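/- For every integer n ≥ 2 and every 0 ≤ k ≤ n, the number of partitions π ∈ NC^B(n-1,1) with rank(π) = k equals C(n,k)². -/

import Mathlib

/-!  Common setup: annular non-crossing partitions of type B, following
Goulden–Nica–Oancea, "Enumerative properties of NC^(B)(p,q)". -/

/-- The underlying set `{±1, …, ±n}`, realized inside `ℤ`. -/
def signedSet (n : ℕ) : Set ℤ := {x : ℤ | x ≠ 0 ∧ |x| ≤ (n : ℤ)}

/-- Membership in the hyperoctahedral group `B_n`, realized as the permutations of `ℤ`
that commute with negation and fix every point outside `{±1, …, ±n}`. -/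
def inB (n : ℕ) (π : Equiv.Perm ℤ) : Prop :=
  (∀ x : ℤ, π (-x) = -(π x)) ∧ ∀ x : ℤ, x ∉ signedSet n → π x = x

/-- The set of generators of `B_n`:
`(i,j)(-i,-j)`, `(i,-j)(-i,j)` for `1 ≤ i ≠ j ≤ n`, and `(i,-i)` for `1 ≤ i ≤ n`. -/
def genB (n : ℕ) : Set (Equiv.Perm ℤ) :=
  {π | (∃ i j : ℤ, 1 ≤ i ∧ i ≤ (n : ℤ) ∧ 1 ≤ j ∧ j ≤ (n : ℤ) ∧ i ≠ j ∧
          π = Equiv.swap i j * Equiv.swap (-i) (-j)) ∨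
       (∃ i j : ℤ, 1 ≤ i ∧ i ≤ (n : ℤ) ∧ 1 ≤ j ∧ j ≤ (n : ℤ) ∧ i ≠ j ∧
          π = Equiv.swap i (-j) * Equiv.swap (-i) j) ∨
       (∃ i : ℤ, 1 ≤ i ∧ i ≤ (n : ℤ) ∧ π = Equiv.swap i (-i))}

/-- The length function `ℓ_B` on `B_n`: the least `k` such that `τ` is a product of `k`
generators from `genB n` (the empty product being the identity). -/
noncomputable def lenB (n : ℕ) (τ : Equiv.Perm ℤ) : ℕ :=
  sInf {k : ℕ | ∃ l : List (Equiv.Perm ℤ),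
    l.length = k ∧ (∀ g ∈ l, g ∈ genB n) ∧ l.prod = τ}

/-- The partial order on `B_n`:  `τ ≤ σ` iff `ℓ_B(σ) = ℓ_B(τ) + ℓ_B(τ⁻¹σ)`. -/
def leB (n : ℕ) (τ σ : Equiv.Perm ℤ) : Prop :=
  lenB n σ = lenB n τ + lenB n (τ⁻¹ * σ)

/-- The permutation `γ_{p,q} = (1,…,p,-1,…,-p)(p+1,…,p+q,-(p+1),…,-(p+q))`. -/
def gammaPQ (p q : ℕ) : Equiv.Perm ℤ :=
  (((List.range p).map fun i => ((i : ℤ) + 1)) ++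
      ((List.range p).map fun i => -((i : ℤ) + 1))).formPerm *
    (((List.range q).map fun i => ((p : ℤ) + (i : ℤ) + 1)) ++
      ((List.range q).map fun i => -((p : ℤ) + (i : ℤ) + 1))).formPerm

/-- The long cycle `γ_n = (1,…,n,-1,…,-n)` of `B_n` (disc case). -/
def gammaDisc (n : ℕ) : Equiv.Perm ℤ :=
  (((List.range n).map fun i => ((i : ℤ) + 1)) ++
    ((List.range n).map fun i => -((i : ℤ) + 1))).formPerm

/-- The annular non-crossing permutations of type B: `S^B_nc(p,q) = [ε, γ_{p,q}] ⊆ B_{p+q}`. -/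
def SncB (p q : ℕ) : Set (Equiv.Perm ℤ) :=
  {τ | inB (p + q) τ ∧ leB (p + q) τ (gammaPQ p q)}

/-- The orbit of `x` under the permutation `τ`. -/
def permOrbit (τ : Equiv.Perm ℤ) (x : ℤ) : Set ℤ := {y | ∃ m : ℤ, (τ ^ m) x = y}

/-- The partition `Ω(τ)` of `{±1,…,±n}` into orbits of `τ`. -/
def orbitsOn (n : ℕ) (τ : Equiv.Perm ℤ) : Set (Set ℤ) :=
  {A | ∃ x ∈ signedSet n, A = permOrbit τ x}

/-- The negation `-A` of a set `A ⊆ ℤ`. -/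
def negSet (A : Set ℤ) : Set ℤ := {x | -x ∈ A}

/-- The partition `Ω̃(τ)`, obtained from `Ω(τ)` by merging all inversion-invariant orbits
(orbits `A` with `A = -A`) into a single block. -/
def omegaTilde (n : ℕ) (τ : Equiv.Perm ℤ) : Set (Set ℤ) :=
  {A | A ∈ orbitsOn n τ ∧ negSet A ≠ A} ∪
    {B | B = ⋃₀ {A | A ∈ orbitsOn n τ ∧ negSet A = A} ∧ B.Nonempty}

/-- The annular non-crossing partitions of type B: `NC^B(p,q) = {Ω̃(τ) : τ ∈ S^B_nc(p,q)}`. -/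
def NCB (p q : ℕ) : Set (Set (Set ℤ)) :=
  {π | ∃ τ ∈ SncB p q, π = omegaTilde (p + q) τ}

/-- The type B non-crossing partitions of the disc: `NC^B(n) = {Ω̃(τ) : τ ∈ B_n, τ ≤ γ_n}`. -/
def NCBdisc (n : ℕ) : Set (Set (Set ℤ)) :=
  {π | ∃ τ, inB n τ ∧ leB n τ (gammaDisc n) ∧ π = omegaTilde n τ}

/-- Reverse refinement order on partitions: every block of `π` is contained in a block of `ρ`. -/
def refines (π ρ : Set (Set ℤ)) : Prop := ∀ A ∈ π, ∃ B ∈ ρ, A ⊆ B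

/-- The rank of a partition of `{±1,…,±n}`:
`n` minus half the number of blocks `A` with `A ≠ -A`. -/
noncomputable def rankNCB (n : ℕ) (π : Set (Set ℤ)) : ℕ :=
  n - {A | A ∈ π ∧ negSet A ≠ A}.ncard / 2

/-- The inner point set `{±(p+1), …, ±(p+q)}`. -/
def innerSet (p q : ℕ) : Set ℤ := {x : ℤ | (p : ℤ) < |x| ∧ |x| ≤ (p : ℤ) + (q : ℤ)}

/-- The connectivity of `π ∈ NC^B(p,q)`: half the number of blocks `A` with `A ≠ -A`
meeting both `{±1,…,±p}` and `{±(p+1),…,±(p+q)}`. -/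
noncomputable def connectivity (p q : ℕ) (π : Set (Set ℤ)) : ℕ :=
  {A | A ∈ π ∧ negSet A ≠ A ∧ (A ∩ signedSet p).Nonempty ∧
    (A ∩ innerSet p q).Nonempty}.ncard / 2

/-- The number of exterior pairs of blocks `{A, -A}` (with `A ≠ -A`, `A ⊆ {±1,…,±p}`). -/
noncomputable def extPairs (p : ℕ) (π : Set (Set ℤ)) : ℕ :=
  {A | A ∈ π ∧ negSet A ≠ A ∧ A ⊆ signedSet p}.ncard / 2

/-- The number of interior pairs of blocks `{A, -A}`
(with `A ≠ -A`, `A ⊆ {±(p+1),…,±(p+q)}`). -/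
noncomputable def intPairs (p q : ℕ) (π : Set (Set ℤ)) : ℕ :=
  {A | A ∈ π ∧ negSet A ≠ A ∧ A ⊆ innerSet p q}.ncard / 2

/-- The minimum `0̂` of `NC^B(p,q)` (with `n = p+q`): the partition into singletons. -/
def botNCB (n : ℕ) : Set (Set ℤ) := {A | ∃ x ∈ signedSet n, A = {x}}

/-- The maximum `1̂` of `NC^B(p,q)` (with `n = p+q`): the partition with a single block. -/
def topNCB (n : ℕ) : Set (Set ℤ) := {signedSet n}

/-- The orbit of `x` under the subgroup generated by `{τ, γ}`. -/
def jointOrbit (τ γ : Equiv.Perm ℤ) (x : ℤ) : Set ℤ :=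
  {y | ∃ g ∈ Subgroup.closure ({τ, γ} : Set (Equiv.Perm ℤ)), g x = y}

/-- The orbits on `{±1,…,±n}` of the subgroup generated by `{τ, γ}`. -/
def jointOrbitsOn (n : ℕ) (τ γ : Equiv.Perm ℤ) : Set (Set ℤ) :=
  {Y | ∃ x ∈ signedSet n, Y = jointOrbit τ γ x}

open Equiv

def rf (x y : ℤ) : Equiv.Perm ℤ :=
  if y = -x then Equiv.swap x (-x) else Equiv.swap x y * Equiv.swap (-x) (-y)

theorem rf_apply (x y : ℤ) (hx : x ≠ 0) (hy : y ≠ 0) (hxy : x ≠ y) (z : ℤ) :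
    rf x y z = if z = x then y else if z = y then x else if z = -x then -y
      else if z = -y then -x else z := by
  unfold rf
  split_ifs <;> simp [Equiv.swap_apply_def] <;> grind

theorem rf_left {x y : ℤ} (hx : x ≠ 0) (hy : y ≠ 0) (hxy : x ≠ y) : rf x y x = y := by
  rw [rf_apply x y hx hy hxy]; simp

theorem rf_right {x y : ℤ} (hx : x ≠ 0) (hy : y ≠ 0) (hxy : x ≠ y) : rf x y y = x := by
  rw [rf_apply x y hx hy hxy]; grind

theorem rf_neg {x y : ℤ} (hx : x ≠ 0) (hy : y ≠ 0) (hxy : x ≠ y) (z : ℤ) :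
    rf x y (-z) = - rf x y z := by
  rw [rf_apply x y hx hy hxy, rf_apply x y hx hy hxy]; grind

theorem rf_sq {x y : ℤ} (hx : x ≠ 0) (hy : y ≠ 0) (hxy : x ≠ y) :
    rf x y * rf x y = 1 := by
  ext z
  rw [Equiv.Perm.mul_apply, rf_apply x y hx hy hxy, rf_apply x y hx hy hxy]
  simp only [Equiv.Perm.one_apply]
  grind

theorem rf_inv {x y : ℤ} (hx : x ≠ 0) (hy : y ≠ 0) (hxy : x ≠ y) :
    (rf x y)⁻¹ = rf x y := inv_eq_of_mul_eq_one_left (rf_sq hx hy hxy)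

theorem mem_signed {n : ℕ} {x : ℤ} : x ∈ signedSet n ↔ x ≠ 0 ∧ -(n : ℤ) ≤ x ∧ x ≤ n := by
  unfold signedSet; simp [abs_le]

theorem neg_mem_signed {n : ℕ} {x : ℤ} : -x ∈ signedSet n ↔ x ∈ signedSet n := by
  simp only [mem_signed]; grind

theorem genB_iff {n : ℕ} {g : Equiv.Perm ℤ} :
    g ∈ genB n ↔ ∃ x y, x ∈ signedSet n ∧ y ∈ signedSet n ∧ x ≠ y ∧ g = rf x y := by
  constructor
  · rintro (⟨i, j, h1, h2, h3, h4, h5, rfl⟩ | ⟨i, j, h1, h2, h3, h4, h5, rfl⟩ | ⟨i, h1, h2, rfl⟩)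
    · refine ⟨i, j, ?_, ?_, h5, ?_⟩
      · rw [mem_signed]; omega
      · rw [mem_signed]; omega
      · rw [rf, if_neg (by omega)]
    · refine ⟨i, -j, ?_, ?_, by omega, ?_⟩
      · rw [mem_signed]; omega
      · rw [mem_signed]; omega
      · rw [rf, if_neg (by omega), neg_neg]
    · refine ⟨i, -i, ?_, ?_, by omega, ?_⟩
      · rw [mem_signed]; omega
      · rw [mem_signed]; omega
      · rw [rf, if_pos rfl]
  · rintro ⟨x, y, hx, hy, hxy, rfl⟩
    rw [mem_signed] at hx hy
    by_cases hyx : y = -x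
    · right; right
      refine ⟨|x|, ?_, ?_, ?_⟩
      · have := abs_pos.mpr hx.1; omega
      · rw [abs_le]; omega
      · ext z
        rw [rf_apply x y hx.1 hy.1 hxy, Equiv.swap_apply_def]
        rcases abs_cases x with h | h <;> grind
    · by_cases hs : 0 < x * y
      · left
        refine ⟨|x|, |y|, ?_, ?_, ?_, ?_, ?_, ?_⟩
        · have := abs_pos.mpr hx.1; omega
        · rw [abs_le]; omega
        · have := abs_pos.mpr hy.1; omega
        · rw [abs_le]; omega
        · intro h; rcases abs_eq_abs.mp h with h | h <;> omega
        · rcases mul_pos_iff.mp hs with h | h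
          · rw [abs_of_pos h.1, abs_of_pos h.2, rf, if_neg hyx]
          · rw [abs_of_neg h.1, abs_of_neg h.2, neg_neg, neg_neg]
            ext z
            rw [rf_apply x y hx.1 hy.1 hxy, Equiv.Perm.mul_apply, Equiv.swap_apply_def,
              Equiv.swap_apply_def]
            grind
      · right; left
        have hs' : x * y < 0 := lt_of_le_of_ne (not_lt.mp hs) (mul_ne_zero hx.1 hy.1)
        refine ⟨|x|, |y|, ?_, ?_, ?_, ?_, ?_, ?_⟩
        · have := abs_pos.mpr hx.1; omega
        · rw [abs_le]; omega
        · have := abs_pos.mpr hy.1; omega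
        · rw [abs_le]; omega
        · intro h; rcases abs_eq_abs.mp h with h | h <;> omega
        · rcases mul_neg_iff.mp hs' with h | h
          · rw [abs_of_pos h.1, abs_of_neg h.2, rf, if_neg hyx, neg_neg]
          · rw [abs_of_neg h.1, abs_of_pos h.2, neg_neg]
            ext z
            rw [rf_apply x y hx.1 hy.1 hxy, Equiv.Perm.mul_apply, Equiv.swap_apply_def,
              Equiv.swap_apply_def]
            grind

theorem rf_inB {n : ℕ} {x y : ℤ} (hx : x ∈ signedSet n) (hy : y ∈ signedSet n) (hxy : x ≠ y) :
    inB n (rf x y) := by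
  have h0 := hx.1
  have h1 := hy.1
  refine ⟨rf_neg h0 h1 hxy, fun z hz => ?_⟩
  rw [rf_apply x y h0 h1 hxy]
  have h2 := (neg_mem_signed.mpr hx)
  have h3 := (neg_mem_signed.mpr hy)
  grind

theorem inB_mul {n : ℕ} {σ τ : Equiv.Perm ℤ} (h : inB n σ) (h' : inB n τ) : inB n (σ * τ) := by
  refine ⟨fun x => ?_, fun x hx => ?_⟩
  · simp [h.1, h'.1]
  · simp [h.2 x hx, h'.2 x hx]

theorem inB_inv {n : ℕ} {τ : Equiv.Perm ℤ} (h : inB n τ) : inB n τ⁻¹ := by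
  refine ⟨fun x => ?_, fun x hx => ?_⟩
  · rw [Equiv.Perm.inv_eq_iff_eq, h.1]; simp
  · rw [Equiv.Perm.inv_eq_iff_eq, h.2 x hx]

theorem inB_one {n : ℕ} : inB n 1 := ⟨fun _ => rfl, fun _ _ => rfl⟩

theorem inB_mem {n : ℕ} {τ : Equiv.Perm ℤ} (h : inB n τ) {x : ℤ} :
    τ x ∈ signedSet n ↔ x ∈ signedSet n := by
  constructor
  · intro hx; by_contra hc; rw [h.2 x hc] at hx; exact hc hx
  · intro hx; by_contra hc
    have := h.2 _ hc
    rw [τ.injective this] at hc; exact hc hx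

/-- fixed space -/
def FixS (n : ℕ) (τ : Equiv.Perm ℤ) : Submodule ℚ (ℤ → ℚ) where
  carrier := {u | (∀ x, u (-x) = - u x) ∧ (∀ x, x ∉ signedSet n → u x = 0) ∧ ∀ x, u (τ x) = u x}
  add_mem' := by
    rintro u v ⟨h1, h2, h3⟩ ⟨h1', h2', h3'⟩
    refine ⟨fun x => ?_, fun x hx => ?_, fun x => ?_⟩
    · simp [h1, h1']; ring
    · simp [h2 x hx, h2' x hx]
    · simp [h3, h3']
  zero_mem' := by simp
  smul_mem' := by
    rintro c u ⟨h1, h2, h3⟩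
    refine ⟨fun x => ?_, fun x hx => ?_, fun x => ?_⟩
    · simp [h1]
    · simp [h2 x hx]
    · simp [h3]

theorem mem_FixS {n : ℕ} {τ : Equiv.Perm ℤ} {u : ℤ → ℚ} : u ∈ FixS n τ ↔
    (∀ x, u (-x) = - u x) ∧ (∀ x, x ∉ signedSet n → u x = 0) ∧ ∀ x, u (τ x) = u x := Iff.rfl

noncomputable def cB (n : ℕ) (τ : Equiv.Perm ℤ) : ℕ := Module.finrank ℚ (FixS n τ)

def evalFin (n : ℕ) : FixS n 1 →ₗ[ℚ] (Fin n → ℚ) where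
  toFun u := fun i => u.1 ((i : ℤ) + 1)
  map_add' := by intros; rfl
  map_smul' := by intros; rfl

theorem evalFin_bij (n : ℕ) : Function.Bijective (evalFin n) := by
  constructor
  · rw [← LinearMap.ker_eq_bot, LinearMap.ker_eq_bot']
    rintro ⟨u, hu⟩ h
    have h' : ∀ i : Fin n, u ((i : ℤ) + 1) = 0 := fun i => congrFun h i
    ext x
    change u x = 0
    by_cases hx : x ∈ signedSet n
    · rw [mem_signed] at hx
      by_cases hp : 0 < x
      · have := h' ⟨(x - 1).toNat, by omega⟩
        rw [show (((⟨(x - 1).toNat, by omega⟩ : Fin n) : ℕ) : ℤ) + 1 = x by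
          simp only; omega] at this
        exact this
      · have := h' ⟨(-x - 1).toNat, by omega⟩
        rw [show (((⟨(-x - 1).toNat, by omega⟩ : Fin n) : ℕ) : ℤ) + 1 = -x by
          simp only; omega, hu.1] at this
        linarith
    · exact hu.2.1 x hx
  · intro w
    refine ⟨⟨fun x => if h : 1 ≤ x ∧ x ≤ n then w ⟨(x - 1).toNat, by omega⟩ else
      if h : 1 ≤ -x ∧ -x ≤ n then - w ⟨(-x - 1).toNat, by omega⟩ else 0, ?_, ?_, ?_⟩, ?_⟩
    · intro x
      by_cases h1 : 1 ≤ x ∧ x ≤ n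
      · have : ¬ (1 ≤ -x ∧ -x ≤ n) := by omega
        simp [h1, this]
      · by_cases h2 : 1 ≤ -x ∧ -x ≤ n
        · simp [h1, h2]
        · simp [h1, h2]
    · intro x hx
      rw [mem_signed] at hx
      have : ¬ (1 ≤ -x ∧ -x ≤ n) := by omega
      have : ¬ (1 ≤ x ∧ x ≤ n) := by omega
      simp [*]
    · intro x; rfl
    · ext i
      have : (1:ℤ) ≤ (i:ℤ) + 1 ∧ (i:ℤ) + 1 ≤ n := by omega
      simp only [evalFin, LinearMap.coe_mk, AddHom.coe_mk, this, and_self, dite_true]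
      congr 1
      ext; simp

noncomputable def evalEquiv (n : ℕ) : FixS n 1 ≃ₗ[ℚ] (Fin n → ℚ) :=
  LinearEquiv.ofBijective (evalFin n) (evalFin_bij n)

instance fdOne (n : ℕ) : FiniteDimensional ℚ (FixS n 1) :=
  Module.Finite.equiv (evalEquiv n).symm

theorem cB_one (n : ℕ) : cB n 1 = n := by
  unfold cB; rw [(evalEquiv n).finrank_eq]; simp

theorem FixS_le_one (n : ℕ) (τ : Equiv.Perm ℤ) : FixS n τ ≤ FixS n 1 :=
  fun _ hu => ⟨hu.1, hu.2.1, fun _ => rfl⟩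

instance fdFix (n : ℕ) (τ : Equiv.Perm ℤ) : FiniteDimensional ℚ (FixS n τ) :=
  Submodule.finiteDimensional_of_le (FixS_le_one n τ)

theorem cB_le (n : ℕ) (τ : Equiv.Perm ℤ) : cB n τ ≤ n := by
  conv_rhs => rw [← cB_one n]
  exact Submodule.finrank_mono (FixS_le_one n τ)

theorem FixS_inv (n : ℕ) (τ : Equiv.Perm ℤ) : FixS n τ⁻¹ = FixS n τ := by
  ext u
  simp only [mem_FixS]
  refine and_congr_right fun _ => and_congr_right fun _ => ⟨fun h x => ?_, fun h x => ?_⟩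
  · have := h (τ x); simpa using this.symm
  · have := h (τ⁻¹ x); simpa using this.symm

theorem cB_inv (n : ℕ) (τ : Equiv.Perm ℤ) : cB n τ⁻¹ = cB n τ := by
  unfold cB; rw [FixS_inv]

theorem finrank_le_aux {E : Type*} [AddCommGroup E] [Module ℚ E] (W W' : Submodule ℚ E)
    [FiniteDimensional ℚ W] [FiniteDimensional ℚ W'] (φ : E →ₗ[ℚ] ℚ)
    (h : ∀ u ∈ W, φ u = 0 → u ∈ W') : Module.finrank ℚ W ≤ Module.finrank ℚ W' + 1 := by
  have h1 := (φ.domRestrict W).finrank_range_add_finrank_ker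
  have h2 : Module.finrank ℚ (LinearMap.range (φ.domRestrict W)) ≤ 1 := by
    have := Submodule.finrank_le (LinearMap.range (φ.domRestrict W))
    simpa using this
  have h3 : Module.finrank ℚ (LinearMap.ker (φ.domRestrict W)) ≤ Module.finrank ℚ W' := by
    rw [← Submodule.finrank_map_subtype_eq]
    apply Submodule.finrank_mono
    rintro _ ⟨u, hu, rfl⟩
    exact h _ u.2 hu
  omega

def evF (x : ℤ) : (ℤ → ℚ) →ₗ[ℚ] ℚ where
  toFun u := u x
  map_add' := by intros; rfl
  map_smul' := by intros; rfl

def diffF (x y : ℤ) : (ℤ → ℚ) →ₗ[ℚ] ℚ := evF x - evF y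

theorem fix_rf {n : ℕ} {u : ℤ → ℚ} (hu : ∀ x, u (-x) = - u x) {x y : ℤ}
    (hx : x ∈ signedSet n) (hy : y ∈ signedSet n) (hxy : x ≠ y)
    (h : u x = u y) (z : ℤ) : u (rf x y z) = u z := by
  rw [rf_apply x y hx.1 hy.1 hxy]
  split_ifs <;> simp_all

theorem cB_mul_rf {n : ℕ} (τ : Equiv.Perm ℤ) {x y : ℤ}
    (hx : x ∈ signedSet n) (hy : y ∈ signedSet n) (hxy : x ≠ y) :
    cB n τ ≤ cB n (τ * rf x y) + 1 := by
  apply finrank_le_aux _ _ (diffF x y)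
  intro u hu h
  have h' : u x = u y := by simpa [diffF, evF, sub_eq_zero] using h
  refine ⟨hu.1, hu.2.1, fun z => ?_⟩
  rw [Equiv.Perm.mul_apply, hu.2.2, fix_rf hu.1 hx hy hxy h']

theorem cB_rf_mul {n : ℕ} (τ : Equiv.Perm ℤ) {x y : ℤ}
    (hx : x ∈ signedSet n) (hy : y ∈ signedSet n) (hxy : x ≠ y) :
    cB n τ ≤ cB n (rf x y * τ) + 1 := by
  have := cB_mul_rf τ⁻¹ hx hy hxy
  rwa [cB_inv, ← cB_inv n (τ⁻¹ * _), mul_inv_rev, inv_inv, rf_inv hx.1 hy.1 hxy] at this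

theorem cB_lt_of {n : ℕ} (τ : Equiv.Perm ℤ) {x y : ℤ}
    (hx : x ∈ signedSet n) (hy : y ∈ signedSet n) (hxy : x ≠ y)
    (h : ∀ u ∈ FixS n τ, u x = u y) (u : ℤ → ℚ) (hu : u ∈ FixS n (τ * rf x y))
    (hu' : u ∉ FixS n τ) : cB n (τ * rf x y) = cB n τ + 1 := by
  have h1 : cB n τ < cB n (τ * rf x y) := by
    apply Submodule.finrank_lt_finrank_of_lt
    refine lt_of_le_of_ne (fun v hv => ⟨hv.1, hv.2.1, fun z => ?_⟩) (fun h => hu' (h ▸ hu))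
    rw [Equiv.Perm.mul_apply, hv.2.2, fix_rf hv.1 hx hy hxy (h v hv)]
  have h2 := cB_mul_rf (τ * rf x y) hx hy hxy
  rw [mul_assoc, rf_sq hx.1 hy.1 hxy, mul_one] at h2
  omega

def dl (a : ℤ) : ℤ → ℚ := fun x => if x = a then 1 else if x = -a then -1 else 0

theorem dl_anti {a : ℤ} (ha : a ≠ 0) (x : ℤ) : dl a (-x) = - dl a x := by
  unfold dl; split_ifs <;> first | omega | simp

theorem dl_supp {n : ℕ} {a : ℤ} (ha : a ∈ signedSet n) (x : ℤ) (hx : x ∉ signedSet n) :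
    dl a x = 0 := by
  have := neg_mem_signed.mpr ha
  unfold dl; split_ifs <;> simp_all

theorem dl_mem_one {n : ℕ} {a : ℤ} (ha : a ∈ signedSet n) : dl a ∈ FixS n 1 :=
  ⟨dl_anti ha.1, dl_supp ha, fun _ => rfl⟩

theorem dl_mem {n : ℕ} {τ : Equiv.Perm ℤ} (hτ : inB n τ) {a : ℤ} (ha : a ∈ signedSet n)
    (h : τ a = a) : dl a ∈ FixS n τ := by
  refine ⟨dl_anti ha.1, dl_supp ha, fun x => ?_⟩
  unfold dl
  have h1 : τ x = a ↔ x = a := by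
    conv_lhs => rw [← h]
    exact τ.injective.eq_iff
  have h2 : τ x = -a ↔ x = -a := by
    conv_lhs => rw [← h, ← hτ.1]
    exact τ.injective.eq_iff
  simp [h1, h2]

theorem cB_split {n : ℕ} {τ : Equiv.Perm ℤ} (hτ : inB n τ) {x y : ℤ}
    (hx : x ∈ signedSet n) (hxy : x ≠ y) (h : τ y = x) :
    cB n (τ * rf x y) = cB n τ + 1 := by
  have hy : y ∈ signedSet n := by rw [← inB_mem hτ, h]; exact hx
  apply cB_lt_of τ hx hy hxy (fun u hu => by rw [← h, hu.2.2]) (dl x)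
  · apply dl_mem (inB_mul hτ (rf_inB hx hy hxy)) hx
    rw [Equiv.Perm.mul_apply, rf_left hx.1 hy.1 hxy, h]
  · intro hc
    have := hc.2.2 y
    rw [h] at this
    unfold dl at this
    have hh := hx.1
    split_ifs at this <;> first | omega | norm_num at this

theorem eq_one_of_cB {n : ℕ} {τ : Equiv.Perm ℤ} (hτ : inB n τ) (h : cB n τ = n) : τ = 1 := by
  by_contra hne
  obtain ⟨y, hy⟩ : ∃ y, τ y ≠ y := by
    by_contra hc; push Not at hc; exact hne (Equiv.ext hc)
  have hyS : y ∈ signedSet n := by by_contra hc; exact hy (hτ.2 y hc)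
  have := cB_split hτ ((inB_mem hτ).mpr hyS) hy rfl
  have := cB_le n (τ * rf (τ y) y)
  omega

theorem exists_list {n : ℕ} : ∀ (k : ℕ) (τ : Equiv.Perm ℤ), inB n τ → cB n τ + k = n →
    ∃ l : List (Equiv.Perm ℤ), l.length = k ∧ (∀ g ∈ l, g ∈ genB n) ∧ l.prod = τ := by
  intro k
  induction k with
  | zero => 
    intro τ hτ h
    exact ⟨[], rfl, by simp, by simp [eq_one_of_cB hτ h]⟩
  | succ k ih =>
    intro τ hτ h
    have hne : τ ≠ 1 := by rintro rfl; rw [cB_one] at h; omega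
    obtain ⟨y, hy⟩ : ∃ y, τ y ≠ y := by
      by_contra hc; push Not at hc; exact hne (Equiv.ext hc)
    have hyS : y ∈ signedSet n := by by_contra hc; exact hy (hτ.2 y hc)
    have hxS := ((inB_mem hτ).mpr hyS)
    have h1 := cB_split hτ hxS hy rfl
    obtain ⟨l, hl1, hl2, hl3⟩ := ih (τ * rf (τ y) y) (inB_mul hτ (rf_inB hxS hyS hy)) (by omega)
    refine ⟨l ++ [rf (τ y) y], by simp [hl1], ?_, ?_⟩
    · intro g hg
      rcases List.mem_append.mp hg with hg | hg
      · exact hl2 g hg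
      · rw [List.mem_singleton] at hg
        exact genB_iff.mpr ⟨_, _, hxS, hyS, hy, hg⟩
    · simp [hl3, mul_assoc, rf_sq hxS.1 hyS.1 hy]

theorem list_bound {n : ℕ} (l : List (Equiv.Perm ℤ)) (h : ∀ g ∈ l, g ∈ genB n) :
    n ≤ cB n l.prod + l.length := by
  induction l with
  | nil => simp [cB_one]
  | cons g l ih =>
    have h1 := ih (fun g hg => h g (List.mem_cons_of_mem _ hg))
    obtain ⟨x, y, hx, hy, hxy, rfl⟩ := genB_iff.mp (h g List.mem_cons_self)
    have := cB_rf_mul l.prod hx hy hxy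
    simp only [List.prod_cons, List.length_cons]
    omega

theorem lenB_eq {n : ℕ} {τ : Equiv.Perm ℤ} (hτ : inB n τ) : lenB n τ + cB n τ = n := by
  have hc := cB_le n τ
  obtain ⟨l, hl⟩ := exists_list (n - cB n τ) τ hτ (by omega)
  have h1 : lenB n τ ≤ n - cB n τ := Nat.sInf_le ⟨l, hl⟩
  obtain ⟨l', h2, h3, h4⟩ := Nat.sInf_mem (s := {k : ℕ | ∃ l : List (Equiv.Perm ℤ),
    l.length = k ∧ (∀ g ∈ l, g ∈ genB n) ∧ l.prod = τ}) ⟨_, l, hl⟩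
  have h5 := list_bound l' h3
  rw [h4, h2] at h5
  change n ≤ cB n τ + lenB n τ at h5
  omega

theorem leB_iff {n : ℕ} {τ γ : Equiv.Perm ℤ} (hτ : inB n τ) (hγ : inB n γ) (h0 : cB n γ = 0) :
    leB n τ γ ↔ cB n τ + cB n (τ⁻¹ * γ) = n := by
  unfold leB
  have h1 := lenB_eq hτ
  have h2 := lenB_eq hγ
  have h3 := lenB_eq (inB_mul (inB_inv hτ) hγ)
  omega

theorem cB_add_le {n : ℕ} (τ γ : Equiv.Perm ℤ) (h0 : cB n γ = 0) :
    cB n τ + cB n (τ⁻¹ * γ) ≤ n := by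
  have hd : Disjoint (FixS n τ) (FixS n (τ⁻¹ * γ)) := by
    rw [Submodule.disjoint_def]
    intro u h1 h2
    have : FixS n γ = ⊥ := Submodule.finrank_eq_zero.mp h0
    rw [← Submodule.mem_bot ℚ, ← this]
    refine ⟨h1.1, h1.2.1, fun x => ?_⟩
    have := h2.2.2 x
    rw [← h1.2.2] at this
    simpa using this
  have h1 := Submodule.finrank_sup_add_finrank_inf_eq (FixS n τ) (FixS n (τ⁻¹ * γ))
  rw [hd.eq_bot, finrank_bot, add_zero] at h1
  unfold cB
  rw [← h1]
  have := Submodule.finrank_mono (sup_le (FixS_le_one n τ) (FixS_le_one n (τ⁻¹ * γ)))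
  refine this.trans (le_of_eq (cB_one n))

theorem mem_permOrbit_self (τ : Equiv.Perm ℤ) (x : ℤ) : x ∈ permOrbit τ x := ⟨0, by simp⟩

theorem permOrbit_eq {τ : Equiv.Perm ℤ} {x y : ℤ} (h : y ∈ permOrbit τ x) :
    permOrbit τ y = permOrbit τ x := by
  obtain ⟨m, rfl⟩ := h
  ext z
  constructor
  · rintro ⟨k, rfl⟩; exact ⟨k + m, by rw [zpow_add, Equiv.Perm.mul_apply]⟩
  · rintro ⟨k, rfl⟩
    refine ⟨k - m, ?_⟩
    rw [← Equiv.Perm.mul_apply, ← zpow_add, sub_add_cancel]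

theorem permOrbit_eq_iff {τ : Equiv.Perm ℤ} {x y : ℤ} :
    permOrbit τ y = permOrbit τ x ↔ y ∈ permOrbit τ x :=
  ⟨fun h => h ▸ mem_permOrbit_self τ y, permOrbit_eq⟩

theorem permOrbit_map (τ : Equiv.Perm ℤ) (x : ℤ) : permOrbit τ (τ x) = permOrbit τ x :=
  permOrbit_eq ⟨1, by simp⟩

theorem inB_zpow {n : ℕ} {τ : Equiv.Perm ℤ} (h : inB n τ) (k : ℤ) : inB n (τ ^ k) := by
  induction k with
  | zero => simpa using inB_one
  | succ k ih => rw [zpow_add_one]; exact inB_mul ih h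
  | pred k ih => rw [zpow_sub_one]; exact inB_mul ih (inB_inv h)

theorem negSet_permOrbit {n : ℕ} {τ : Equiv.Perm ℤ} (h : inB n τ) (x : ℤ) :
    negSet (permOrbit τ x) = permOrbit τ (-x) := by
  ext z
  constructor
  · rintro ⟨m, hm⟩; exact ⟨m, by rw [(inB_zpow h m).1, hm, neg_neg]⟩
  · rintro ⟨m, hm⟩
    refine ⟨m, ?_⟩
    rw [(inB_zpow h m).1] at hm
    omega

theorem negSet_negSet (A : Set ℤ) : negSet (negSet A) = A := by
  ext x; simp [negSet]

theorem fix_zpow {n : ℕ} {τ : Equiv.Perm ℤ} {u : ℤ → ℚ} (hu : u ∈ FixS n τ) (k x : ℤ) :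
    u ((τ ^ k) x) = u x := by
  induction k with
  | zero => simp
  | succ k ih => rw [add_comm, zpow_add, zpow_one, Equiv.Perm.mul_apply, hu.2.2, ih]
  | pred k ih =>
    rw [sub_eq_neg_add, zpow_add, zpow_neg_one, Equiv.Perm.mul_apply]
    rw [← ih, ← hu.2.2]; simp

theorem fix_orbit {n : ℕ} {τ : Equiv.Perm ℤ} {u : ℤ → ℚ} (hu : u ∈ FixS n τ) {x y : ℤ}
    (h : y ∈ permOrbit τ x) : u y = u x := by
  obtain ⟨m, rfl⟩ := h; exact fix_zpow hu m x

theorem fix_sym {n : ℕ} {τ : Equiv.Perm ℤ} {u : ℤ → ℚ} (hu : u ∈ FixS n τ) {x : ℤ}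
    (h : -x ∈ permOrbit τ x) : u x = 0 := by
  have := fix_orbit hu h
  rw [hu.1] at this; linarith

theorem permOrbit_sub {n : ℕ} {τ : Equiv.Perm ℤ} (h : inB n τ) {x y : ℤ}
    (hy : y ∈ permOrbit τ x) : y ∈ signedSet n ↔ x ∈ signedSet n := by
  obtain ⟨m, rfl⟩ := hy; exact inB_mem (inB_zpow h m)

open Classical in
theorem exists_fix {n : ℕ} {τ : Equiv.Perm ℤ} (hτ : inB n τ) {a : ℤ} (ha : a ∈ signedSet n)
    (h : -a ∉ permOrbit τ a) : ∃ u ∈ FixS n τ, u a = 1 := by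
  refine ⟨fun x => if permOrbit τ x = permOrbit τ a then 1 else
    if permOrbit τ (-x) = permOrbit τ a then -1 else 0, ⟨fun x => ?_, fun x hx => ?_, fun x => ?_⟩,
    by simp⟩
  · by_cases h1 : permOrbit τ x = permOrbit τ a
    · have h2 : permOrbit τ (-x) ≠ permOrbit τ a := by
        rw [← negSet_permOrbit hτ, h1, negSet_permOrbit hτ]
        intro h3
        exact h (permOrbit_eq_iff.mp h3)
      simp [h1, h2]
    · by_cases h2 : permOrbit τ (-x) = permOrbit τ a
      · simp [h1, h2]
      · simp [h1, h2]
  · have h1 : permOrbit τ x ≠ permOrbit τ a := fun hc =>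
      hx ((permOrbit_sub hτ (permOrbit_eq_iff.mp hc)).mpr ha)
    have h2 : permOrbit τ (-x) ≠ permOrbit τ a := fun hc =>
      hx (neg_mem_signed.mp ((permOrbit_sub hτ (permOrbit_eq_iff.mp hc)).mpr ha))
    simp [h1, h2]
  · simp only [permOrbit_map, ← hτ.1]

theorem signed_finite (n : ℕ) : (signedSet n).Finite :=
  (Set.finite_Icc (-(n:ℤ)) n).subset fun x hx => (mem_signed.mp hx).2

theorem orbitsOn_finite (n : ℕ) (τ : Equiv.Perm ℤ) : (orbitsOn n τ).Finite := by
  have : orbitsOn n τ = permOrbit τ '' signedSet n := by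
    ext A; simp [orbitsOn, eq_comm]
  rw [this]; exact (signed_finite n).image _

def nsOrb (n : ℕ) (τ : Equiv.Perm ℤ) : Set (Set ℤ) := {A | A ∈ orbitsOn n τ ∧ negSet A ≠ A}

def halfOrb (n : ℕ) (τ : Equiv.Perm ℤ) : Set (Set ℤ) :=
  {A | A ∈ nsOrb n τ ∧ WellOrderingRel A (negSet A)}

theorem halfOrb_finite (n : ℕ) (τ : Equiv.Perm ℤ) : (halfOrb n τ).Finite :=
  (orbitsOn_finite n τ).subset fun _ h => h.1.1

theorem nsOrb_neg {n : ℕ} {τ : Equiv.Perm ℤ} (hτ : inB n τ) {A : Set ℤ} (hA : A ∈ nsOrb n τ) :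
    negSet A ∈ nsOrb n τ := by
  obtain ⟨⟨x, hx, rfl⟩, h⟩ := hA
  refine ⟨⟨-x, neg_mem_signed.mpr hx, negSet_permOrbit hτ x⟩, ?_⟩
  rw [negSet_negSet]; exact h.symm

theorem halfOrb_asymm {n : ℕ} {τ : Equiv.Perm ℤ} {A : Set ℤ} (hA : A ∈ halfOrb n τ) :
    negSet A ∉ halfOrb n τ := by
  intro h
  have h1 := h.2
  rw [negSet_negSet] at h1
  exact asymm h1 hA.2

theorem nsOrb_card {n : ℕ} {τ : Equiv.Perm ℤ} (hτ : inB n τ) :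
    (nsOrb n τ).ncard = 2 * (halfOrb n τ).ncard := by
  have h1 : nsOrb n τ = halfOrb n τ ∪ negSet '' halfOrb n τ := by
    ext A
    constructor
    · intro hA
      rcases trichotomous_of WellOrderingRel A (negSet A) with h | h | h
      · left; exact ⟨hA, h⟩
      · exact absurd h.symm hA.2
      · right
        refine ⟨negSet A, ⟨nsOrb_neg hτ hA, ?_⟩, negSet_negSet A⟩
        rw [negSet_negSet]; exact h
    · rintro (h | ⟨B, hB, rfl⟩)
      · exact h.1
      · exact nsOrb_neg hτ hB.1
  have h2 : Disjoint (halfOrb n τ) (negSet '' halfOrb n τ) := by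
    rw [Set.disjoint_left]
    rintro _ h ⟨B, hB, rfl⟩
    exact halfOrb_asymm hB h
  rw [h1, Set.ncard_union_eq h2 (halfOrb_finite n τ) ((halfOrb_finite n τ).image _),
    Set.ncard_image_of_injective _ (fun A B h => by rw [← negSet_negSet A, h, negSet_negSet])]
  ring

noncomputable def orep (A : Set ℤ) : ℤ := open Classical in if h : A.Nonempty then h.choose else 0

theorem orep_mem {A : Set ℤ} (h : A.Nonempty) : orep A ∈ A := by
  unfold orep; rw [dif_pos h]; exact h.choose_spec

noncomputable def evHalf (n : ℕ) (τ : Equiv.Perm ℤ) : FixS n τ →ₗ[ℚ] (halfOrb n τ → ℚ) where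
  toFun u := fun A => u.1 (orep A.1)
  map_add' := by intros; rfl
  map_smul' := by intros; rfl

theorem evHalf_spec {n : ℕ} {τ : Equiv.Perm ℤ} (u : FixS n τ) (x : ℤ)
    (h : permOrbit τ x ∈ halfOrb n τ) : evHalf n τ u ⟨_, h⟩ = u.1 x :=
  fix_orbit u.2 (orep_mem ⟨x, mem_permOrbit_self τ x⟩)

open Classical in
theorem evHalf_bij {n : ℕ} {τ : Equiv.Perm ℤ} (hτ : inB n τ) :
    Function.Bijective (evHalf n τ) := by
  constructor
  · rw [← LinearMap.ker_eq_bot, LinearMap.ker_eq_bot']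
    rintro u h
    ext x
    change u.1 x = 0
    have key : ∀ y, permOrbit τ y ∈ halfOrb n τ → u.1 y = 0 := by
      intro y hy
      rw [← evHalf_spec u y hy, h]; rfl
    by_cases hx : x ∈ signedSet n
    · by_cases hs : negSet (permOrbit τ x) = permOrbit τ x
      · apply fix_sym u.2
        rw [negSet_permOrbit hτ] at hs
        exact permOrbit_eq_iff.mp hs
      · have hA : permOrbit τ x ∈ nsOrb n τ := ⟨⟨x, hx, rfl⟩, hs⟩
        rcases trichotomous_of WellOrderingRel (permOrbit τ x) (negSet (permOrbit τ x))
          with h | h | h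
        · exact key x ⟨hA, h⟩
        · exact absurd h.symm hs
        · have := key (-x) (by
            rw [← negSet_permOrbit hτ]
            exact ⟨nsOrb_neg hτ hA, by rw [negSet_negSet]; exact h⟩)
          rw [u.2.1] at this; linarith
    · exact u.2.2.1 x hx
  · intro w
    let v : ℤ → ℚ := fun x => if h : permOrbit τ x ∈ halfOrb n τ then w ⟨_, h⟩ else
      if h : permOrbit τ (-x) ∈ halfOrb n τ then - w ⟨_, h⟩ else 0
    have hv : v ∈ FixS n τ := by
      refine ⟨fun x => ?_, fun x hx => ?_, fun x => ?_⟩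
      · by_cases h1 : permOrbit τ x ∈ halfOrb n τ
        · have h2 := halfOrb_asymm h1
          rw [negSet_permOrbit hτ] at h2
          simp [v, h1, h2]
        · by_cases h2 : permOrbit τ (-x) ∈ halfOrb n τ
          · simp [v, h1, h2]
          · simp [v, h1, h2]
      · have h0 : ∀ y, y ∉ signedSet n → permOrbit τ y ∉ halfOrb n τ := by
          rintro y hy ⟨⟨⟨z, hz, h⟩, _⟩, _⟩
          exact hy ((permOrbit_sub hτ (permOrbit_eq_iff.mp h)).mpr hz)
        have h1 := h0 x hx
        have h2 := h0 (-x) (fun h => hx (neg_mem_signed.mp h))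
        simp [v, h1, h2]
      · have e1 := permOrbit_map τ x
        have e2 : permOrbit τ (- τ x) = permOrbit τ (-x) := by
          rw [← hτ.1, permOrbit_map]
        simp only [v, e1, e2]
    refine ⟨⟨v, hv⟩, ?_⟩
    ext ⟨A, hA⟩
    have hA' := hA
    obtain ⟨⟨⟨z, hz, hAz⟩, _⟩, _⟩ := hA'
    subst hAz
    rw [evHalf_spec ⟨v, hv⟩ z hA]
    exact dif_pos hA

theorem nsOrb_ncard {n : ℕ} {τ : Equiv.Perm ℤ} (hτ : inB n τ) :
    (nsOrb n τ).ncard = 2 * cB n τ := by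
  rw [nsOrb_card hτ]
  unfold cB
  rw [(LinearEquiv.ofBijective (evHalf n τ) (evHalf_bij hτ)).finrank_eq]
  haveI : Fintype (halfOrb n τ) := (halfOrb_finite n τ).fintype
  rw [Module.finrank_fintype_fun_eq_card, ← Nat.card_eq_fintype_card, Nat.card_coe_set_eq]

theorem ns_omega {n : ℕ} {τ : Equiv.Perm ℤ} (hτ : inB n τ) :
    {A | A ∈ omegaTilde n τ ∧ negSet A ≠ A} = nsOrb n τ := by
  ext A
  constructor
  · rintro ⟨h | h, h2⟩
    · exact h
    · exfalso
      apply h2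
      rw [h.1]
      ext x
      constructor
      · rintro ⟨B, ⟨hB, hB'⟩, hx⟩
        refine ⟨B, ⟨hB, hB'⟩, ?_⟩
        rw [← hB']; exact hx
      · rintro ⟨B, ⟨hB, hB'⟩, hx⟩
        refine ⟨B, ⟨hB, hB'⟩, ?_⟩
        rw [← hB'] at hx; exact hx
  · intro h
    exact ⟨Or.inl h, h.2⟩

theorem rank_omega {n : ℕ} {τ : Equiv.Perm ℤ} (hτ : inB n τ) :
    rankNCB n (omegaTilde n τ) = n - cB n τ := by
  unfold rankNCB
  rw [ns_omega hτ, nsOrb_ncard hτ]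
  simp

/-- the fixed space in terms of the partition -/
theorem fix_of_omega {n : ℕ} {τ : Equiv.Perm ℤ} (hτ : inB n τ) (u : ℤ → ℚ) :
    u ∈ FixS n τ ↔ (∀ x, u (-x) = - u x) ∧ (∀ x, x ∉ signedSet n → u x = 0) ∧
      ∀ A ∈ omegaTilde n τ, ∀ x ∈ A, ∀ y ∈ A, u x = u y := by
  constructor
  · intro hu
    refine ⟨hu.1, hu.2.1, ?_⟩
    rintro A (⟨⟨z, hz, rfl⟩, _⟩ | ⟨hA, _⟩) x hx y hy
    · rw [fix_orbit hu hx, fix_orbit hu hy]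
    · have key : ∀ x ∈ A, u x = 0 := by
        intro x hx
        rw [hA] at hx
        obtain ⟨B, ⟨⟨z, hz, rfl⟩, hB⟩, hx⟩ := hx
        rw [fix_orbit hu hx]
        apply fix_sym hu
        rw [negSet_permOrbit hτ] at hB
        exact permOrbit_eq_iff.mp hB
      rw [key x hx, key y hy]
  · rintro ⟨h1, h2, h3⟩
    refine ⟨h1, h2, fun x => ?_⟩
    by_cases hx : x ∈ signedSet n
    · by_cases hs : negSet (permOrbit τ x) = permOrbit τ x
      · have hm : permOrbit τ x ∈ {A | A ∈ orbitsOn n τ ∧ negSet A = A} := ⟨⟨x, hx, rfl⟩, hs⟩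
        refine h3 _ (Or.inr ⟨rfl, ⟨x, _, hm, mem_permOrbit_self τ x⟩⟩) _
          ⟨_, hm, ⟨1, by simp⟩⟩ _ ⟨_, hm, mem_permOrbit_self τ x⟩
      · exact h3 _ (Or.inl ⟨⟨x, hx, rfl⟩, hs⟩) _ ⟨1, by simp⟩ _ (mem_permOrbit_self τ x)
    · rw [hτ.2 x hx]

theorem FixS_eq_of_omega {n : ℕ} {τ τ' : Equiv.Perm ℤ} (hτ : inB n τ) (hτ' : inB n τ')
    (h : omegaTilde n τ = omegaTilde n τ') : FixS n τ = FixS n τ' := by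
  ext u; rw [fix_of_omega hτ, fix_of_omega hτ', h]

noncomputable def ipB (n : ℕ) (u v : ℤ → ℚ) : ℚ := ∑ x ∈ Finset.Icc (-(n : ℤ)) n, u x * v x

theorem ipB_comp {n : ℕ} {τ : Equiv.Perm ℤ} (hτ : inB n τ) (u v : ℤ → ℚ) :
    ipB n (fun x => u (τ x)) (fun x => v (τ x)) = ipB n u v := by
  unfold ipB
  refine Finset.sum_equiv τ (fun x => ?_) (fun x _ => rfl)
  have h := inB_mem hτ (x := x)
  by_cases hx : x ∈ signedSet n
  · have h2 := h.mpr hx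
    rw [mem_signed] at hx h2
    simp only [Finset.mem_Icc]; omega
  · rw [hτ.2 x hx]

theorem ipB_self {n : ℕ} {u : ℤ → ℚ} (hu : ∀ x, x ∉ signedSet n → u x = 0) (h : ipB n u u = 0) :
    u = 0 := by
  unfold ipB at h
  rw [Finset.sum_eq_zero_iff_of_nonneg (fun x _ => mul_self_nonneg _)] at h
  ext x
  by_cases hx : x ∈ signedSet n
  · have := h x (by rw [mem_signed] at hx; simp only [Finset.mem_Icc]; omega)
    simpa using this
  · simpa using hu x hx

def tMap (γ : Equiv.Perm ℤ) : (ℤ → ℚ) →ₗ[ℚ] (ℤ → ℚ) where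
  toFun v := fun x => v (γ⁻¹ x) - v x
  map_add' := by intro u v; ext x; simp; ring
  map_smul' := by intro c v; ext x; simp; ring

def kSub (n : ℕ) (γ : Equiv.Perm ℤ) (W : Submodule ℚ (ℤ → ℚ)) : Submodule ℚ (ℤ → ℚ) where
  carrier := {v | v ∈ FixS n 1 ∧ ∀ w ∈ W, ipB n (tMap γ v) w = 0}
  add_mem' := by
    rintro u v ⟨h1, h2⟩ ⟨h3, h4⟩
    refine ⟨add_mem h1 h3, fun w hw => ?_⟩
    have := h2 w hw
    have := h4 w hw
    unfold ipB at *
    rw [map_add]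
    simp only [Pi.add_apply, add_mul, Finset.sum_add_distrib]
    linarith
  zero_mem' := ⟨zero_mem _, fun w _ => by simp [ipB]⟩
  smul_mem' := by
    rintro c v ⟨h1, h2⟩
    refine ⟨Submodule.smul_mem _ _ h1, fun w hw => ?_⟩
    have := h2 w hw
    unfold ipB at *
    rw [map_smul]
    simp only [Pi.smul_apply, smul_eq_mul, mul_assoc, ← Finset.mul_sum]
    rw [this, mul_zero]

theorem eq_zero_of_fix {n : ℕ} {γ : Equiv.Perm ℤ} (h0 : cB n γ = 0) {u : ℤ → ℚ}
    (hu : u ∈ FixS n γ) : u = 0 := by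
  unfold cB at h0
  rw [Submodule.finrank_eq_zero] at h0
  rw [h0] at hu
  exact hu

theorem kSub_dim {n : ℕ} {γ τ : Equiv.Perm ℤ} (hγ : inB n γ) (h0 : cB n γ = 0) :
    Module.finrank ℚ (kSub n γ (FixS n τ)) + cB n τ ≤ n := by
  set K := kSub n γ (FixS n τ) with hK
  have hKle : K ≤ FixS n 1 := fun v hv => hv.1
  have hfd : FiniteDimensional ℚ K := Submodule.finiteDimensional_of_le hKle
  have hinj : Function.Injective ((tMap γ).domRestrict K) := by
    rw [← LinearMap.ker_eq_bot, LinearMap.ker_eq_bot']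
    rintro ⟨v, hv⟩ h
    have hv1 := hKle hv
    have : v ∈ FixS n γ⁻¹ := ⟨hv1.1, hv1.2.1, fun x => by
      have : v (γ⁻¹ x) - v x = 0 := congrFun h x
      linarith⟩
    rw [FixS_inv] at this
    ext x; simp [eq_zero_of_fix h0 this]
  have hr := LinearMap.finrank_range_of_inj hinj
  set R := LinearMap.range ((tMap γ).domRestrict K) with hR
  have hRle : R ≤ FixS n 1 := by
    rintro _ ⟨⟨v, hv⟩, rfl⟩
    have hv1 := hKle hv
    refine ⟨fun x => ?_, fun x hx => ?_, fun _ => rfl⟩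
    · change v (γ⁻¹ (-x)) - v (-x) = -(v (γ⁻¹ x) - v x)
      rw [(inB_inv hγ).1, hv1.1, hv1.1]; ring
    · change v (γ⁻¹ x) - v x = 0
      rw [(inB_inv hγ).2 x hx, sub_self]
  have hd : Disjoint R (FixS n τ) := by
    rw [Submodule.disjoint_def]
    rintro _ ⟨⟨v, hv⟩, rfl⟩ hw
    exact ipB_self hw.2.1 (hv.2 _ hw)
  have hfR : FiniteDimensional ℚ R := Submodule.finiteDimensional_of_le hRle
  have h2 := Submodule.finrank_sup_add_finrank_inf_eq R (FixS n τ)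
  rw [hd.eq_bot, finrank_bot] at h2
  have h3 := Submodule.finrank_mono (sup_le hRle (FixS_le_one n τ))
  have h4 := cB_one n
  unfold cB at h4 ⊢
  omega

theorem fix_le_kSub {n : ℕ} {γ τ : Equiv.Perm ℤ} (hτ : inB n τ) :
    FixS n (τ⁻¹ * γ) ≤ kSub n γ (FixS n τ) := by
  intro v hv
  refine ⟨FixS_le_one _ _ hv, fun w hw => ?_⟩
  have h1 : ∀ x, v (γ⁻¹ x) = v (τ⁻¹ x) := by
    intro x
    have := hv.2.2 (γ⁻¹ x)
    simpa using this.symm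
  have h2 := ipB_comp (inB_inv hτ) v w
  have h3 : ∀ x, w (τ⁻¹ x) = w x := (FixS_inv n τ ▸ hw : w ∈ FixS n τ⁻¹).2.2
  simp only [h3] at h2
  unfold ipB at *
  simp only [tMap, LinearMap.coe_mk, AddHom.coe_mk, sub_mul, Finset.sum_sub_distrib, h1, h2,
    sub_self]

theorem brady_watt {n : ℕ} {γ τ τ' : Equiv.Perm ℤ} (hγ : inB n γ) (h0 : cB n γ = 0)
    (hτ : inB n τ) (hτ' : inB n τ') (h : cB n τ + cB n (τ⁻¹ * γ) = n)
    (h' : cB n τ' + cB n (τ'⁻¹ * γ) = n) (hF : FixS n τ = FixS n τ') : τ = τ' := by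
  have key : ∀ τ : Equiv.Perm ℤ, inB n τ → cB n τ + cB n (τ⁻¹ * γ) = n →
      FixS n (τ⁻¹ * γ) = kSub n γ (FixS n τ) := by
    intro τ hτ h
    have := kSub_dim (τ := τ) hγ h0
    have hfd : FiniteDimensional ℚ (kSub n γ (FixS n τ)) :=
      Submodule.finiteDimensional_of_le (S₂ := FixS n 1) (fun v hv => And.left hv)
    apply Submodule.eq_of_le_of_finrank_le (fix_le_kSub hτ)
    unfold cB at *
    omega
  have e1 := key τ hτ h
  have e2 := key τ' hτ' h'
  rw [← hF, ← e1] at e2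
  have hd : Disjoint (FixS n τ) (FixS n (τ⁻¹ * γ)) := by
    rw [Submodule.disjoint_def]
    intro u h1 h2
    apply eq_zero_of_fix h0
    refine ⟨h1.1, h1.2.1, fun x => ?_⟩
    rw [← h2.2.2 x]
    have := h1.2.2 (τ⁻¹ (γ x))
    simpa using this
  have hsup : FixS n τ ⊔ FixS n (τ⁻¹ * γ) = FixS n 1 := by
    apply Submodule.eq_of_le_of_finrank_le (sup_le (FixS_le_one _ _) (FixS_le_one _ _))
    have h2 := Submodule.finrank_sup_add_finrank_inf_eq (FixS n τ) (FixS n (τ⁻¹ * γ))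
    rw [hd.eq_bot, finrank_bot] at h2
    have := cB_one n
    unfold cB at *
    omega
  have hv : ∀ v ∈ FixS n 1, ∀ x, v (τ⁻¹ x) = v (τ'⁻¹ x) := by
    intro v hv x
    rw [← hsup, Submodule.mem_sup] at hv
    obtain ⟨w, hw, k, hk, rfl⟩ := hv
    have a1 : w (τ⁻¹ x) = w x := (FixS_inv n τ ▸ hw : w ∈ FixS n τ⁻¹).2.2 x
    have a2 : w (τ'⁻¹ x) = w x := (FixS_inv n τ' ▸ hF ▸ hw : w ∈ FixS n τ'⁻¹).2.2 x
    have b1 := hk.2.2 (γ⁻¹ x)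
    have b2 := (e2 ▸ hk : k ∈ FixS n (τ'⁻¹ * γ)).2.2 (γ⁻¹ x)
    rw [Perm.mul_apply, show γ (γ⁻¹ x) = x from γ.apply_symm_apply x] at b1 b2
    rw [Pi.add_apply, Pi.add_apply, a1, a2, b1, b2]
  have : τ⁻¹ = τ'⁻¹ := by
    ext x
    by_cases hx : x ∈ signedSet n
    · have hm : τ⁻¹ x ∈ signedSet n := (inB_mem (inB_inv hτ)).mpr hx
      have := hv (dl (τ⁻¹ x)) (dl_mem_one hm) x
      unfold dl at this
      simp only [if_true] at this
      split_ifs at this with h1 h2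
      · exact h1.symm
      · norm_num at this
      · norm_num at this
    · rw [(inB_inv hτ).2 x hx, (inB_inv hτ').2 x hx]
  exact inv_injective this

def ph (m : ℕ) (x : ℤ) : ℤ :=
  if x % (2 * m) < m then x % (2 * m) + 1 else m - x % (2 * m) - 1

def ps (m : ℕ) (s : ℤ) : ℤ := if 0 < s then s - 1 else m - s - 1

theorem ps_range {m : ℕ} {s : ℤ} (hs : s ∈ signedSet m) : 0 ≤ ps m s ∧ ps m s < 2 * m := by
  rw [mem_signed] at hs; unfold ps; split_ifs <;> omega

theorem ph_ps {m : ℕ} {s : ℤ} (hs : s ∈ signedSet m) : ph m (ps m s) = s := by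
  obtain ⟨h1, h2⟩ := ps_range hs
  unfold ph
  rw [Int.emod_eq_of_lt h1 h2]
  rw [mem_signed] at hs; unfold ps; split_ifs <;> omega

theorem mod_range {m : ℕ} (hm : 0 < m) (x : ℤ) : 0 ≤ x % (2 * m) ∧ x % (2 * m) < 2 * m :=
  ⟨Int.emod_nonneg _ (by omega), Int.emod_lt_of_pos _ (by omega)⟩

theorem ps_ph {m : ℕ} (hm : 0 < m) (x : ℤ) : ps m (ph m x) = x % (2 * m) := by
  obtain ⟨h1, h2⟩ := mod_range hm x
  unfold ph ps; split_ifs <;> omega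

theorem ph_mem {m : ℕ} (hm : 0 < m) (x : ℤ) : ph m x ∈ signedSet m := by
  obtain ⟨h1, h2⟩ := mod_range hm x
  rw [mem_signed]; unfold ph; split_ifs <;> omega

theorem ph_eq_iff {m : ℕ} (hm : 0 < m) {x y : ℤ} : ph m x = ph m y ↔ (2 * m : ℤ) ∣ y - x := by
  rw [← Int.modEq_iff_dvd]
  constructor
  · intro h; have := congrArg (ps m) h; rwa [ps_ph hm, ps_ph hm] at this
  · intro h; unfold ph; rw [show x % (2 * m) = y % (2 * m) from h]

theorem ph_add {m : ℕ} (hm : 0 < m) (x : ℤ) : ph m (x + m) = - ph m x := by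
  obtain ⟨h1, h2⟩ := mod_range hm x
  by_cases h : x % (2 * m) < m
  · have : (x + m) % (2 * m) = x % (2 * m) + m := by
      rw [Int.add_emod, Int.emod_eq_of_lt (a := (m : ℤ)) (by omega) (by omega),
        Int.emod_eq_of_lt (by omega) (by omega)]
    unfold ph; rw [this]; split_ifs <;> omega
  · have : (x + m) % (2 * m) = x % (2 * m) - m := by
      rw [show x + m = (x - m) + 2 * m by ring, Int.add_emod_right, ← Int.emod_sub_emod,
        Int.emod_eq_of_lt (by omega) (by omega)]
    unfold ph; rw [this]; split_ifs <;> omega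

theorem ph_addN {m : ℕ} (hm : 0 < m) (x : ℤ) : ph m (x + 2 * m) = ph m x := by
  rw [eq_comm, ph_eq_iff hm]; simp

def gl (m : ℕ) : List ℤ := ((List.range m).map fun i : ℕ => ((i : ℤ) + 1)) ++
    ((List.range m).map fun i : ℕ => -((i : ℤ) + 1))

theorem lift_range (m : ℕ) : (do let a ← List.range m; pure (a : ℤ)) =
    (List.range m).map (fun a : ℕ => (a : ℤ)) := by
  simp [List.map_eq_flatMap]

theorem gd_eq (m : ℕ) : gammaDisc m = (gl m).formPerm := by
  unfold gammaDisc gl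
  rw [lift_range, List.map_map, List.map_map]
  rfl

theorem gpq_eq (m : ℕ) : gammaPQ m 1 = gammaDisc m * rf (m + 1) (-(m + 1)) := by
  unfold gammaPQ gammaDisc
  congr 1
  rw [lift_range]
  simp [rf]

theorem gl_get (m : ℕ) (i : ℕ) (h : i < (gl m).length) :
    (gl m)[i] = ph m i := by
  unfold gl at h ⊢
  simp only [List.length_append, List.length_map, List.length_range] at h
  have : (i : ℤ) % (2 * m) = i := Int.emod_eq_of_lt (by omega) (by omega)
  unfold ph
  rw [this, List.getElem_append]
  simp only [List.length_map, List.length_range, List.getElem_map, List.getElem_range]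
  split_ifs <;> omega

theorem gl_nodup (m : ℕ) : (gl m).Nodup := by
  unfold gl
  rw [List.nodup_append]
  refine ⟨?_, ?_, ?_⟩
  · exact List.Nodup.map (fun a b h => by simpa using h) List.nodup_range
  · exact List.Nodup.map (fun a b h => by simpa using h) List.nodup_range
  · intro a ha b hb
    simp only [List.mem_map, List.mem_range] at ha hb
    omega

theorem gd_ph {m : ℕ} (hm : 0 < m) (x : ℤ) : gammaDisc m (ph m x) = ph m (x + 1) := by
  obtain ⟨h1, h2⟩ := mod_range hm x
  set r := x % (2 * m) with hr
  have hx : ph m x = ph m r := by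
    rw [ph_eq_iff hm, ← Int.modEq_iff_dvd]; exact (Int.mod_modEq _ _).symm
  have hx' : ph m (x + 1) = ph m (r + 1) := by
    rw [ph_eq_iff hm, ← Int.modEq_iff_dvd]
    exact ((Int.mod_modEq _ _).symm).add_right 1
  obtain ⟨i, hi⟩ := Int.eq_ofNat_of_zero_le h1
  rw [hx, hx', hi]
  have hl : (gl m).length = 2 * m := by unfold gl; simp; ring
  rw [show ph m ((i : ℕ) : ℤ) = _ from (gl_get m i (by rw [hl]; omega)).symm]
  rw [gd_eq, List.formPerm_apply_getElem _ (gl_nodup m), gl_get, hl]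
  rw [ph_eq_iff hm, ← Int.modEq_iff_dvd]
  push_cast
  exact Int.mod_modEq _ _

theorem gd_inB {m : ℕ} (hm : 0 < m) : inB m (gammaDisc m) := by
  have h2 : ∀ x : ℤ, x ∉ signedSet m → gammaDisc m x = x := by
    intro x hx
    rw [gd_eq]
    apply List.formPerm_apply_of_notMem
    unfold gl
    simp only [List.mem_append, List.mem_map, List.mem_range]
    rw [mem_signed] at hx
    omega
  refine ⟨fun x => ?_, h2⟩
  by_cases hx : x ∈ signedSet m
  · rw [← ph_ps hx, ← ph_add hm, gd_ph hm, gd_ph hm, ← ph_add hm]; congr 1; ring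
  · rw [h2 x hx, h2]; rwa [neg_mem_signed]

theorem gd_cB {m : ℕ} (hm : 0 < m) : cB m (gammaDisc m) = 0 := by
  unfold cB
  rw [Submodule.finrank_eq_zero, Submodule.eq_bot_iff]
  intro u hu
  have h1 : ∀ x : ℤ, ∀ k : ℕ, u (ph m (x + k)) = u (ph m x) := by
    intro x k
    induction k with
    | zero => simp
    | succ k ih => rw [← ih, ← hu.2.2 (ph m (x + k)), gd_ph hm]; congr 2; push_cast; ring
  ext x
  by_cases hx : x ∈ signedSet m
  · have := h1 (ps m x) m
    rw [ph_add hm, hu.1, ph_ps hx] at this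
    simp; linarith
  · simpa using hu.2.1 x hx

/-! lifts -/
def liftF (m : ℕ) (τ : Equiv.Perm ℤ) (x : ℤ) : ℤ :=
  x + 1 + (ps m (τ (ph m x)) - x - 1) % (2 * m)

section
variable {m : ℕ} (hm : 0 < m) {τ : Equiv.Perm ℤ} (hτ : inB m τ)
include hm
theorem liftF_range (x : ℤ) : x + 1 ≤ liftF m τ x ∧ liftF m τ x ≤ x + 2 * m := by
  have := mod_range hm (ps m (τ (ph m x)) - x - 1)
  unfold liftF; omega

include hτ
theorem ph_liftF (x : ℤ) : ph m (liftF m τ x) = τ (ph m x) := by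
  have h := ph_ps ((inB_mem hτ).mpr (ph_mem hm x))
  conv_rhs => rw [← h]
  rw [ph_eq_iff hm]
  unfold liftF
  have := Int.emod_add_mul_ediv (ps m (τ (ph m x)) - x - 1) (2 * m)
  exact ⟨(ps m (τ (ph m x)) - x - 1) / (2 * m), by linarith⟩

theorem liftF_unique {x y : ℤ} (h1 : x + 1 ≤ y) (h2 : y ≤ x + 2 * m)
    (h3 : ph m y = τ (ph m x)) : liftF m τ x = y := by
  rw [← ph_liftF hm hτ, ph_eq_iff hm] at h3
  obtain ⟨h4, h5⟩ := liftF_range hm (τ := τ) x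
  have := Int.eq_zero_of_abs_lt_dvd h3 (by rw [abs_lt]; omega)
  omega

theorem liftF_add (x : ℤ) : liftF m τ (x + m) = liftF m τ x + m := by
  obtain ⟨h4, h5⟩ := liftF_range hm (τ := τ) x
  apply liftF_unique hm hτ (by omega) (by omega)
  rw [ph_add hm, ph_add hm, hτ.1, ph_liftF hm hτ]

theorem liftF_inj : Function.Injective (liftF m τ) := by
  have hadd : ∀ x, liftF m τ (x + 2 * m) = liftF m τ x + 2 * m := by
    intro x
    rw [show x + 2 * (m : ℤ) = x + m + m by ring, liftF_add hm hτ, liftF_add hm hτ]; ring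
  have hmul : ∀ x, ∀ k : ℕ, liftF m τ (x + 2 * m * k) = liftF m τ x + 2 * m * k := by
    intro x k
    induction k with
    | zero => simp
    | succ k ih =>
      rw [show x + 2 * (m : ℤ) * ((k + 1 : ℕ) : ℤ) = (x + 2 * m * k) + 2 * m by push_cast; ring,
        hadd, ih]; push_cast; ring
  have key : ∀ x y, x ≤ y → liftF m τ x = liftF m τ y → x = y := by
    intro x y hle h
    have h1 : ph m x = ph m y := by
      have := congrArg (ph m) h
      rw [ph_liftF hm hτ, ph_liftF hm hτ] at this
      exact τ.injective this
    rw [ph_eq_iff hm] at h1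
    obtain ⟨k, hk⟩ := h1
    have hk0 : 0 ≤ k := by
      by_contra hc
      have : (2 * m : ℤ) * k < 0 := mul_neg_of_pos_of_neg (by omega) (by omega)
      omega
    obtain ⟨k', rfl⟩ := Int.eq_ofNat_of_zero_le hk0
    have := hmul x k'
    rw [show x + 2 * (m : ℤ) * k' = y by omega] at this
    omega
  intro x y h
  rcases le_total x y with h' | h'
  · exact key x y h' h
  · exact (key y x h' h.symm).symm

theorem liftF_dual (x : ℤ) :
    liftF m τ (liftF m (τ⁻¹ * gammaDisc m) x) = x + 2 * m + 1 := by
  have hσ : inB m (τ⁻¹ * gammaDisc m) := inB_mul (inB_inv hτ) (gd_inB hm)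
  obtain ⟨h4, h5⟩ := liftF_range hm (τ := τ⁻¹ * gammaDisc m) x
  apply liftF_unique hm hτ (by omega) (by omega)
  rw [ph_liftF hm hσ, Perm.mul_apply, show ∀ y, τ (τ⁻¹ y) = y from τ.apply_symm_apply,
    gd_ph hm, show x + 2 * (m : ℤ) + 1 = x + 1 + 2 * m by ring, ph_addN hm]
end

def NCm (m : ℕ) (τ : Equiv.Perm ℤ) : Prop :=
  inB m τ ∧ cB m τ + cB m (τ⁻¹ * gammaDisc m) = m

theorem cB_conj_le {n : ℕ} {τ γ : Equiv.Perm ℤ} (hγ : inB n γ) :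
    cB n τ ≤ cB n (γ⁻¹ * τ * γ) := by
  let e := LinearEquiv.funCongrLeft ℚ ℚ (γ : ℤ ≃ ℤ)
  unfold cB
  rw [← LinearEquiv.finrank_map_eq e (FixS n τ)]
  apply Submodule.finrank_mono
  rintro _ ⟨u, hu, rfl⟩
  refine ⟨fun x => ?_, fun x hx => ?_, fun x => ?_⟩
  · change u (γ (-x)) = - u (γ x)
    rw [hγ.1, hu.1]
  · change u (γ x) = 0
    rw [hγ.2 x hx, hu.2.1 x hx]
  · change u (γ (γ⁻¹ (τ (γ x)))) = u (γ x)
    rw [show ∀ y, γ (γ⁻¹ y) = y from γ.apply_symm_apply, hu.2.2]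

theorem NCm_dual {m : ℕ} (hm : 0 < m) {τ : Equiv.Perm ℤ} (h : NCm m τ) :
    NCm m (τ⁻¹ * gammaDisc m) := by
  have hσ : inB m (τ⁻¹ * gammaDisc m) := inB_mul (inB_inv h.1) (gd_inB hm)
  refine ⟨hσ, ?_⟩
  have h1 := cB_add_le (n := m) (τ⁻¹ * gammaDisc m) (gammaDisc m) (gd_cB hm)
  have h2 := cB_conj_le (τ := τ) (gd_inB hm)
  have h3 := h.2
  rw [show (τ⁻¹ * gammaDisc m)⁻¹ * gammaDisc m = (gammaDisc m)⁻¹ * τ * gammaDisc m by group]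
    at h1 ⊢
  omega

noncomputable def Sf (m : ℕ) : Finset ℤ := (Finset.Icc (-(m : ℤ)) m).erase 0

theorem mem_Sf {m : ℕ} {s : ℤ} : s ∈ Sf m ↔ s ∈ signedSet m := by
  unfold Sf; rw [mem_signed]; simp

theorem card_Sf (m : ℕ) : (Sf m).card = 2 * m := by
  unfold Sf
  rw [Finset.card_erase_of_mem (by simp), Int.card_Icc]; omega

def dD (m : ℕ) (τ : Equiv.Perm ℤ) (s : ℤ) : ℤ := 1 + (ps m (τ s) - ps m s - 1) % (2 * m)

theorem dD_ph {m : ℕ} (hm : 0 < m) (τ : Equiv.Perm ℤ) (x : ℤ) :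
    liftF m τ x = x + dD m τ (ph m x) := by
  unfold liftF dD
  rw [ps_ph hm]
  have : (ps m (τ (ph m x)) - x % (2 * m) - 1) % (2 * m) = (ps m (τ (ph m x)) - x - 1) % (2 * m) := by
    apply Int.ModEq.sub_right
    apply Int.ModEq.sub_left
    exact Int.mod_modEq _ _
  rw [this]; ring

theorem dD_pos {m : ℕ} (hm : 0 < m) (τ : Equiv.Perm ℤ) (s : ℤ) : 1 ≤ dD m τ s := by
  have := mod_range hm (ps m (τ s) - ps m s - 1)
  unfold dD; omega

theorem dD_neg {m : ℕ} (hm : 0 < m) {τ : Equiv.Perm ℤ} (hτ : inB m τ) {s : ℤ}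
    (hs : s ∈ signedSet m) : dD m τ (-s) = dD m τ s := by
  have h1 := dD_ph hm τ (ps m s)
  have h2 := dD_ph hm τ (ps m s + m)
  rw [liftF_add hm hτ, ph_add hm, ph_ps hs] at h2
  rw [ph_ps hs] at h1
  omega

theorem dD_dual {m : ℕ} (hm : 0 < m) {τ : Equiv.Perm ℤ} (hτ : inB m τ) {s : ℤ}
    (hs : s ∈ signedSet m) :
    dD m (τ⁻¹ * gammaDisc m) s + dD m τ ((τ⁻¹ * gammaDisc m) s) = 2 * m + 1 := by
  have hσ : inB m (τ⁻¹ * gammaDisc m) := inB_mul (inB_inv hτ) (gd_inB hm)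
  have h := liftF_dual hm hτ (ps m s)
  rw [dD_ph hm τ, ph_liftF hm hσ, dD_ph hm, ph_ps hs] at h
  omega

open Classical in
noncomputable def fib (m : ℕ) (τ : Equiv.Perm ℤ) (A : Set ℤ) : Finset ℤ :=
  (Sf m).filter (fun s => permOrbit τ s = A)

open Classical in
noncomputable def orbs (m : ℕ) (τ : Equiv.Perm ℤ) : Finset (Set ℤ) := (Sf m).image (permOrbit τ)

theorem mem_orbs {m : ℕ} {τ : Equiv.Perm ℤ} {A : Set ℤ} : A ∈ orbs m τ ↔ A ∈ orbitsOn m τ := by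
  unfold orbs orbitsOn
  simp only [Finset.mem_image, mem_Sf, Set.mem_setOf_eq, eq_comm]

theorem mem_fib {m : ℕ} {τ : Equiv.Perm ℤ} {A : Set ℤ} {s : ℤ} :
    s ∈ fib m τ A ↔ s ∈ signedSet m ∧ permOrbit τ s = A := by
  unfold fib; simp [mem_Sf]

noncomputable def fsum (m : ℕ) (τ : Equiv.Perm ℤ) (A : Set ℤ) : ℤ := ∑ s ∈ fib m τ A, dD m τ s

theorem sum_fsum (m : ℕ) (τ : Equiv.Perm ℤ) :
    ∑ A ∈ orbs m τ, fsum m τ A = ∑ s ∈ Sf m, dD m τ s := by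
  classical
  unfold fsum fib orbs
  exact Finset.sum_fiberwise_of_maps_to (fun s hs => Finset.mem_image_of_mem _ hs) _

theorem fsum_dvd {m : ℕ} {τ : Equiv.Perm ℤ} (hτ : inB m τ) (A : Set ℤ) :
    (2 * m : ℤ) ∣ fsum m τ A := by
  have h1 : ∑ s ∈ fib m τ A, ps m (τ s) = ∑ s ∈ fib m τ A, ps m s := by
    refine Finset.sum_equiv τ (fun s => ?_) (fun _ _ => rfl)
    rw [mem_fib, mem_fib, inB_mem hτ, permOrbit_map]
  have h2 : fsum m τ A = ∑ s ∈ fib m τ A, (ps m (τ s) - ps m s -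
      2 * m * ((ps m (τ s) - ps m s - 1) / (2 * m))) := by
    apply Finset.sum_congr rfl
    intro s _
    have := Int.emod_add_mul_ediv (ps m (τ s) - ps m s - 1) (2 * m)
    unfold dD; linarith
  rw [h2, Finset.sum_sub_distrib, Finset.sum_sub_distrib, h1, sub_self, zero_sub, dvd_neg,
    ← Finset.mul_sum]
  exact dvd_mul_right _ _

theorem fsum_ge {m : ℕ} (hm : 0 < m) {τ : Equiv.Perm ℤ} (hτ : inB m τ) {A : Set ℤ}
    (hA : A ∈ orbs m τ) : 2 * m ≤ fsum m τ A := by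
  apply Int.le_of_dvd _ (fsum_dvd hτ A)
  rw [mem_orbs] at hA
  obtain ⟨x, hx, rfl⟩ := hA
  apply Finset.sum_pos
  · intro s _; have := dD_pos hm τ s; omega
  · exact ⟨x, mem_fib.mpr ⟨hx, rfl⟩⟩

theorem fsum_neg {m : ℕ} (hm : 0 < m) {τ : Equiv.Perm ℤ} (hτ : inB m τ) (A : Set ℤ) :
    fsum m τ (negSet A) = fsum m τ A := by
  have key : ∀ s A, permOrbit τ s = A → permOrbit τ (-s) = negSet A := by
    rintro s _ rfl; rw [negSet_permOrbit hτ]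
  unfold fsum
  refine Finset.sum_equiv (Equiv.neg ℤ) (fun s => ?_) (fun s hs => ?_)
  · rw [mem_fib, mem_fib]
    simp only [Equiv.neg_apply, neg_mem_signed]
    refine and_congr_right fun _ => ⟨fun h => ?_, fun h => ?_⟩
    · rw [key _ _ h, negSet_negSet]
    · rw [← key _ _ h, neg_neg]
  · rw [mem_fib] at hs
    exact (dD_neg hm hτ hs.1).symm

open Classical in
theorem card_orbs {m : ℕ} {τ : Equiv.Perm ℤ} (hτ : inB m τ) :
    (orbs m τ).card = 2 * cB m τ + ((orbs m τ).filter (fun A => negSet A = A)).card := by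
  have h1 : nsOrb m τ = ↑((orbs m τ).filter (fun A => ¬ negSet A = A)) := by
    ext A; simp [nsOrb, mem_orbs]
  have h2 := nsOrb_ncard hτ
  rw [h1, Set.ncard_coe_finset] at h2
  have := Finset.card_filter_add_card_filter_not (s := orbs m τ) (fun A => negSet A = A)
  omega

theorem total_ge {m : ℕ} (hm : 0 < m) {τ : Equiv.Perm ℤ} (hτ : inB m τ) :
    2 * (m : ℤ) * (2 * cB m τ) ≤ ∑ s ∈ Sf m, dD m τ s := by
  classical
  rw [← sum_fsum]
  have h := Finset.card_nsmul_le_sum (orbs m τ) (fsum m τ) (2 * m) (fun A hA => fsum_ge hm hτ hA)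
  have h2 := card_orbs hτ
  refine le_trans ?_ h
  rw [h2, nsmul_eq_mul, mul_comm]
  push_cast
  nlinarith [Nat.zero_le ((orbs m τ).filter (fun A => negSet A = A)).card]

theorem total_ge_bad {m : ℕ} (hm : 0 < m) {τ : Equiv.Perm ℤ} (hτ : inB m τ) {A : Set ℤ}
    (hA : A ∈ orbs m τ) (hbad : fsum m τ A ≠ 2 * m) :
    2 * (m : ℤ) * (2 * cB m τ + 2) ≤ ∑ s ∈ Sf m, dD m τ s := by
  classical
  rw [← sum_fsum]
  have h0 : 2 * (2 * (m : ℤ)) ≤ fsum m τ A := by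
    have h1 := fsum_ge hm hτ hA
    obtain ⟨k, hk⟩ := fsum_dvd hτ A
    have : 2 ≤ k := by
      by_contra hc
      have h3 : k ≤ 1 := by omega
      have h4 : k ≠ 1 := by rintro rfl; exact hbad (by rw [hk, mul_one])
      have : (2 * m : ℤ) * k ≤ 0 := mul_nonpos_of_nonneg_of_nonpos (by omega) (by omega)
      omega
    rw [hk]
    nlinarith
  have h2 := card_orbs hτ
  have hge : ∀ A ∈ orbs m τ, 0 ≤ fsum m τ A - 2 * m := fun A hA => by
    have := fsum_ge hm hτ hA; omega
  have hs : ∑ A ∈ orbs m τ, (fsum m τ A - 2 * m) =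
      ∑ A ∈ orbs m τ, fsum m τ A - 2 * m * (orbs m τ).card := by
    rw [Finset.sum_sub_distrib, Finset.sum_const, nsmul_eq_mul]; ring
  by_cases hn : negSet A = A
  · have h3 : 1 ≤ ((orbs m τ).filter (fun A => negSet A = A)).card :=
      Finset.card_pos.mpr ⟨A, Finset.mem_filter.mpr ⟨hA, hn⟩⟩
    have h4 := Finset.single_le_sum hge hA
    have h5 : 2 * cB m τ + 1 ≤ (orbs m τ).card := by omega
    have h6 : (2 * cB m τ + 1 : ℤ) ≤ (orbs m τ).card := by exact_mod_cast h5
    nlinarith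
  · have hA' : negSet A ∈ orbs m τ := by
      rw [mem_orbs] at hA ⊢
      exact (nsOrb_neg hτ ⟨hA, hn⟩).1
    have h4 := Finset.add_le_sum hge hA hA' (fun h => hn h.symm)
    rw [fsum_neg hm hτ] at h4
    have h6 : (2 * cB m τ : ℤ) ≤ (orbs m τ).card := by
      have : 2 * cB m τ ≤ (orbs m τ).card := by omega
      exact_mod_cast this
    nlinarith

theorem total_eq {m : ℕ} (hm : 0 < m) {τ : Equiv.Perm ℤ} (hτ : inB m τ) :
    ∑ s ∈ Sf m, dD m (τ⁻¹ * gammaDisc m) s + ∑ s ∈ Sf m, dD m τ s = 2 * m * (2 * m + 1) := by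
  have hσ : inB m (τ⁻¹ * gammaDisc m) := inB_mul (inB_inv hτ) (gd_inB hm)
  have h1 : ∑ s ∈ Sf m, dD m τ ((τ⁻¹ * gammaDisc m) s) = ∑ s ∈ Sf m, dD m τ s := by
    refine Finset.sum_equiv (τ⁻¹ * gammaDisc m) (fun s => ?_) (fun _ _ => rfl)
    rw [mem_Sf, mem_Sf, inB_mem hσ]
  rw [← h1, ← Finset.sum_add_distrib, Finset.sum_congr rfl
    (fun s hs => dD_dual hm hτ (mem_Sf.mp hs)), Finset.sum_const, card_Sf, nsmul_eq_mul]
  push_cast; ring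

theorem fsum_eq {m : ℕ} (hm : 0 < m) {τ : Equiv.Perm ℤ} (hτ : NCm m τ) {A : Set ℤ}
    (hA : A ∈ orbs m τ) : fsum m τ A = 2 * m := by
  by_contra hbad
  have h1 := total_ge_bad hm hτ.1 hA hbad
  have h2 := total_ge hm (NCm_dual hm hτ).1
  have h3 := total_eq hm hτ.1
  have h4 : (cB m τ : ℤ) + cB m (τ⁻¹ * gammaDisc m) = m := by exact_mod_cast hτ.2
  have : 2 * (m : ℤ) * (2 * (cB m τ + cB m (τ⁻¹ * gammaDisc m)) + 2) ≤ 2 * m * (2 * m + 1) := by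
    linarith
  rw [h4] at this
  nlinarith

theorem iter_ph {m : ℕ} (hm : 0 < m) {τ : Equiv.Perm ℤ} (hτ : inB m τ) (x : ℤ) (r : ℕ) :
    ph m ((liftF m τ)^[r] x) = (τ ^ r) (ph m x) := by
  induction r with
  | zero => simp
  | succ r ih => rw [Function.iterate_succ_apply', ph_liftF hm hτ, ih, pow_succ', Perm.mul_apply]

theorem iter_sum {m : ℕ} (hm : 0 < m) {τ : Equiv.Perm ℤ} (hτ : inB m τ) (x : ℤ) (r : ℕ) :
    (liftF m τ)^[r] x = x + ∑ i ∈ Finset.range r, dD m τ ((τ ^ i) (ph m x)) := by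
  induction r with
  | zero => simp
  | succ r ih =>
    rw [Function.iterate_succ_apply', dD_ph hm, iter_ph hm hτ, Finset.sum_range_succ, ih]; ring

theorem wind {m : ℕ} (hm : 0 < m) {τ : Equiv.Perm ℤ} (hτ : NCm m τ) (x : ℤ) :
    ∃ r : ℕ, (liftF m τ)^[r] x = x + 2 * m := by
  set s := ph m x with hs
  have hsm : s ∈ signedSet m := ph_mem hm x
  have hex : ∃ r : ℕ, 0 < r ∧ (τ ^ r) s = s := by
    have hmaps : ∀ i : ℕ, (τ ^ i) s ∈ signedSet m := by
      intro i
      have := inB_zpow hτ.1 i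
      rw [zpow_natCast] at this
      exact (inB_mem this).mpr hsm
    obtain ⟨i, j, hij, h⟩ := Set.Finite.exists_lt_map_eq_of_forall_mem hmaps (signed_finite m)
    refine ⟨j - i, by omega, ?_⟩
    rw [show j = i + (j - i) by omega, pow_add, Perm.mul_apply] at h
    exact ((τ ^ i).injective h).symm
  classical
  obtain ⟨hr0, hr⟩ := Nat.find_spec hex
  have hmin := fun k => Nat.find_min hex (m := k)
  set r := Nat.find hex with hrdef
  refine ⟨r, ?_⟩
  have h1 := iter_sum hm hτ.1 x r
  rw [← hs] at h1
  have h2 := iter_ph hm hτ.1 x r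
  rw [← hs, hr, hs, eq_comm, ph_eq_iff hm] at h2
  have hinj : Set.InjOn (fun i : ℕ => (τ ^ i) s) (Finset.range r : Set ℕ) := by
    have key : ∀ i j : ℕ, i < j → j < r → (τ ^ i) s ≠ (τ ^ j) s := by
      intro i j hij hj h
      rw [show j = i + (j - i) by omega, pow_add, Perm.mul_apply] at h
      exact hmin (j - i) (by omega) ⟨by omega, ((τ ^ i).injective h).symm⟩
    intro i hi j hj h
    simp only [Finset.coe_range, Set.mem_Iio] at hi hj
    rcases lt_trichotomy i j with h' | h' | h'
    · exact absurd h (key i j h' hj)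
    · exact h'
    · exact absurd h.symm (key j i h' hi)
  have h3 : ∑ i ∈ Finset.range r, dD m τ ((τ ^ i) s) ≤ 2 * m := by
    rw [← fsum_eq hm hτ (mem_orbs.mpr ⟨s, hsm, rfl⟩)]
    unfold fsum
    rw [← Finset.sum_image (f := dD m τ) (g := fun i : ℕ => (τ ^ i) s) hinj]
    apply Finset.sum_le_sum_of_subset_of_nonneg
    · intro y hy
      obtain ⟨i, -, rfl⟩ := Finset.mem_image.mp hy
      have hy' : (τ ^ i) s ∈ permOrbit τ s := ⟨i, by simp⟩
      exact mem_fib.mpr ⟨(permOrbit_sub hτ.1 hy').mpr hsm, permOrbit_eq hy'⟩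
    · intro y _ _
      have := dD_pos hm τ y; omega
  have h4 : 0 < ∑ i ∈ Finset.range r, dD m τ ((τ ^ i) s) := by
    apply Finset.sum_pos (fun i _ => by have := dD_pos hm τ ((τ ^ i) s); omega)
    exact ⟨0, Finset.mem_range.mpr hr0⟩
  rw [h1, show x + ∑ i ∈ Finset.range r, dD m τ ((τ ^ i) s) - x
    = ∑ i ∈ Finset.range r, dD m τ ((τ ^ i) s) by ring] at h2
  have := Int.le_of_dvd h4 h2
  rw [h1]
  omega

structure LP (m : ℕ) (F G : ℤ → ℤ) : Prop where
  pos : 0 < m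
  lo : ∀ x, x + 1 ≤ F x
  hi : ∀ x, F x ≤ x + 2 * m
  glo : ∀ x, x + 1 ≤ G x
  ghi : ∀ x, G x ≤ x + 2 * m
  addm : ∀ x, F (x + m) = F x + m
  gaddm : ∀ x, G (x + m) = G x + m
  inj : Function.Injective F
  ginj : Function.Injective G
  dual : ∀ x, F (G x) = x + 2 * m + 1
  wnd : ∀ x, ∃ r : ℕ, F^[r] x = x + 2 * m
  gwnd : ∀ x, ∃ r : ℕ, G^[r] x = x + 2 * m

theorem NCm_LP {m : ℕ} (hm : 0 < m) {τ : Equiv.Perm ℤ} (hτ : NCm m τ) :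
    LP m (liftF m τ) (liftF m (τ⁻¹ * gammaDisc m)) where
  pos := hm
  lo x := (liftF_range hm x).1
  hi x := (liftF_range hm x).2
  glo x := (liftF_range hm x).1
  ghi x := (liftF_range hm x).2
  addm := liftF_add hm hτ.1
  gaddm := liftF_add hm (NCm_dual hm hτ).1
  inj := liftF_inj hm hτ.1
  ginj := liftF_inj hm (NCm_dual hm hτ).1
  dual := liftF_dual hm hτ.1
  wnd := wind hm hτ
  gwnd := wind hm (NCm_dual hm hτ)

theorem exists_step (a : ℕ → ℤ) (y : ℤ) : ∀ k : ℕ, a 0 ≤ y → y < a k →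
    ∃ i < k, a i ≤ y ∧ y < a (i + 1) := by
  intro k
  induction k with
  | zero => intro h1 h2; omega
  | succ k ih =>
    intro h1 h2
    by_cases h : y < a k
    · obtain ⟨i, hi, h3⟩ := ih h1 h
      exact ⟨i, by omega, h3⟩
    · exact ⟨k, by omega, by omega, h2⟩

theorem iter_mono {F : ℤ → ℤ} (hF : ∀ x, x + 1 ≤ F x) (x : ℤ) :
    Monotone (fun i : ℕ => F^[i] x) := by
  apply monotone_nat_of_le_succ
  intro i
  rw [Function.iterate_succ_apply']
  have := hF (F^[i] x)
  omega

namespace LP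
variable {m : ℕ} {F G : ℤ → ℤ} (H : LP m F G)
include H

theorem add2 (x : ℤ) : F (x + 2 * m) = F x + 2 * m := by
  rw [show x + 2 * (m : ℤ) = x + m + m by ring, H.addm, H.addm]; ring

theorem dual' (x : ℤ) : G (F x - 1 - 2 * m) = x := by
  apply H.inj; rw [H.dual]; ring

theorem symm : LP m G (fun x => F (x + 1) - 1) where
  pos := H.pos
  lo := H.glo
  hi := H.ghi
  glo x := by have := H.lo (x + 1); omega
  ghi x := by have := H.hi (x + 1); omega
  addm := H.gaddm
  gaddm x := by rw [show x + m + 1 = x + 1 + m by ring, H.addm]; ring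
  inj := H.ginj
  ginj x y h := by
    have := H.inj (show F (x + 1) = F (y + 1) by simpa using h)
    omega
  dual x := by
    apply H.inj
    rw [H.dual, show x + 2 * (m : ℤ) + 1 = x + 1 + 2 * m by ring, H.add2]; ring
  wnd := H.gwnd
  gwnd x := by
    obtain ⟨r, hr⟩ := H.wnd (x + 1)
    refine ⟨r, ?_⟩
    have : ∀ i : ℕ, (fun x => F (x + 1) - 1)^[i] x = F^[i] (x + 1) - 1 := by
      intro i
      induction i with
      | zero => simp
      | succ i ih => rw [Function.iterate_succ_apply', ih, Function.iterate_succ_apply']; simp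
    rw [this, hr]; ring

theorem nc_aux : ∀ d : ℕ, ∀ x y : ℤ, F x - x ≤ d → x < y → y < F x →
    F y < F x ∨ x + 2 * m < F y := by
  intro d
  induction d with
  | zero => intro x y h h1 h2; omega
  | succ d ih =>
    intro x y h h1 h2
    have hpos := H.pos
    obtain ⟨k, hk⟩ : ∃ k : ℕ, G^[k] x = F x - 1 := by
      obtain ⟨r, hr⟩ := H.gwnd (F x - 1 - 2 * m)
      cases r with
      | zero => simp at hr; omega
      | succ k =>
        rw [Function.iterate_succ_apply, H.dual'] at hr
        exact ⟨k, by rw [hr]; ring⟩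
    have gm := iter_mono H.glo x
    obtain ⟨i, hi, h3, h4⟩ := exists_step (fun i => G^[i] x) (y - 1) k
      (by simp; omega) (by change _ < G^[k] x; omega)
    have h5 := gm (Nat.zero_le i)
    have h6 := gm (show i + 1 ≤ k by omega)
    simp only [Function.iterate_zero, id_eq] at h3 h4 h5 h6
    rw [Function.iterate_succ_apply'] at h4 h6
    set s := G^[i] x with hs
    have hd := H.dual s
    by_cases hy : y = G s
    · right; rw [hy, hd]; omega
    · obtain ⟨r, hr⟩ : ∃ r : ℕ, F^[r] (s + 1) = G s := by
        obtain ⟨r, hr⟩ := H.wnd (s + 1)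
        cases r with
        | zero => simp at hr; omega
        | succ r =>
          rw [Function.iterate_succ_apply'] at hr
          exact ⟨r, H.inj (by rw [hr, hd]; ring)⟩
      have fm := iter_mono H.lo (s + 1)
      obtain ⟨j, hj, h7, h8⟩ := exists_step (fun i => F^[i] (s + 1)) y r
        (by simp; omega) (by change _ < F^[r] (s + 1); omega)
      have h9 := fm (Nat.zero_le j)
      have h10 := fm (show j + 1 ≤ r by omega)
      simp only [Function.iterate_zero, id_eq] at h7 h8 h9 h10
      rw [Function.iterate_succ_apply'] at h8 h10
      set a := F^[j] (s + 1) with ha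
      by_cases hya : y = a
      · left; rw [hya]; omega
      · rcases ih a y (by omega) (by omega) h8 with h11 | h11
        · left; omega
        · right; omega

theorem nc {x y : ℤ} (h1 : x < y) (h2 : y < F x) : F y < F x ∨ x + 2 * m < F y := by
  have := H.hi x
  exact H.nc_aux (2 * m) x y (by push_cast; omega) h1 h2

theorem nc' {x y : ℤ} (h1 : F x - 2 * m ≤ y) (h2 : y ≤ x) : F y ≤ x ∨ F x ≤ F y := by
  by_contra hc
  push Not at hc
  have hne : y ≠ x := by rintro rfl; omega
  rcases H.nc (show y < x by omega) hc.1 with h | h <;> omega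
end LP

def fF (m : ℕ) (F : ℤ → ℤ) (x : ℤ) : ℤ := if x + m < F x then F x - 2 * m else F x
def RR (m : ℕ) (F : ℤ → ℤ) (x : ℤ) : Prop := x + m < F x
def LL (m : ℕ) (F : ℤ → ℤ) (y : ℤ) : Prop := ∃ x, RR m F x ∧ fF m F x = y

theorem fF_R {m : ℕ} {F : ℤ → ℤ} {x : ℤ} (h : RR m F x) : fF m F x = F x - 2 * m := if_pos h
theorem fF_nR {m : ℕ} {F : ℤ → ℤ} {x : ℤ} (h : ¬ RR m F x) : fF m F x = F x := if_neg h

namespace LP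
variable {m : ℕ} {F G : ℤ → ℤ} (H : LP m F G)
include H

theorem RR_add (x : ℤ) : RR m F (x + m) ↔ RR m F x := by
  unfold RR; rw [H.addm]; omega

theorem RR_add2 (x : ℤ) : RR m F (x + 2 * m) ↔ RR m F x := by
  unfold RR; rw [H.add2]; omega

theorem fF_add (x : ℤ) : fF m F (x + m) = fF m F x + m := by
  by_cases h : RR m F x
  · rw [fF_R h, fF_R ((H.RR_add x).mpr h), H.addm]; ring
  · rw [fF_nR h, fF_nR (fun h' => h ((H.RR_add x).mp h')), H.addm]

theorem fF_sub (x : ℤ) : fF m F (x - m) = fF m F x - m := by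
  have := H.fF_add (x - m); rw [sub_add_cancel] at this; omega

theorem RR_sub (x : ℤ) : RR m F (x - m) ↔ RR m F x := by
  have := H.RR_add (x - m); rw [sub_add_cancel] at this; exact this.symm

theorem LL_add (x : ℤ) : LL m F (x + m) ↔ LL m F x := by
  constructor
  · rintro ⟨y, h1, h2⟩; exact ⟨y - m, (H.RR_sub y).mpr h1, by rw [H.fF_sub]; omega⟩
  · rintro ⟨y, h1, h2⟩; exact ⟨y + m, (H.RR_add y).mpr h1, by rw [H.fF_add]; omega⟩

theorem fF_inj : Function.Injective (fF m F) := by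
  have key : ∀ x y, RR m F x → ¬ RR m F y → fF m F x ≠ fF m F y := by
    intro x y hx hy h
    rw [fF_R hx, fF_nR hy] at h
    have : x = y + 2 * m := H.inj (by rw [H.add2]; omega)
    rw [this, H.RR_add2] at hx
    exact hy hx
  intro x y h
  by_cases hx : RR m F x <;> by_cases hy : RR m F y
  · rw [fF_R hx, fF_R hy] at h; exact H.inj (by omega)
  · exact absurd h (key x y hx hy)
  · exact absurd h.symm (key y x hy hx)
  · rw [fF_nR hx, fF_nR hy] at h; exact H.inj h

theorem fF_surj (y : ℤ) : ∃ x, fF m F x = y := by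
  have h : F (G (y - 2 * m - 1)) = y := by rw [H.dual]; ring
  by_cases hR : RR m F (G (y - 2 * m - 1))
  · exact ⟨G (y - 2 * m - 1) + 2 * m, by rw [fF_R ((H.RR_add2 _).mpr hR), H.add2]; omega⟩
  · exact ⟨_, by rw [fF_nR hR]; exact h⟩

theorem fF_le {x : ℤ} (h : RR m F x) : fF m F x ≤ x := by
  have := H.hi x; rw [fF_R h]; omega

theorem fF_gt {x : ℤ} (h : RR m F x) : x - m < fF m F x := by
  rw [fF_R h]; unfold RR at h; omega

theorem fF_lt {x : ℤ} (h : ¬ RR m F x) : x < fF m F x := by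
  have := H.lo x; rw [fF_nR h]; omega

theorem fF_le' {x : ℤ} (h : ¬ RR m F x) : fF m F x ≤ x + m := by
  rw [fF_nR h]; unfold RR at h; omega

theorem fF_maps {x y : ℤ} (hx : RR m F x) (h1 : fF m F x ≤ y) (h2 : y ≤ x) :
    fF m F x ≤ fF m F y ∧ fF m F y ≤ x := by
  have h0 := H.hi x
  have hl := H.lo y
  have hh := H.hi y
  rw [fF_R hx] at h1 ⊢
  have hx' := hx
  unfold RR at hx'
  by_cases hy : RR m F y
  · rw [fF_R hy]
    unfold RR at hy
    rcases H.nc' h1 h2 with h | h <;> omega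
  · rw [fF_nR hy]
    unfold RR at hy
    rcases H.nc' h1 h2 with h | h <;> omega

theorem fF_mapsI {x : ℤ} (hx : RR m F x) :
    (Finset.Icc (fF m F x) x).image (fF m F) = Finset.Icc (fF m F x) x := by
  apply Finset.eq_of_subset_of_card_le
  · intro y hy
    obtain ⟨z, hz, rfl⟩ := Finset.mem_image.mp hy
    rw [Finset.mem_Icc] at hz ⊢
    exact H.fF_maps hx hz.1 hz.2
  · rw [Finset.card_image_of_injective _ H.fF_inj]

theorem fF_maps' {x y : ℤ} (hx : RR m F x) (h1 : fF m F x ≤ fF m F y) (h2 : fF m F y ≤ x) :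
    fF m F x ≤ y ∧ y ≤ x := by
  have : fF m F y ∈ Finset.Icc (fF m F x) x := Finset.mem_Icc.mpr ⟨h1, h2⟩
  rw [← H.fF_mapsI hx] at this
  obtain ⟨z, hz, h⟩ := Finset.mem_image.mp this
  rw [H.fF_inj h, Finset.mem_Icc] at hz
  exact hz

theorem fF_succ {z : ℤ} (h1 : ¬ RR m F z) (h2 : ¬ LL m F (z + 1)) : fF m F z = z + 1 := by
  obtain ⟨w, hw⟩ := H.fF_surj (z + 1)
  have hwR : ¬ RR m F w := fun h => h2 ⟨w, h, hw⟩
  have hlt := H.fF_lt hwR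
  have hle := H.fF_le' hwR
  by_cases hwz : w = z
  · rw [← hwz] at hw ⊢; exact hw
  · rw [fF_nR hwR] at hw
    exfalso
    have hl := H.lo z
    apply h1
    unfold RR
    rw [fF_nR hwR] at hle hlt
    rcases H.nc (show w < z by omega) (by omega) with h | h <;> omega

end LP

open Classical in
theorem LP.count {m : ℕ} {F G : ℤ → ℤ} (H : LP m F G) {x : ℤ} (hx : RR m F x) :
    ((Finset.Icc (fF m F x) x).filter (LL m F)).card =
      ((Finset.Icc (fF m F x) x).filter (RR m F)).card := by
  symm
  rw [← Finset.card_image_of_injective _ H.fF_inj]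
  congr 1
  ext y
  simp only [Finset.mem_image, Finset.mem_filter, Finset.mem_Icc]
  constructor
  · rintro ⟨z, ⟨⟨h1, h2⟩, h3⟩, rfl⟩
    exact ⟨H.fF_maps hx h1 h2, z, h3, rfl⟩
  · rintro ⟨⟨h1, h2⟩, z, h3, rfl⟩
    exact ⟨z, ⟨H.fF_maps' hx h1 h2, h3⟩, rfl⟩

section
variable {m : ℕ} {F G F' G' : ℤ → ℤ} (H : LP m F G) (H' : LP m F' G')
include H H'

theorem LP.det_aux (hR : ∀ x, RR m F x ↔ RR m F' x) (hL : ∀ x, LL m F x ↔ LL m F' x) {x : ℤ}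
    (hx : RR m F x) : fF m F x ≤ fF m F' x := by
  classical
  by_contra hc
  push Not at hc
  have h1 := H.count hx
  have hx' := (hR x).mp hx
  have h2 : ((Finset.Icc (fF m F x) x).filter (LL m F)).card ≤
      (((Finset.Icc (fF m F x) x).filter (RR m F)).erase x).card := by
    rw [← Finset.card_image_of_injective (((Finset.Icc (fF m F x) x).filter (RR m F)).erase x)
      H'.fF_inj]
    apply Finset.card_le_card
    intro y hy
    rw [Finset.mem_filter, Finset.mem_Icc] at hy
    obtain ⟨w, hw, hwy⟩ := (hL y).mp hy.2
    refine Finset.mem_image.mpr ⟨w, ?_, hwy⟩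
    have h3 := H'.fF_maps' (y := w) hx' (by omega) (by omega)
    have h4 := H'.fF_le hw
    rw [Finset.mem_erase, Finset.mem_filter, Finset.mem_Icc]
    refine ⟨?_, by omega, (hR w).mpr hw⟩
    rintro rfl; omega
  have h5 : x ∈ (Finset.Icc (fF m F x) x).filter (RR m F) := by
    rw [Finset.mem_filter, Finset.mem_Icc]
    exact ⟨⟨H.fF_le hx, le_refl _⟩, hx⟩
  rw [Finset.card_erase_of_mem h5] at h2
  have := Finset.card_pos.mpr ⟨x, h5⟩
  omega
end

namespace LP
variable {m : ℕ} {F G F' G' : ℤ → ℤ} (H : LP m F G) (H' : LP m F' G')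

section
include H
theorem g_spec {x : ℤ} (h : RR m G x) : ¬ RR m F (fF m G x) ∧ fF m F (fF m G x) = x + 1 := by
  have hd := H.dual x
  rw [fF_R h]
  have h1 : F (G x - 2 * m) = x + 1 := by
    have := H.add2 (G x - 2 * m); rw [sub_add_cancel] at this; omega
  have h2 : ¬ RR m F (G x - 2 * m) := by unfold RR at *; omega
  exact ⟨h2, by rw [fF_nR h2, h1]⟩

theorem RR_dual (x : ℤ) : RR m G x ↔ ¬ LL m F (x + 1) := by
  constructor
  · rintro h ⟨w, hw, hw'⟩
    have := H.g_spec h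
    rw [← hw'] at this
    exact this.1 (H.fF_inj this.2 ▸ hw)
  · intro h
    obtain ⟨w, hw⟩ := H.fF_surj (x + 1)
    have hwR : ¬ RR m F w := fun h' => h ⟨w, h', hw⟩
    rw [fF_nR hwR] at hw
    have : G x = w + 2 * m := H.inj (by rw [H.dual, H.add2]; omega)
    unfold RR at *; omega

theorem LL_dual (x : ℤ) : LL m G x ↔ ¬ RR m F x := by
  constructor
  · rintro ⟨w, hw, rfl⟩; exact (H.g_spec hw).1
  · intro h
    have h1 : RR m G (fF m F x - 1) := by
      rw [H.RR_dual]
      rintro ⟨w, hw, hw'⟩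
      rw [sub_add_cancel] at hw'
      exact h (H.fF_inj hw' ▸ hw)
    refine ⟨_, h1, ?_⟩
    have := (H.g_spec h1).2
    rw [sub_add_cancel] at this
    exact H.fF_inj this
end

include H H'
theorem det (hR : ∀ x, RR m F x ↔ RR m F' x) (hL : ∀ x, LL m F x ↔ LL m F' x) : F = F' := by
  have h1 : ∀ x, fF m F x = fF m F' x := by
    intro x
    by_cases hx : RR m F x
    · exact le_antisymm (H.det_aux H' hR hL hx)
        (H'.det_aux H (fun x => (hR x).symm) (fun x => (hL x).symm) ((hR x).mp hx))
    · obtain ⟨z, hz, hzx⟩ := (H.LL_dual x).mpr hx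
      have a1 : ∀ x, RR m G x ↔ RR m G' x := fun x => by rw [H.RR_dual, H'.RR_dual, hL]
      have a2 : ∀ x, LL m G x ↔ LL m G' x := fun x => by rw [H.LL_dual, H'.LL_dual, hR]
      have h3 : fF m G z = fF m G' z := le_antisymm (H.symm.det_aux H'.symm a1 a2 hz)
        (H'.symm.det_aux H.symm (fun x => (a1 x).symm) (fun x => (a2 x).symm) ((a1 z).mp hz))
      have h4 := (H.g_spec hz).2
      have h5 := (H'.g_spec ((a1 z).mp hz)).2
      rw [← h3, hzx] at h5
      rw [hzx] at h4
      rw [h4, h5]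
  ext x
  have := h1 x
  by_cases hx : RR m F x
  · rw [fF_R hx, fF_R ((hR x).mp hx)] at this; omega
  · rw [fF_nR hx, fF_nR (fun h => hx ((hR x).mpr h))] at this; omega
end LP

theorem per_mul {α : Type*} {P : ℤ → α} {m : ℕ} (h : ∀ x, P (x + m) = P x) (x k : ℤ) :
    P (x + m * k) = P x := by
  have hp : Function.Periodic P (m : ℤ) := h
  have := hp.int_mul k x
  rw [mul_comm]; simpa using this

theorem per_mod {α : Type*} {P : ℤ → α} {m : ℕ} (h : ∀ x, P (x + m) = P x) (x : ℤ) :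
    P (x % m) = P x := by
  conv_rhs => rw [← Int.emod_add_mul_ediv x m]
  rw [per_mul h]

open Classical in
noncomputable def pfin (m : ℕ) (P : ℤ → Prop) : Finset ℤ := (Finset.Ico 0 (m : ℤ)).filter P

theorem mem_pfin {m : ℕ} {P : ℤ → Prop} {x : ℤ} : x ∈ pfin m P ↔ (0 ≤ x ∧ x < m) ∧ P x := by
  classical
  unfold pfin; rw [Finset.mem_filter, Finset.mem_Ico]

theorem LP.fF_mul {m : ℕ} {F G : ℤ → ℤ} (H : LP m F G) (x k : ℤ) :
    fF m F (x + m * k) = fF m F x + m * k := by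
  have := per_mul (P := fun x => fF m F x - x) (m := m) (fun x => by
    rw [H.fF_add]; ring) x k
  linarith

theorem LP.RR_mod {m : ℕ} {F G : ℤ → ℤ} (H : LP m F G) (x : ℤ) : RR m F (x % m) ↔ RR m F x :=
  Iff.of_eq (per_mod (fun x => propext (H.RR_add x)) x)

theorem LP.LL_mod {m : ℕ} {F G : ℤ → ℤ} (H : LP m F G) (x : ℤ) : LL m F (x % m) ↔ LL m F x :=
  Iff.of_eq (per_mod (fun x => propext (H.LL_add x)) x)

theorem LP.card_LR {m : ℕ} {F G : ℤ → ℤ} (H : LP m F G) :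
    (pfin m (LL m F)).card = (pfin m (RR m F)).card := by
  have hm := H.pos
  symm
  apply Finset.card_bij (fun x _ => fF m F x % m)
  · intro x hx
    rw [mem_pfin] at hx ⊢
    refine ⟨⟨Int.emod_nonneg _ (by omega), Int.emod_lt_of_pos _ (by omega)⟩, ?_⟩
    rw [H.LL_mod]; exact ⟨x, hx.2, rfl⟩
  · intro x hx y hy h
    rw [mem_pfin] at hx hy
    have h1 := Int.emod_add_mul_ediv (fF m F x) m
    have h2 := Int.emod_add_mul_ediv (fF m F y) m
    have h3 : fF m F x = fF m F (y + m * (fF m F x / m - fF m F y / m)) := by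
      rw [H.fF_mul]; linarith
    have h4 := H.fF_inj h3
    have h5 : x % m = y % m := by rw [h4]; simp
    rwa [Int.emod_eq_of_lt (by omega) (by omega), Int.emod_eq_of_lt (by omega) (by omega)] at h5
  · intro y hy
    rw [mem_pfin] at hy
    obtain ⟨x, hx, rfl⟩ := hy.2
    refine ⟨x % m, mem_pfin.mpr ⟨⟨Int.emod_nonneg _ (by omega), Int.emod_lt_of_pos _ (by omega)⟩,
      (H.RR_mod x).mpr hx⟩, ?_⟩
    have h1 := Int.emod_add_mul_ediv x m
    have h2 := H.fF_mul (x % m) (x / m)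
    rw [h1] at h2
    have h3 : (fF m F x) % m = fF m F (x % m) % m := by rw [h2]; simp
    rw [← h3, Int.emod_eq_of_lt (by omega) (by omega)]

/-! counting R -/
noncomputable def big (m : ℕ) (τ : Equiv.Perm ℤ) : Finset ℤ :=
  (Sf m).filter (fun s => (m : ℤ) < dD m τ s)

theorem mem_big {m : ℕ} {τ : Equiv.Perm ℤ} {s : ℤ} :
    s ∈ big m τ ↔ s ∈ signedSet m ∧ (m : ℤ) < dD m τ s := by
  unfold big; rw [Finset.mem_filter, mem_Sf]

theorem big_inj {m : ℕ} (hm : 0 < m) {τ : Equiv.Perm ℤ} (hτ : NCm m τ) {s t : ℤ}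
    (hs : s ∈ big m τ) (ht : t ∈ big m τ) (h : permOrbit τ s = permOrbit τ t) : s = t := by
  by_contra hne
  rw [mem_big] at hs ht
  have h1 := fsum_eq hm hτ (mem_orbs.mpr ⟨t, ht.1, rfl⟩)
  unfold fsum at h1
  have := Finset.add_le_sum (f := dD m τ) (fun y _ => by have := dD_pos hm τ y; omega)
    (mem_fib.mpr ⟨hs.1, h⟩) (mem_fib.mpr ⟨ht.1, rfl⟩) hne
  omega

theorem big_ns {m : ℕ} (hm : 0 < m) {τ : Equiv.Perm ℤ} (hτ : NCm m τ) {s : ℤ}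
    (hs : s ∈ big m τ) : permOrbit τ s ∈ nsOrb m τ := by
  have hs' := mem_big.mp hs
  refine ⟨⟨s, hs'.1, rfl⟩, ?_⟩
  rw [negSet_permOrbit hτ.1]
  intro h
  have hn : -s ∈ big m τ := mem_big.mpr ⟨neg_mem_signed.mpr hs'.1, by
    rw [dD_neg hm hτ.1 hs'.1]; exact hs'.2⟩
  have := big_inj hm hτ hn hs h
  have := hs'.1.1
  omega

theorem nsOrb_finite (m : ℕ) (τ : Equiv.Perm ℤ) : (nsOrb m τ).Finite :=
  (orbs m τ).finite_toSet.subset (fun _ hA => mem_orbs.mpr hA.1)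

open Classical in
theorem big_le {m : ℕ} (hm : 0 < m) {τ : Equiv.Perm ℤ} (hτ : NCm m τ) :
    (big m τ).card ≤ 2 * cB m τ := by
  rw [← nsOrb_ncard hτ.1, ← Finset.card_image_of_injOn (f := permOrbit τ) (s := big m τ)
    (fun s hs t ht h => big_inj hm hτ hs ht h), ← Set.ncard_coe_finset]
  apply Set.ncard_le_ncard _ (nsOrb_finite m τ)
  intro A hA
  obtain ⟨s, hs, rfl⟩ := Finset.mem_image.mp (Finset.mem_coe.mp hA)
  exact big_ns hm hτ hs

theorem big_add {m : ℕ} (hm : 0 < m) {τ : Equiv.Perm ℤ} (hτ : inB m τ) :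
    (big m τ).card + (big m (τ⁻¹ * gammaDisc m)).card = 2 * m := by
  have hσ : inB m (τ⁻¹ * gammaDisc m) := inB_mul (inB_inv hτ) (gd_inB hm)
  rw [← card_Sf m, ← Finset.card_filter_add_card_filter_not (s := Sf m)
    (fun s => (m : ℤ) < dD m τ ((τ⁻¹ * gammaDisc m) s))]
  congr 1
  · symm
    apply Finset.card_equiv (τ⁻¹ * gammaDisc m)
    intro s
    rw [mem_big, Finset.mem_filter, mem_Sf, inB_mem hσ]
  · congr 1
    apply Finset.filter_congr
    intro s hs
    have := dD_dual hm hτ (mem_Sf.mp hs)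
    omega

theorem big_eq {m : ℕ} (hm : 0 < m) {τ : Equiv.Perm ℤ} (hτ : NCm m τ) :
    (big m τ).card = 2 * cB m τ := by
  have h1 := big_le hm hτ
  have h2 := big_le hm (NCm_dual hm hτ)
  have h3 := big_add hm hτ.1
  have h4 := hτ.2
  omega

open Classical in
theorem big_surj {m : ℕ} (hm : 0 < m) {τ : Equiv.Perm ℤ} (hτ : NCm m τ) {A : Set ℤ}
    (hA : A ∈ nsOrb m τ) : ∃ s ∈ big m τ, permOrbit τ s = A := by
  have h : ((big m τ).image (permOrbit τ) : Set (Set ℤ)) = nsOrb m τ := by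
    apply Set.eq_of_subset_of_ncard_le _ _ (nsOrb_finite m τ)
    · intro A hA
      obtain ⟨s, hs, rfl⟩ := Finset.mem_image.mp (Finset.mem_coe.mp hA)
      exact big_ns hm hτ hs
    · rw [nsOrb_ncard hτ.1, Set.ncard_coe_finset, Finset.card_image_of_injOn
        (fun s hs t ht h => big_inj hm hτ hs ht h), big_eq hm hτ]
  rw [← h] at hA
  obtain ⟨s, hs, rfl⟩ := Finset.mem_image.mp (Finset.mem_coe.mp hA)
  exact ⟨s, hs, rfl⟩

theorem RR_big {m : ℕ} (hm : 0 < m) {τ : Equiv.Perm ℤ} (x : ℤ) :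
    RR m (liftF m τ) x ↔ ph m x ∈ big m τ := by
  rw [mem_big, and_iff_right (ph_mem hm x)]
  unfold RR; rw [dD_ph hm]; omega

theorem ph_small {m : ℕ} {x : ℤ} (h0 : 0 ≤ x) (h1 : x < m) : ph m x = x + 1 := by
  unfold ph; rw [Int.emod_eq_of_lt h0 (by omega), if_pos h1]

theorem card_RR {m : ℕ} (hm : 0 < m) {τ : Equiv.Perm ℤ} (hτ : NCm m τ) :
    (pfin m (RR m (liftF m τ))).card = cB m τ := by
  have h1 := big_eq hm hτ
  have h2 := Finset.card_filter_add_card_filter_not (s := big m τ) (fun s => 0 < s)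
  have h3 : ((big m τ).filter (fun s => ¬ 0 < s)).card = ((big m τ).filter (fun s => 0 < s)).card := by
    apply Finset.card_equiv (Equiv.neg ℤ)
    intro s
    simp only [Finset.mem_filter, Equiv.neg_apply, mem_big, neg_mem_signed]
    constructor
    · rintro ⟨⟨a, b⟩, c⟩
      have := a.1
      exact ⟨⟨a, by rwa [dD_neg hm hτ.1 a]⟩, by omega⟩
    · rintro ⟨⟨a, b⟩, c⟩
      exact ⟨⟨a, by rwa [dD_neg hm hτ.1 a] at b⟩, by omega⟩
  have h4 : (pfin m (RR m (liftF m τ))).card = ((big m τ).filter (fun s => 0 < s)).card := by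
    apply Finset.card_equiv (Equiv.addRight 1)
    intro x
    rw [mem_pfin, Finset.mem_filter, RR_big hm]
    simp only [Equiv.coe_addRight]
    constructor
    · rintro ⟨⟨a, b⟩, c⟩; rw [ph_small a b] at c; exact ⟨c, by omega⟩
    · rintro ⟨c, d⟩
      have := (mem_big.mp c).1
      rw [mem_signed] at this
      rw [ph_small (by omega) (by omega)]
      exact ⟨by omega, c⟩
  omega

/-! zero points -/
def Zpt (m : ℕ) (ρ : Equiv.Perm ℤ) (a : ℤ) : Prop := a ∈ signedSet m ∧ ∀ u ∈ FixS m ρ, u a = 0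

theorem Zpt_iff {m : ℕ} {ρ : Equiv.Perm ℤ} (hρ : inB m ρ) {a : ℤ} :
    Zpt m ρ a ↔ a ∈ signedSet m ∧ -a ∈ permOrbit ρ a := by
  unfold Zpt
  refine and_congr_right fun ha => ⟨fun h => ?_, fun h u hu => fix_sym hu h⟩
  by_contra hc
  obtain ⟨u, hu, h1⟩ := exists_fix hρ ha hc
  rw [h u hu] at h1
  norm_num at h1

theorem ph_fF {m : ℕ} (hm : 0 < m) {τ : Equiv.Perm ℤ} (hτ : inB m τ) (x : ℤ) :
    ph m (fF m (liftF m τ) x) = τ (ph m x) := by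
  rw [← ph_liftF hm hτ]
  by_cases h : RR m (liftF m τ) x
  · rw [fF_R h, ← ph_addN hm, sub_add_cancel]
  · rw [fF_nR h]

theorem ph_fFiter {m : ℕ} (hm : 0 < m) {τ : Equiv.Perm ℤ} (hτ : inB m τ) (x : ℤ) (r : ℕ) :
    ph m ((fF m (liftF m τ))^[r] x) = (τ ^ r) (ph m x) := by
  induction r with
  | zero => simp
  | succ r ih => rw [Function.iterate_succ_apply', ph_fF hm hτ, ih, pow_succ', Perm.mul_apply]

theorem Zpt_ph {m : ℕ} (hm : 0 < m) {τ : Equiv.Perm ℤ} (hτ : NCm m τ) (x : ℤ) :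
    Zpt m τ (ph m x) ↔ ∀ r : ℕ, ¬ RR m (liftF m τ) ((fF m (liftF m τ))^[r] x) := by
  rw [Zpt_iff hτ.1, and_iff_right (ph_mem hm x)]
  constructor
  · intro h r hr
    rw [RR_big hm, ph_fFiter hm hτ.1] at hr
    have h1 := (big_ns hm hτ hr).2
    have h2 : permOrbit τ ((τ ^ r) (ph m x)) = permOrbit τ (ph m x) :=
      permOrbit_eq ⟨r, by simp⟩
    rw [h2, negSet_permOrbit hτ.1] at h1
    exact h1 (permOrbit_eq h)
  · intro h
    by_contra hc
    have hns : permOrbit τ (ph m x) ∈ nsOrb m τ := by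
      refine ⟨⟨_, ph_mem hm x, rfl⟩, ?_⟩
      rw [negSet_permOrbit hτ.1, Ne, permOrbit_eq_iff]
      exact hc
    obtain ⟨s, hs, hso⟩ := big_surj hm hτ hns
    have hsS := (mem_big.mp hs).1
    rw [permOrbit_eq_iff] at hso
    obtain ⟨k, hk⟩ := hso
    -- make exponent natural
    obtain ⟨r, hr⟩ : ∃ r : ℕ, (τ ^ r) (ph m x) = s := by
      obtain ⟨p, hp⟩ := wind hm hτ x
      have hp1 := congrArg (ph m) hp
      rw [iter_ph hm hτ.1, ph_addN hm] at hp1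
      have hp0 : 0 < p := by
        rcases Nat.eq_zero_or_pos p with h0 | h0
        · subst h0; simp at hp; omega
        · exact h0
      refine ⟨(k % p).toNat, ?_⟩
      have hk2 : ((k % p).toNat : ℤ) = k % p := Int.toNat_of_nonneg (Int.emod_nonneg _ (by omega))
      have hpz : ∀ j : ℤ, (τ ^ ((p : ℤ) * j)) (ph m x) = ph m x := by
        intro j
        rw [zpow_mul, zpow_natCast]
        exact Perm.zpow_apply_eq_self_of_apply_eq_self hp1 j
      rw [← zpow_natCast, hk2, ← hk]
      conv_rhs => rw [← Int.emod_add_mul_ediv k p, zpow_add, Perm.mul_apply, hpz]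
    apply h r
    rw [RR_big hm, ph_fFiter hm hτ.1, hr]
    exact hs

open Classical in
noncomputable def bInd (B : Set ℤ) : ℤ → ℚ := fun s => if s ∈ B then 1 else if -s ∈ B then -1 else 0

theorem bInd_fix {n : ℕ} {τ : Equiv.Perm ℤ} (hτ : inB n τ) {B : Set ℤ} (hB : B ⊆ signedSet n)
    (h1 : ∀ s, τ s ∈ B ↔ s ∈ B) (h2 : ∀ s ∈ B, -s ∉ B) : bInd B ∈ FixS n τ := by
  unfold bInd
  refine ⟨fun s => ?_, fun s hs => ?_, fun s => ?_⟩
  · by_cases a : s ∈ B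
    · simp [a, h2 s a]
    · by_cases b : -s ∈ B <;> simp [a, b]
  · have a : s ∉ B := fun h => hs (hB h)
    have b : -s ∉ B := fun h => hs (neg_mem_signed.mp (hB h))
    simp [a, b]
  · have := h1 (-s)
    rw [hτ.1] at this
    by_cases a : s ∈ B <;> by_cases b : -s ∈ B <;> simp [h1 s, this, a, b]

theorem perm_set_iff {τ : Equiv.Perm ℤ} {B : Set ℤ} (h1 : ∀ s ∈ B, τ s ∈ B)
    (h2 : ∀ s ∈ B, ∃ t ∈ B, τ t = s) (s : ℤ) : τ s ∈ B ↔ s ∈ B := by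
  refine ⟨fun h => ?_, h1 s⟩
  obtain ⟨t, ht, hts⟩ := h2 _ h
  rwa [← τ.injective hts]

theorem NCm_step {m : ℕ} (hm : 0 < m) {τ : Equiv.Perm ℤ} (hτ : NCm m τ) {a b : ℤ}
    (ha : a ∈ signedSet m) (hb : b ∈ signedSet m) (hab : a ≠ b)
    (h : cB m (τ * rf a b) = cB m τ + 1) : NCm m (τ * rf a b) := by
  refine ⟨inB_mul hτ.1 (rf_inB ha hb hab), ?_⟩
  have h1 := cB_add_le (n := m) (τ * rf a b) (gammaDisc m) (gd_cB hm)
  have h2 := cB_rf_mul (n := m) (τ⁻¹ * gammaDisc m) ha hb hab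
  have h3 := hτ.2
  rw [mul_inv_rev, rf_inv ha.1 hb.1 hab, mul_assoc] at h1 ⊢
  omega

theorem gd_NCm {m : ℕ} (hm : 0 < m) : NCm m (gammaDisc m) := by
  refine ⟨gd_inB hm, ?_⟩
  rw [gd_cB hm, inv_mul_cancel, cB_one, zero_add]

theorem gd_lift {m : ℕ} (hm : 0 < m) (x : ℤ) : liftF m (gammaDisc m) x = x + 1 :=
  liftF_unique hm (gd_inB hm) (by omega) (by omega) (by rw [gd_ph hm])

theorem ph_eq_neg_iff {m : ℕ} (hm : 0 < m) {x y : ℤ} :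
    (ph m x = ph m y ∨ ph m x = - ph m y) ↔ (m : ℤ) ∣ y - x := by
  rw [← ph_add hm, ph_eq_iff hm, ph_eq_iff hm]
  constructor
  · rintro (⟨k, hk⟩ | ⟨k, hk⟩)
    · exact ⟨2 * k, by linarith⟩
    · exact ⟨2 * k - 1, by linarith⟩
  · rintro ⟨k, hk⟩
    rcases Int.even_or_odd' k with ⟨j, rfl | rfl⟩
    · left; exact ⟨j, by linarith⟩
    · right; exact ⟨j + 1, by linarith⟩

theorem card_pfin_erase {m : ℕ} (hm : 0 < m) {P : ℤ → Prop} (hP : ∀ x, P (x + m) ↔ P x) {y : ℤ}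
    (hy : P y) : (pfin m (fun z => P z ∧ ¬ (m : ℤ) ∣ z - y)).card + 1 = (pfin m P).card := by
  classical
  have h : pfin m (fun z => P z ∧ ¬ (m : ℤ) ∣ z - y) = (pfin m P).erase (y % m) := by
    ext z
    rw [Finset.mem_erase, mem_pfin, mem_pfin]
    constructor
    · rintro ⟨a, b, c⟩
      refine ⟨?_, a, b⟩
      rintro rfl
      apply c
      rw [← Int.modEq_iff_dvd]
      exact (Int.mod_modEq y m).symm
    · rintro ⟨a, b, c⟩
      refine ⟨b, c, fun hd => a ?_⟩
      rw [← Int.modEq_iff_dvd] at hd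
      rw [show y % m = z % m from hd, Int.emod_eq_of_lt b.1 b.2]
  have hmem : y % m ∈ pfin m P := by
    rw [mem_pfin]
    exact ⟨⟨Int.emod_nonneg _ (by omega), Int.emod_lt_of_pos _ (by omega)⟩,
      (per_mod (fun x => propext (hP x)) y).mpr hy⟩
  rw [h, Finset.card_erase_add_one hmem]

theorem min_pair {m : ℕ} (hm : 0 < m) {L R : ℤ → Prop} (hR : ∀ x, R (x + m) ↔ R x)
    {y0 x0 : ℤ} (hy : L y0) (hx : R x0) :
    ∃ y x : ℤ, L y ∧ R x ∧ y ≤ x ∧ x < y + m ∧ (∀ z, y ≤ z → z < x → ¬ R z) ∧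
      ∀ z, y < z → z ≤ x → ¬ L z := by
  classical
  have hex : ∃ d : ℕ, ∃ y, L y ∧ R (y + d) := by
    refine ⟨((x0 - y0) % m).toNat, y0, hy, ?_⟩
    rw [Int.toNat_of_nonneg (Int.emod_nonneg _ (by omega))]
    have h1 := per_mul (fun x => propext (hR x)) (y0 + (x0 - y0) % m) ((x0 - y0) / m)
    have h2 := Int.emod_add_mul_ediv (x0 - y0) m
    rw [show y0 + (x0 - y0) % m + m * ((x0 - y0) / m) = x0 by linarith] at h1
    rw [← h1]; exact hx
  obtain ⟨y, h1, h2⟩ := Nat.find_spec hex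
  have hmin := fun k => Nat.find_min hex (m := k)
  set d := Nat.find hex with hd
  refine ⟨y, y + d, h1, h2, by omega, ?_, ?_, ?_⟩
  · by_contra hc
    apply hmin (d - m) (by omega)
    refine ⟨y, h1, ?_⟩
    rw [← hR]
    rwa [show y + ((d - m : ℕ) : ℤ) + m = y + d by omega]
  · intro z hz hz' hRz
    apply hmin (z - y).toNat (by omega)
    exact ⟨y, h1, by rwa [show y + ((z - y).toNat : ℤ) = z by omega]⟩
  · intro z hz hz' hLz
    apply hmin (y + d - z).toNat (by omega)
    exact ⟨z, hLz, by rwa [show z + ((y + d - z).toNat : ℤ) = y + d by omega]⟩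

theorem exists_LR {m : ℕ} (hm : 0 < m) : ∀ (k : ℕ) (L R : ℤ → Prop), (∀ x, L (x + m) ↔ L x) →
    (∀ x, R (x + m) ↔ R x) → (pfin m L).card = k → (pfin m R).card = k →
    ∃ τ, NCm m τ ∧ (∀ x, LL m (liftF m τ) x ↔ L x) ∧ (∀ x, RR m (liftF m τ) x ↔ R x) := by
  intro k
  induction k with
  | zero =>
    intro L R hL hR cL cR
    refine ⟨gammaDisc m, gd_NCm hm, ?_, ?_⟩
    · intro x
      constructor
      · rintro ⟨y, h, _⟩
        unfold RR at h; rw [gd_lift hm] at h; omega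
      · intro h
        exfalso
        have := card_pfin_erase hm hL h
        omega
    · intro x
      constructor
      · intro h; unfold RR at h; rw [gd_lift hm] at h; omega
      · intro h
        exfalso
        have := card_pfin_erase hm hR h
        omega
  | succ k ih =>
    intro L R hL hR cL cR
    obtain ⟨y0, hy0⟩ : ∃ y, L y := by
      obtain ⟨y, hy⟩ := Finset.card_pos.mp (show 0 < (pfin m L).card by omega)
      exact ⟨y, (mem_pfin.mp hy).2⟩
    obtain ⟨x0, hx0⟩ : ∃ y, R y := by
      obtain ⟨y, hy⟩ := Finset.card_pos.mp (show 0 < (pfin m R).card by omega)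
      exact ⟨y, (mem_pfin.mp hy).2⟩
    obtain ⟨y, x, hLy, hRx, hyx, hxm, hnR, hnL⟩ := min_pair hm hR hy0 hx0
    have cL' := card_pfin_erase hm hL hLy
    have cR' := card_pfin_erase hm hR hRx
    have hdv : ∀ (a z : ℤ), (m : ℤ) ∣ z + m - a ↔ (m : ℤ) ∣ z - a := by
      intro a z
      rw [show z + m - a = (z - a) + m by ring, dvd_add_self_right]
    obtain ⟨τ1, hτ1, h1L, h1R⟩ := ih (fun z => L z ∧ ¬ (m : ℤ) ∣ z - y)
      (fun z => R z ∧ ¬ (m : ℤ) ∣ z - x) (fun z => by rw [hL, hdv]) (fun z => by rw [hR, hdv])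
      (by omega) (by omega)
    have H1 := NCm_LP hm hτ1
    set F1 := liftF m τ1 with hF1
    have hR1 : ∀ z, y ≤ z → z ≤ x → ¬ RR m F1 z := by
      intro z h1 h2
      rw [h1R]
      rintro ⟨a, b⟩
      rcases eq_or_lt_of_le h2 with h | h
      · subst h; simp at b
      · exact hnR z h1 h a
    have hL1 : ∀ z, y ≤ z → z ≤ x → ¬ LL m F1 z := by
      intro z h1 h2
      rw [h1L]
      rintro ⟨a, b⟩
      rcases eq_or_lt_of_le h1 with h | h
      · subst h; simp at b
      · exact hnL z h h2 a
    have hs : ∀ z, y ≤ z → z < x → fF m F1 z = z + 1 := fun z h1 h2 =>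
      H1.fF_succ (hR1 z h1 (by omega)) (hL1 (z + 1) (by omega) (by omega))
    obtain ⟨p, hp⟩ := H1.fF_surj y
    have hpR : ¬ RR m F1 p := fun h => hL1 y (le_refl _) hyx ⟨p, h, hp⟩
    have hpy := H1.fF_lt hpR
    have hpm := H1.fF_le' hpR
    have hxR := hR1 x hyx (le_refl _)
    obtain ⟨q, hq⟩ : ∃ q, fF m F1 x = q := ⟨_, rfl⟩
    have hxq := H1.fF_lt hxR
    have hqm := H1.fF_le' hxR
    rw [hp] at hpy hpm
    rw [hq] at hxq hqm
    have hpx : x - m ≤ p := by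
      by_contra hc
      have h1 := hs (p + m) (by omega) (by omega)
      rw [H1.fF_add, hp] at h1
      omega
    have hτp : τ1 (ph m p) = ph m y := by rw [← hp, ph_fF hm hτ1.1]
    have hτx : τ1 (ph m x) = ph m q := by rw [← hq, ph_fF hm hτ1.1]
    have hτz : ∀ z, y ≤ z → z < x → τ1 (ph m z) = ph m (z + 1) := fun z h1 h2 => by
      rw [← hs z h1 h2, ph_fF hm hτ1.1]
    have hne : ph m p ≠ ph m x := by
      intro h
      rw [ph_eq_iff hm] at h
      have := Int.le_of_dvd (by omega) h
      omega
    have hpS := ph_mem hm p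
    have hxS := ph_mem hm x
    set τ := τ1 * rf (ph m p) (ph m x) with hτdef
    have hτB : inB m τ := inB_mul hτ1.1 (rf_inB hpS hxS hne)
    have tp : τ (ph m p) = ph m q := by
      rw [hτdef, Perm.mul_apply, rf_left hpS.1 hxS.1 hne, hτx]
    have tx : τ (ph m x) = ph m y := by
      rw [hτdef, Perm.mul_apply, rf_right hpS.1 hxS.1 hne, hτp]
    have tz : ∀ z, ¬ (m : ℤ) ∣ z - p → ¬ (m : ℤ) ∣ z - x → τ (ph m z) = τ1 (ph m z) := by
      intro z h1 h2
      rw [← dvd_neg, neg_sub, ← ph_eq_neg_iff hm] at h1 h2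
      rw [hτdef, Perm.mul_apply, rf_apply _ _ hpS.1 hxS.1 hne]
      push Not at h1 h2
      rw [if_neg h1.1, if_neg h2.1, if_neg h1.2, if_neg h2.2]
    have hndvd : ∀ z a : ℤ, a < z → z < a + m → ¬ (m : ℤ) ∣ z - a := by
      intro z a h1 h2 h
      have := Int.le_of_dvd (by omega) h
      omega
    have hndvd' : ∀ z a : ℤ, a < z → z < a + m → ¬ (m : ℤ) ∣ a - z := by
      intro z a h1 h2 h
      rw [← dvd_neg, neg_sub] at h
      exact hndvd z a h1 h2 h
    have hcB : cB m τ = cB m τ1 + 1 := by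
      set B : Set ℤ := {s | ∃ z, y ≤ z ∧ z ≤ x ∧ ph m z = s} with hB
      have hBn : ∀ z, (∃ k : ℤ, y ≤ z + 2 * m * k ∧ z + 2 * m * k ≤ x) ↔ ph m z ∈ B := by
        intro z
        constructor
        · rintro ⟨k, h1, h2⟩
          exact ⟨_, h1, h2, by rw [eq_comm, ph_eq_iff hm]; exact ⟨k, by ring⟩⟩
        · rintro ⟨w, h1, h2, h3⟩
          rw [eq_comm, ph_eq_iff hm] at h3
          obtain ⟨k, hk⟩ := h3
          exact ⟨k, by linarith, by linarith⟩
      have hpB : ph m p ∉ B := by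
        rw [← hBn]
        rintro ⟨k, h1, h2⟩
        rcases lt_trichotomy k 0 with h | h | h
        · have : (2 * m : ℤ) * k ≤ 0 := mul_nonpos_of_nonneg_of_nonpos (by omega) (by omega)
          omega
        · subst h; omega
        · have : (2 * m : ℤ) * 1 ≤ 2 * m * k := mul_le_mul_of_nonneg_left (by omega) (by omega)
          omega
      apply cB_lt_of τ1 hpS hxS hne _ (bInd B)
      · apply bInd_fix hτB
        · rintro s ⟨z, _, _, rfl⟩; exact ph_mem hm z
        · apply perm_set_iff
          · rintro s ⟨z, h1, h2, rfl⟩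
            rcases eq_or_lt_of_le h2 with h | h
            · rw [h, tx]; exact ⟨y, le_refl _, hyx, rfl⟩
            · rw [tz z _ (hndvd' x z h (by omega)), hτz z h1 h]
              · exact ⟨z + 1, by omega, by omega, rfl⟩
              · exact hndvd z p (by omega) (by omega)
          · rintro s ⟨z, h1, h2, rfl⟩
            rcases eq_or_lt_of_le h1 with h | h
            · exact ⟨ph m x, ⟨x, hyx, le_refl _, rfl⟩, by rw [tx, h]⟩
            · refine ⟨ph m (z - 1), ⟨z - 1, by omega, by omega, rfl⟩, ?_⟩
              rw [tz (z - 1) _ (hndvd' x _ (by omega) (by omega)), hτz (z - 1) (by omega) (by omega),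
                sub_add_cancel]
              exact hndvd _ p (by omega) (by omega)
        · rintro s ⟨z, h1, h2, rfl⟩ h3
          rw [← ph_add hm, ← hBn] at h3
          obtain ⟨k, h4, h5⟩ := h3
          rcases lt_or_ge k 0 with h | h
          · have : (2 * m : ℤ) * k ≤ 2 * m * (-1) := mul_le_mul_of_nonneg_left (by omega) (by omega)
            omega
          · have : (2 * m : ℤ) * 0 ≤ 2 * m * k := mul_le_mul_of_nonneg_left (by omega) (by omega)
            omega
      · intro hu
        have h1 := hu.2.2 (ph m p)
        have hyB : ph m y ∈ B := ⟨y, le_refl _, hyx, rfl⟩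
        rw [hτp] at h1
        unfold bInd at h1
        rw [if_pos hyB, if_neg hpB] at h1
        split_ifs at h1 <;> norm_num at h1
      · intro u hu
        have h1 : ∀ i : ℕ, y + i ≤ x → u (ph m (y + i)) = u (ph m y) := by
          intro i
          induction i with
          | zero => simp
          | succ i ih' =>
            intro hi
            push_cast at hi ⊢
            rw [← ih' (by omega), ← hu.2.2 (ph m (y + i)), hτz _ (by omega) (by omega), add_assoc]
        have h2 := h1 (x - y).toNat (by omega)
        rw [show y + ((x - y).toNat : ℤ) = x by omega] at h2
        rw [h2, ← hu.2.2 (ph m p), hτp]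
    have hτ : NCm m τ := NCm_step hm hτ1 hpS hxS hne hcB
    have H := NCm_LP hm hτ
    refine ⟨τ, hτ, ?_⟩
    set F := liftF m τ with hF
    have Fx : F x = y + 2 * m := liftF_unique hm hτB (by omega) (by omega) (by
      rw [ph_addN hm, tx])
    have Rx : RR m F x := by unfold RR; omega
    have fx : fF m F x = y := by rw [fF_R Rx, Fx]; ring
    have hdvm : ∀ z a : ℤ, (m : ℤ) ∣ z - a → ∃ k, z = a + m * k := by
      rintro z a ⟨k, hk⟩; exact ⟨k, by linarith⟩
    have RRk : ∀ z k : ℤ, RR m F (z + m * k) ↔ RR m F z := fun z k =>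
      Iff.of_eq (per_mul (fun x => propext (H.RR_add x)) z k)
    have Rk : ∀ z k : ℤ, R (z + m * k) ↔ R z := fun z k =>
      Iff.of_eq (per_mul (fun x => propext (hR x)) z k)
    have Lk : ∀ z k : ℤ, L (z + m * k) ↔ L z := fun z k =>
      Iff.of_eq (per_mul (fun x => propext (hL x)) z k)
    have Fz : ∀ z, ¬ (m : ℤ) ∣ z - p → ¬ (m : ℤ) ∣ z - x → F z = F1 z := by
      intro z h1 h2
      have := liftF_range hm (τ := τ1) z
      exact liftF_unique hm hτB this.1 this.2 (by rw [tz z h1 h2, ph_liftF hm hτ1.1])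
    have hpnR : ¬ (m : ℤ) ∣ p - x → ¬ R p := fun h1 h2 => hpR ((h1R p).mpr ⟨h2, h1⟩)
    have Fp : ¬ (m : ℤ) ∣ p - x → ¬ RR m F p := by
      intro hpd
      have hpx' : x - m < p := by
        rcases eq_or_lt_of_le hpx with h | h
        · exfalso; apply hpd; exact ⟨-1, by linarith⟩
        · exact h
      have hqp : q ≤ p + m := by
        by_contra hc
        have hxm1 : F1 (x - m) = q - m := by
          rw [← fF_nR (fun h => hxR ((H1.RR_sub x).mp h)), H1.fF_sub, hq]
        have hFp : F1 p = y := by rw [← fF_nR hpR, hp]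
        rcases H1.nc hpx' (by omega) with h | h
        · have h3 := hs (q - m - 1) (by omega) (by omega)
          have h4 : fF m F1 (x - m) = q - m := by rw [H1.fF_sub, hq]
          have := H1.fF_inj (h3.trans (by rw [h4]; ring) : fF m F1 (q - m - 1) = fF m F1 (x - m))
          omega
        · omega
      have : F p = q := liftF_unique hm hτB (by omega) (by omega) tp.symm
      unfold RR; omega
    have hRR : ∀ z, RR m F z ↔ R z := by
      intro z
      by_cases hzx : (m : ℤ) ∣ z - x
      · obtain ⟨k, rfl⟩ := hdvm _ _ hzx
        rw [RRk, Rk]; exact ⟨fun _ => hRx, fun _ => Rx⟩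
      · by_cases hzp : (m : ℤ) ∣ z - p
        · obtain ⟨k, rfl⟩ := hdvm _ _ hzp
          have : ¬ (m : ℤ) ∣ p - x := by
            intro h; apply hzx
            rw [show p + m * k - x = (p - x) + m * k by ring]
            exact dvd_add h (dvd_mul_right _ _)
          rw [RRk, Rk]
          exact ⟨fun h => absurd h (Fp this), fun h => absurd h (hpnR this)⟩
        · have : RR m F z ↔ RR m F1 z := by unfold RR; rw [Fz z hzp hzx]
          rw [this, h1R]
          exact ⟨fun h => h.1, fun h => ⟨h, hzx⟩⟩
    have hfz : ∀ z, R z → ¬ (m : ℤ) ∣ z - x → fF m F z = fF m F1 z := by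
      intro z hz hzx
      have hzp : ¬ (m : ℤ) ∣ z - p := by
        intro h
        obtain ⟨k, rfl⟩ := hdvm _ _ h
        rw [Rk] at hz
        refine hpnR ?_ hz
        intro h'; apply hzx
        rw [show p + m * k - x = (p - x) + m * k by ring]
        exact dvd_add h' (dvd_mul_right _ _)
      unfold fF; rw [Fz z hzp hzx]
    refine ⟨fun w => ?_, hRR⟩
    constructor
    · rintro ⟨z, hz, rfl⟩
      by_cases hzx : (m : ℤ) ∣ z - x
      · obtain ⟨k, rfl⟩ := hdvm _ _ hzx
        rw [H.fF_mul, Lk, fx]; exact hLy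
      · have hRz := (hRR z).mp hz
        rw [hfz z hRz hzx]
        exact ((h1L _).mp ⟨z, (h1R z).mpr ⟨hRz, hzx⟩, rfl⟩).1
    · intro hw
      by_cases hwy : (m : ℤ) ∣ w - y
      · obtain ⟨k, rfl⟩ := hdvm _ _ hwy
        exact ⟨x + m * k, by rw [RRk]; exact Rx, by rw [H.fF_mul, fx]⟩
      · obtain ⟨z, hz, hzw⟩ := (h1L w).mpr ⟨hw, hwy⟩
        obtain ⟨a, b⟩ := (h1R z).mp hz
        exact ⟨z, (hRR z).mpr a, by rw [hfz z a b, hzw]⟩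

noncomputable def cnt (P : ℤ → Prop) (y x : ℤ) : ℕ :=
  open Classical in ((Finset.Ioc y x).filter P).card

theorem cnt_add (P : ℤ → Prop) {a b c : ℤ} (h1 : a ≤ b) (h2 : b ≤ c) :
    cnt P a c = cnt P a b + cnt P b c := by
  classical
  unfold cnt
  rw [← Finset.card_union_of_disjoint]
  · congr 1
    ext z
    simp only [Finset.mem_union, Finset.mem_filter, Finset.mem_Ioc]
    constructor
    · rintro ⟨h, hp⟩
      rcases le_or_gt z b with h' | h'
      · exact Or.inl ⟨⟨h.1, h'⟩, hp⟩
      · exact Or.inr ⟨⟨h', h.2⟩, hp⟩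
    · rintro (⟨h, hp⟩ | ⟨h, hp⟩)
      · exact ⟨by omega, hp⟩
      · exact ⟨by omega, hp⟩
  · rw [Finset.disjoint_left]
    intro z h h'
    simp only [Finset.mem_filter, Finset.mem_Ioc] at h h'
    omega

theorem LP.Zchar {m : ℕ} {F G : ℤ → ℤ} (H : LP m F G) (x : ℤ) :
    (∀ r : ℕ, ¬ RR m F ((fF m F)^[r] x)) ↔
      ¬ RR m F x ∧ ∀ y < x, cnt (LL m F) y x ≤ cnt (RR m F) y x := by
  classical
  constructor
  · intro h
    refine ⟨h 0, fun y hy => ?_⟩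
    unfold cnt
    refine le_trans (Finset.card_le_card ?_) (Finset.card_image_le (f := fF m F))
    intro w hw
    simp only [Finset.mem_filter, Finset.mem_Ioc] at hw
    obtain ⟨⟨h1, h2⟩, z, hz, rfl⟩ := hw
    refine Finset.mem_image.mpr ⟨z, ?_, rfl⟩
    have h3 := H.fF_le hz
    simp only [Finset.mem_filter, Finset.mem_Ioc]
    refine ⟨⟨by omega, ?_⟩, hz⟩
    by_contra hc
    push Not at hc
    have h4 : ∀ r : ℕ, fF m F z ≤ (fF m F)^[r] x ∧ (fF m F)^[r] x ≤ z ∧ x + r ≤ (fF m F)^[r] x := by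
      intro r
      induction r with
      | zero => simp; omega
      | succ r ih =>
        rw [Function.iterate_succ_apply']
        have := H.fF_maps hz ih.1 ih.2.1
        have := H.fF_lt (h r)
        push_cast
        omega
    have := h4 (z - x + 1).toNat
    omega
  · rintro ⟨h0, h⟩
    by_contra hc
    push Not at hc
    have hmin : ∃ r, RR m F ((fF m F)^[r] x) ∧ ∀ s < r, ¬ RR m F ((fF m F)^[s] x) := by
      refine ⟨Nat.find hc, Nat.find_spec hc, fun s hs => Nat.find_min hc hs⟩
    obtain ⟨r, hr, hmin⟩ := hmin
    set f := fF m F with hf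
    have hge : ∀ s ≤ r, x + s ≤ f^[s] x := by
      intro s
      induction s with
      | zero => simp
      | succ s ih =>
        intro hs
        rw [Function.iterate_succ_apply']
        have := H.fF_lt (hmin s (by omega))
        have := ih (by omega)
        rw [← hf] at *
        push_cast; omega
    have hr0 : r ≠ 0 := by
      rintro rfl; exact h0 hr
    have hback : ∀ s ≤ r, f (f^[r] x) ≤ f^[r - s] x ∧ f^[r - s] x ≤ f^[r] x := by
      intro s
      induction s with
      | zero => intro _; exact ⟨H.fF_le hr, le_refl _⟩
      | succ s ih =>
        intro hs
        have h1 := ih (by omega)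
        have h2 : r - s = (r - (s + 1)) + 1 := by omega
        rw [h2, Function.iterate_succ_apply'] at h1
        exact H.fF_maps' hr h1.1 h1.2
    have hx := hback r (le_refl _)
    rw [Nat.sub_self] at hx
    simp only [Function.iterate_zero, id] at hx
    have hxz := hge r (le_refl _)
    set z := f^[r] x with hz
    have hcount := H.count hr
    have hI : Finset.Icc (fF m F z) z = Finset.Ioc (f z - 1) z := by
      ext w; simp only [Finset.mem_Icc, Finset.mem_Ioc, ← hf]; omega
    rw [hI] at hcount
    have hcount' : cnt (LL m F) (f z - 1) z = cnt (RR m F) (f z - 1) z := by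
      unfold cnt; convert hcount
    rw [cnt_add _ (show f z - 1 ≤ x by omega) hx.2, cnt_add _ (show f z - 1 ≤ x by omega) hx.2] at hcount'
    have h5 := h (f z - 1) (by omega)
    have h6 : cnt (LL m F) x z < cnt (RR m F) x z := by
      unfold cnt
      have hzm : z ∈ (Finset.Ioc x z).filter (RR m F) := by
        simp only [Finset.mem_filter, Finset.mem_Ioc]; exact ⟨by omega, hr⟩
      refine lt_of_le_of_lt ?_ (Finset.card_erase_lt_of_mem hzm)
      refine le_trans (Finset.card_le_card ?_) (Finset.card_image_le (f := f))
      intro w hw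
      simp only [Finset.mem_filter, Finset.mem_Ioc] at hw
      obtain ⟨⟨h1, h2⟩, v, hv, rfl⟩ := hw
      rw [← hf] at h1 h2
      have h3 := H.fF_le hv
      rw [← hf] at h3
      refine Finset.mem_image.mpr ⟨v, ?_, by rw [hf]⟩
      have h4 := H.fF_maps' hr (y := v) (by rw [← hf]; omega) (by rw [← hf]; omega)
      simp only [Finset.mem_erase, Finset.mem_filter, Finset.mem_Ioc]
      refine ⟨?_, by omega, hv⟩
      rintro rfl
      omega
    omega

noncomputable def hh (P : ℤ → Prop) (x : ℤ) : ℤ := (cnt P 0 x : ℤ) - cnt P x 0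

theorem cnt_empty (P : ℤ → Prop) {a b : ℤ} (h : b ≤ a) : cnt P a b = 0 := by
  unfold cnt; rw [Finset.Ioc_eq_empty (by omega)]; simp

theorem cnt_hh (P : ℤ → Prop) {a b : ℤ} (h : a ≤ b) : (cnt P a b : ℤ) = hh P b - hh P a := by
  unfold hh
  rcases le_total 0 a with ha | ha
  · rw [cnt_add P ha h, cnt_empty P ha, cnt_empty P (ha.trans h)]; push_cast; ring
  · rcases le_total 0 b with hb | hb
    · rw [cnt_add P ha hb, cnt_empty P ha, cnt_empty P hb]; push_cast; ring
    · rw [cnt_add P h hb, cnt_empty P ha, cnt_empty P hb]; push_cast; ring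

theorem hh_succ (P : ℤ → Prop) [Decidable (P x)] : hh P x - hh P (x - 1) = if P x then 1 else 0 := by
  classical
  rw [← cnt_hh P (by omega)]
  unfold cnt
  have : Finset.Ioc (x - 1) x = {x} := by
    ext z; simp only [Finset.mem_Ioc, Finset.mem_singleton]; omega
  rw [this, Finset.filter_singleton]
  split_ifs <;> simp

theorem cnt_shift {m : ℕ} {P : ℤ → Prop} (hP : ∀ x, P (x + m) ↔ P x) (a b : ℤ) :
    cnt P (a + m) (b + m) = cnt P a b := by
  classical
  unfold cnt
  rw [← Finset.card_map (s := (Finset.Ioc a b).filter P) (Equiv.addRight (m : ℤ)).toEmbedding]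
  congr 1
  ext z
  simp only [Finset.mem_filter, Finset.mem_Ioc, Finset.mem_map, Equiv.coe_toEmbedding, Equiv.coe_addRight]
  constructor
  · rintro ⟨h, hp⟩
    refine ⟨z - m, ⟨by omega, ?_⟩, by omega⟩
    rw [← hP, sub_add_cancel]; exact hp
  · rintro ⟨w, ⟨h, hp⟩, rfl⟩
    exact ⟨by omega, (hP w).mpr hp⟩

theorem cnt_period {m : ℕ} {P : ℤ → Prop} (hP : ∀ x, P (x + m) ↔ P x) (a : ℤ) :
    cnt P a (a + m) = (pfin m P).card := by
  classical
  have h0 : ∀ k : ℤ, cnt P (a + k) (a + k + m) = cnt P a (a + m) := by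
    intro k
    have e1 : (cnt P (a + k) (a + k + m) : ℤ) = hh P (a + k + m) - hh P (a + k) := cnt_hh P (by omega)
    have e2 : (cnt P a (a + m) : ℤ) = hh P (a + m) - hh P a := cnt_hh P (by omega)
    rcases le_total 0 k with hk | hk
    · have e3 := cnt_hh P (show a ≤ a + k by omega)
      have e4 := cnt_hh P (show a + m ≤ a + k + m by omega)
      have := cnt_shift hP a (a + k)
      omega
    · have e3 := cnt_hh P (show a + k ≤ a by omega)
      have e4 := cnt_hh P (show a + k + m ≤ a + m by omega)
      have := cnt_shift hP (a + k) a
      omega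
  rw [← h0 (-1 - a)]
  unfold cnt pfin
  congr 1
  ext z
  simp only [Finset.mem_filter, Finset.mem_Ioc, Finset.mem_Ico]
  constructor <;> rintro ⟨h, hp⟩ <;> exact ⟨by omega, hp⟩

theorem hh_add {m : ℕ} {P : ℤ → Prop} (hP : ∀ x, P (x + m) ↔ P x) (x : ℤ) :
    hh P (x + m) = hh P x + (pfin m P).card := by
  rw [← cnt_period hP x, cnt_hh P (by omega)]; ring

theorem hh_union {P Q : ℤ → Prop} (h : ∀ x, P x → ¬ Q x) (x : ℤ) :
    hh (fun z => P z ∨ Q z) x = hh P x + hh Q x := by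
  classical
  have : ∀ a b, cnt (fun z => P z ∨ Q z) a b = cnt P a b + cnt Q a b := by
    intro a b
    unfold cnt
    rw [← Finset.card_union_of_disjoint]
    · congr 1
      ext z
      simp only [Finset.mem_union, Finset.mem_filter, and_or_left]
    rw [Finset.disjoint_left]
    intro z hz hz'
    exact h z (Finset.mem_filter.mp hz).2 (Finset.mem_filter.mp hz').2
  unfold hh
  rw [this, this]; push_cast; ring

section cyc
variable {m : ℕ} {L R : ℤ → Prop}

def Rec (L R : ℤ → Prop) (x : ℤ) : Prop := ∀ y < x, hh R y - hh L y < hh R x - hh L x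

theorem K_mul (hL : ∀ x, L (x + m) ↔ L x) (hR : ∀ x, R (x + m) ↔ R x) {d : ℤ}
    (hc : ((pfin m R).card : ℤ) = (pfin m L).card + d) (x k : ℤ) :
    hh R (x + m * k) - hh L (x + m * k) = hh R x - hh L x + d * k := by
  have h1 : ∀ x, hh R (x + m) - hh L (x + m) = hh R x - hh L x + d := by
    intro x; rw [hh_add hR, hh_add hL]; omega
  induction k using Int.induction_on with
  | zero => simp
  | succ i ih =>
    have := h1 (x + m * i)
    rw [show x + (m : ℤ) * (i + 1) = x + m * i + m by ring, this, ih]; ring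
  | pred i ih =>
    have := h1 (x + m * (-i - 1))
    rw [show x + (m : ℤ) * (-i - 1) + m = x + m * (-i) by ring] at this
    linarith

theorem Rec_mul (hL : ∀ x, L (x + m) ↔ L x) (hR : ∀ x, R (x + m) ↔ R x)
    (hc : ((pfin m R).card : ℤ) = (pfin m L).card + 1) {x : ℤ} (h : Rec L R x) (k : ℤ) :
    Rec L R (x + m * k) := by
  intro y hy
  have h1 := h (y - m * k) (by omega)
  have h2 := K_mul hL hR hc (y - m * k) k
  have h3 := K_mul hL hR hc x k
  rw [sub_add_cancel] at h2
  omega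

theorem Rec_unique (hL : ∀ x, L (x + m) ↔ L x) (hR : ∀ x, R (x + m) ↔ R x)
    (hc : ((pfin m R).card : ℤ) = (pfin m L).card + 1) {x x' : ℤ} (h : Rec L R x)
    (h' : Rec L R x') : (m : ℤ) ∣ x' - x := by
  set k := (hh R x' - hh L x') - (hh R x - hh L x) with hk
  have h1 := Rec_mul hL hR hc h k
  have h2 := K_mul hL hR hc x k
  rcases lt_trichotomy x' (x + m * k) with h3 | h3 | h3
  · have := h1 _ h3; omega
  · exact ⟨k, by omega⟩
  · have := h' _ h3; omega

theorem Rec_exists (hm : 0 < m) (hL : ∀ x, L (x + m) ↔ L x) (hR : ∀ x, R (x + m) ↔ R x)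
    (hc : ((pfin m R).card : ℤ) = (pfin m L).card + 1) : ∃ x, Rec L R x := by
  obtain ⟨x, hx, hmax⟩ := Finset.exists_max_image (Finset.Ico (0 : ℤ) m)
    (fun x => m * (hh R x - hh L x) - x) ⟨0, by simp; omega⟩
  rw [Finset.mem_Ico] at hx
  refine ⟨x, fun y hy => ?_⟩
  have hm' : (0 : ℤ) < m := by omega
  have h1 := Int.emod_nonneg y (b := m) (by omega)
  have h2 := Int.emod_lt_of_pos y hm'
  have h3 := Int.emod_add_mul_ediv y m
  have h4 := K_mul hL hR hc (y % m) (y / m)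
  rw [h3] at h4
  have h5 := hmax (y % m) (Finset.mem_Ico.mpr ⟨h1, h2⟩)
  rw [h4]
  set Kx := hh R x - hh L x
  set Ky := hh R (y % m) - hh L (y % m)
  have hq : y / m ≤ 0 := by
    by_contra hc
    have : (m : ℤ) * 1 ≤ m * (y / m) := mul_le_mul_of_nonneg_left (by omega) (by omega)
    omega
  rcases eq_or_lt_of_le hq with h | h
  · have : y % m = y := by rw [h] at h3; omega
    by_contra hc
    have : (m : ℤ) * Kx ≤ m * Ky := mul_le_mul_of_nonneg_left (by omega) (by omega)
    omega
  · by_contra hc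
    have : (m : ℤ) * (Kx + 1) ≤ m * Ky := mul_le_mul_of_nonneg_left (by omega) (by omega)
    rw [mul_add] at this
    omega

theorem Rec_mem {x : ℤ} (h : Rec L R x) : R x := by
  classical
  by_contra hc
  have h1 := h (x - 1) (by omega)
  have h2 := hh_succ (x := x) R
  have h3 := hh_succ (x := x) L
  rw [if_neg hc] at h2
  split_ifs at h3 <;> omega

theorem W_iff_rec (hm : 0 < m) (hL : ∀ x, L (x + m) ↔ L x) (hR : ∀ x, R (x + m) ↔ R x)
    (hc : (pfin m R).card = (pfin m L).card) {x : ℤ} (hx : ¬ R x) :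
    (∀ y < x, cnt L y x ≤ cnt R y x) ↔ Rec L (fun z => R z ∨ (m : ℤ) ∣ z - x) x := by
  classical
  set Q : ℤ → Prop := fun z => (m : ℤ) ∣ z - x with hQ
  have hdis : ∀ z, R z → ¬ Q z := by
    rintro z hz ⟨k, hk⟩
    apply hx
    have := per_mul (fun z => propext (hR z)) x k
    rw [← hk] at this
    rw [← this]
    simpa using hz
  have hu := hh_union hdis
  constructor
  · intro h y hy
    have h1 := h y hy
    have h2 := cnt_hh L hy.le
    have h3 := cnt_hh R hy.le
    have h4 := cnt_hh Q hy.le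
    have h5 : 0 < cnt Q y x := by
      unfold cnt
      apply Finset.card_pos.mpr
      exact ⟨x, by simp [hQ, hy]⟩
    rw [hu, hu]
    omega
  · intro h y hy
    have hc' : ((pfin m R).card : ℤ) = (pfin m L).card + 0 := by omega
    have hm' : (0 : ℤ) < m := by omega
    have h1 := Int.emod_nonneg (y - x) (b := m) (by omega)
    have h2 := Int.emod_lt_of_pos (y - x) hm'
    have h3 := Int.emod_add_mul_ediv (y - x) m
    set y' := x - m + (y - x) % m with hy'
    have h4 : y = y' + m * ((y - x) / m + 1) := by rw [mul_add]; omega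
    have h5 := K_mul hL hR hc' y' ((y - x) / m + 1)
    rw [← h4] at h5
    have h6 := h y' (by omega)
    rw [hu, hu] at h6
    have h7 := cnt_hh Q (show y' ≤ x by omega)
    have h8 : cnt Q y' x = 1 := by
      unfold cnt
      rw [Finset.card_eq_one]
      refine ⟨x, ?_⟩
      ext z
      simp only [Finset.mem_filter, Finset.mem_Ioc, Finset.mem_singleton, hQ]
      constructor
      · rintro ⟨⟨a, b⟩, c⟩
        have := Int.eq_zero_of_abs_lt_dvd c (by rw [abs_lt]; omega)
        omega
      · rintro rfl
        exact ⟨by omega, by simp⟩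
    have h9 := cnt_hh L hy.le
    have h10 := cnt_hh R hy.le
    omega
end cyc

def pset (m : ℕ) (A : Finset ℤ) (z : ℤ) : Prop := z % m ∈ A

theorem pset_add (m : ℕ) (A : Finset ℤ) (x : ℤ) : pset m A (x + m) ↔ pset m A x := by
  unfold pset; rw [Int.add_emod_right]

theorem pfin_pset {m : ℕ} {A : Finset ℤ} (hA : A ⊆ Finset.Ico 0 (m : ℤ)) : pfin m (pset m A) = A := by
  ext z
  rw [mem_pfin]
  unfold pset
  constructor
  · rintro ⟨h, h'⟩
    rwa [Int.emod_eq_of_lt h.1 h.2] at h'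
  · intro h
    have h1 := Finset.mem_Ico.mp (hA h)
    exact ⟨h1, by rwa [Int.emod_eq_of_lt h1.1 h1.2]⟩

theorem pset_pfin {m : ℕ} (hm : 0 < m) {P : ℤ → Prop} (hP : ∀ x, P (x + m) ↔ P x) :
    pset m (pfin m P) = P := by
  funext z
  unfold pset
  rw [mem_pfin, per_mod (fun z => propext (hP z))]
  have h1 := Int.emod_nonneg z (b := m) (by omega)
  have h2 := Int.emod_lt_of_pos z (b := m) (by omega)
  simp [h1, h2]

theorem pfin_sub (m : ℕ) (P : ℤ → Prop) : pfin m P ⊆ Finset.Ico 0 (m : ℤ) := by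
  intro z hz; rw [mem_pfin] at hz; exact Finset.mem_Ico.mpr hz.1

theorem NC_det {m : ℕ} (hm : 0 < m) {τ τ' : Equiv.Perm ℤ} (h : NCm m τ) (h' : NCm m τ')
    (hL : LL m (liftF m τ) = LL m (liftF m τ')) (hR : RR m (liftF m τ) = RR m (liftF m τ')) :
    τ = τ' := by
  have h1 := LP.det (NCm_LP hm h) (NCm_LP hm h') (fun x => by rw [hR]) (fun x => by rw [hL])
  ext z
  by_cases hz : z ∈ signedSet m
  · have h2 := ph_liftF hm h.1 (ps m z)
    rw [h1, ph_liftF hm h'.1, ph_ps hz] at h2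
    exact h2.symm
  · rw [h.1.2 z hz, h'.1.2 z hz]

theorem card_N {m : ℕ} (hm : 0 < m) (j : ℕ) :
    {τ | NCm m τ ∧ cB m τ = j}.ncard = m.choose j ^ 2 := by
  classical
  have himg : (fun τ => (pfin m (LL m (liftF m τ)), pfin m (RR m (liftF m τ)))) ''
      {τ | NCm m τ ∧ cB m τ = j} =
      ((Finset.powersetCard j (Finset.Ico 0 (m : ℤ))) ×ˢ
        (Finset.powersetCard j (Finset.Ico 0 (m : ℤ))) : Finset _) := by
    ext ⟨A, B⟩
    simp only [Set.mem_image, Set.mem_setOf_eq, Finset.mem_coe, Finset.mem_product,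
      Finset.mem_powersetCard, Prod.mk.injEq]
    constructor
    · rintro ⟨τ, ⟨h, hj⟩, rfl, rfl⟩
      have := card_RR hm h
      have := (NCm_LP hm h).card_LR
      exact ⟨⟨pfin_sub _ _, by omega⟩, ⟨pfin_sub _ _, by omega⟩⟩
    · rintro ⟨⟨hA, cA⟩, hB, cB'⟩
      obtain ⟨τ, h, h1, h2⟩ := exists_LR hm j (pset m A) (pset m B) (pset_add m A) (pset_add m B)
        (by rw [pfin_pset hA, cA]) (by rw [pfin_pset hB, cB'])
      have e1 : LL m (liftF m τ) = pset m A := funext fun z => propext (h1 z)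
      have e2 : RR m (liftF m τ) = pset m B := funext fun z => propext (h2 z)
      refine ⟨τ, ⟨h, ?_⟩, ?_, ?_⟩
      · rw [← card_RR hm h, e2, pfin_pset hB, cB']
      · rw [e1, pfin_pset hA]
      · rw [e2, pfin_pset hB]
  rw [← Set.ncard_image_of_injOn (f := (fun τ => (pfin m (LL m (liftF m τ)), pfin m (RR m (liftF m τ))))),
    himg, Set.ncard_coe_finset, Finset.card_product, Finset.card_powersetCard]
  · simp [sq]
  · rintro τ ⟨h, -⟩ τ' ⟨h', -⟩ he
    simp only [Prod.mk.injEq] at he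
    apply NC_det hm h h'
    · rw [← pset_pfin hm (NCm_LP hm h).LL_add, he.1, pset_pfin hm (NCm_LP hm h').LL_add]
    · rw [← pset_pfin hm (NCm_LP hm h).RR_add, he.2, pset_pfin hm (NCm_LP hm h').RR_add]

theorem Z_iff {m : ℕ} (hm : 0 < m) {τ : Equiv.Perm ℤ} (h : NCm m τ) (x : ℤ) :
    Zpt m τ (ph m x) ↔ ¬ RR m (liftF m τ) x ∧
      Rec (LL m (liftF m τ)) (fun z => RR m (liftF m τ) z ∨ (m : ℤ) ∣ z - x) x := by
  have H := NCm_LP hm h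
  rw [Zpt_ph hm h, H.Zchar]
  constructor
  · rintro ⟨h1, h2⟩
    exact ⟨h1, (W_iff_rec hm H.LL_add H.RR_add H.card_LR.symm h1).mp h2⟩
  · rintro ⟨h1, h2⟩
    exact ⟨h1, (W_iff_rec hm H.LL_add H.RR_add H.card_LR.symm h1).mpr h2⟩

theorem card_M {m : ℕ} (hm : 0 < m) (j : ℕ) :
    {p : Equiv.Perm ℤ × ℤ | NCm m p.1 ∧ cB m p.1 = j ∧ Zpt m p.1 p.2}.ncard
      = 2 * (m.choose j * m.choose (j + 1)) := by
  classical
  have hm' : (0 : ℤ) < m := by omega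
  set f : Equiv.Perm ℤ × ℤ → Finset ℤ × Finset ℤ × Bool := fun p =>
    (pfin m (LL m (liftF m p.1)),
      pfin m (fun z => RR m (liftF m p.1) z ∨ (m : ℤ) ∣ z - ps m p.2), decide (ps m p.2 < m)) with hf
  have dadd : ∀ (R : ℤ → Prop) (x : ℤ), (∀ z, R (z + m) ↔ R z) →
      ∀ z, (R (z + m) ∨ (m : ℤ) ∣ z + m - x) ↔ (R z ∨ (m : ℤ) ∣ z - x) := by
    intro R x hR z
    rw [hR, show z + m - x = (z - x) + m by ring, dvd_add_self_right]
  have dcard : ∀ (R : ℤ → Prop) (x : ℤ), (∀ z, R (z + m) ↔ R z) → ¬ R x →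
      (pfin m (fun z => R z ∨ (m : ℤ) ∣ z - x)).card = (pfin m R).card + 1 ∧
      (fun z => (R z ∨ (m : ℤ) ∣ z - x) ∧ ¬ (m : ℤ) ∣ z - x) = R := by
    intro R x hR hx
    have e : (fun z => (R z ∨ (m : ℤ) ∣ z - x) ∧ ¬ (m : ℤ) ∣ z - x) = R := by
      funext z
      apply propext
      constructor
      · rintro ⟨h | h, h'⟩
        · exact h
        · exact absurd h h'
      · intro h
        refine ⟨Or.inl h, ?_⟩
        rintro ⟨k, hk⟩
        apply hx
        have := per_mul (fun z => propext (hR z)) x k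
        rw [← this, ← hk]
        simpa using h
    refine ⟨?_, e⟩
    have := card_pfin_erase hm (P := fun z => R z ∨ (m : ℤ) ∣ z - x) (dadd R x hR) (y := x)
      (Or.inr (by simp))
    rw [e] at this
    exact this.symm
  have himg : f '' {p : Equiv.Perm ℤ × ℤ | NCm m p.1 ∧ cB m p.1 = j ∧ Zpt m p.1 p.2} =
      ((Finset.powersetCard j (Finset.Ico 0 (m : ℤ))) ×ˢ
        ((Finset.powersetCard (j + 1) (Finset.Ico 0 (m : ℤ))) ×ˢ (Finset.univ : Finset Bool)) : Finset _) := by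
    ext ⟨A, B, b⟩
    simp only [Set.mem_image, Set.mem_ofPred_eq, Finset.mem_coe, Finset.mem_product,
      Finset.mem_powersetCard, Prod.mk.injEq, hf, Finset.mem_univ, and_true]
    constructor
    · rintro ⟨⟨τ, a⟩, ⟨h, hj, hz⟩, rfl, rfl, -⟩
      dsimp only at h hj hz ⊢
      have H := NCm_LP hm h
      have c1 := card_RR hm h
      have c2 := H.card_LR
      have hz' := hz
      rw [← ph_ps hz.1, Z_iff hm h] at hz'
      have c3 := (dcard _ _ H.RR_add hz'.1).1
      exact ⟨⟨pfin_sub _ _, by omega⟩, ⟨pfin_sub _ _, by omega⟩⟩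
    · rintro ⟨⟨hA, cA⟩, hB, cB'⟩
      have hc : ((pfin m (pset m B)).card : ℤ) = (pfin m (pset m A)).card + 1 := by
        rw [pfin_pset hA, pfin_pset hB]; omega
      obtain ⟨x0, hx0⟩ := Rec_exists hm (pset_add m A) (pset_add m B) hc
      have h1 := Int.emod_nonneg x0 (b := m) (by omega)
      have h2 := Int.emod_lt_of_pos x0 hm'
      have h3 := Int.emod_add_mul_ediv x0 m
      obtain ⟨x, hxr, hx1, hx2, hxb⟩ : ∃ x, Rec (pset m A) (pset m B) x ∧ 0 ≤ x ∧ x < 2 * m ∧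
          decide (x < m) = b := by
        cases b
        · refine ⟨x0 + m * (- (x0 / m) + 1), Rec_mul (pset_add m A) (pset_add m B) hc hx0 _, ?_⟩
          rw [mul_add, mul_neg, decide_eq_false_iff_not]; omega
        · refine ⟨x0 + m * (- (x0 / m)), Rec_mul (pset_add m A) (pset_add m B) hc hx0 _, ?_⟩
          rw [mul_neg, decide_eq_true_eq]; omega
      have hBx := Rec_mem hxr
      have hce := card_pfin_erase hm (pset_add m B) hBx
      obtain ⟨τ, h, e1, e2⟩ := exists_LR hm j (pset m A) (fun z => pset m B z ∧ ¬ (m : ℤ) ∣ z - x)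
        (pset_add m A) (fun z => by
          rw [pset_add, show z + m - x = (z - x) + m by ring, dvd_add_self_right])
        (by rw [pfin_pset hA, cA]) (by rw [pfin_pset hB] at hce; omega)
      replace e1 : LL m (liftF m τ) = pset m A := funext fun z => propext (e1 z)
      replace e2 : RR m (liftF m τ) = (fun z => pset m B z ∧ ¬ (m : ℤ) ∣ z - x) :=
        funext fun z => propext (e2 z)
      have e3 : (fun z => RR m (liftF m τ) z ∨ (m : ℤ) ∣ z - x) = pset m B := by
        rw [e2]
        funext z
        apply propext
        constructor
        · rintro (h | ⟨k, hk⟩)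
          · exact h.1
          · have := per_mul (fun z => propext (pset_add m B z)) x k
            rw [← hk] at this
            rw [← this] at hBx
            simpa using hBx
        · intro h
          by_cases h' : (m : ℤ) ∣ z - x
          · exact Or.inr h'
          · exact Or.inl ⟨h, h'⟩
      have hps : ps m (ph m x) = x := by rw [ps_ph hm, Int.emod_eq_of_lt hx1 hx2]
      refine ⟨(τ, ph m x), ⟨h, ?_, ?_⟩, ?_, ?_, ?_⟩
      · simp only
        rw [← card_RR hm h, e2]; rw [pfin_pset hB] at hce; omega
      · simp only
        rw [Z_iff hm h, e3, e1]
        refine ⟨?_, hxr⟩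
        rw [e2]; simp
      · simp only; rw [e1, pfin_pset hA]
      · simp only; rw [hps, e3, pfin_pset hB]
      · simp only; rw [hps, hxb]
  have hinj : Set.InjOn f {p : Equiv.Perm ℤ × ℤ | NCm m p.1 ∧ cB m p.1 = j ∧ Zpt m p.1 p.2} := by
    rintro ⟨τ, a⟩ ⟨h, -, hz⟩ ⟨τ', a'⟩ ⟨h', -, hz'⟩ he
    simp only [hf, Prod.mk.injEq] at he h h' hz hz'
    obtain ⟨he1, he2, he3⟩ := he
    have H := NCm_LP hm h
    have H' := NCm_LP hm h'
    have hw := hz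
    have hw' := hz'
    rw [← ph_ps hz.1, Z_iff hm h] at hw
    rw [← ph_ps hz'.1, Z_iff hm h'] at hw'
    have c1 := H.card_LR
    have c3 := dcard _ _ H.RR_add hw.1
    have c4 := dcard _ _ H'.RR_add hw'.1
    have eL : LL m (liftF m τ) = LL m (liftF m τ') := by
      rw [← pset_pfin hm H.LL_add, he1, pset_pfin hm H'.LL_add]
    have eR : (fun z => RR m (liftF m τ) z ∨ (m : ℤ) ∣ z - ps m a) =
        (fun z => RR m (liftF m τ') z ∨ (m : ℤ) ∣ z - ps m a') := by
      have q1 := pset_pfin hm (P := fun z => RR m (liftF m τ) z ∨ (m : ℤ) ∣ z - ps m a)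
        (dadd _ (ps m a) H.RR_add)
      have q2 := pset_pfin hm (P := fun z => RR m (liftF m τ') z ∨ (m : ℤ) ∣ z - ps m a')
        (dadd _ (ps m a') H'.RR_add)
      rw [← q1, he2, q2]
    have hr' := hw'.2
    rw [← eL, ← eR] at hr'
    have hd := Rec_unique H.LL_add (dadd _ (ps m a) H.RR_add) (by rw [c3.1, c1]; push_cast; ring)
      hw.2 hr'
    have r1 := ps_range hz.1
    have r2 := ps_range hz'.1
    have hpp : ps m a = ps m a' := by
      rw [decide_eq_decide] at he3
      have := Int.eq_zero_of_abs_lt_dvd hd (by rw [abs_lt]; omega)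
      omega
    have ha : a = a' := by rw [← ph_ps hz.1, hpp, ph_ps hz'.1]
    have : τ = τ' := by
      apply NC_det hm h h' eL
      rw [← c3.2, ← c4.2, ← hpp]
      rw [← hpp] at eR
      funext z
      rw [congrFun eR z]
    rw [ha, this]
  rw [← Set.InjOn.ncard_image hinj, himg, Set.ncard_coe_finset, Finset.card_product,
    Finset.card_product, Finset.card_powersetCard, Finset.card_powersetCard]
  simp
  ring

theorem cB_le_of {n : ℕ} (τ : Equiv.Perm ℤ) {x y : ℤ}
    (hx : x ∈ signedSet n) (hy : y ∈ signedSet n) (hxy : x ≠ y)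
    (v : ℤ → ℚ) (hv : v ∈ FixS n τ) (h : v x ≠ v y) : cB n (τ * rf x y) ≤ cB n τ := by
  have hlt : FixS n τ ⊓ LinearMap.ker (diffF x y) < FixS n τ := by
    refine lt_of_le_of_ne inf_le_left (fun he => h ?_)
    rw [← he] at hv
    have := hv.2
    simpa [diffF, evF, sub_eq_zero] using this
  have h1 : Module.finrank ℚ ↥(FixS n τ ⊓ LinearMap.ker (diffF x y)) < cB n τ :=
    Submodule.finrank_lt_finrank_of_lt hlt
  haveI : FiniteDimensional ℚ ↥(FixS n τ ⊓ LinearMap.ker (diffF x y)) :=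
    Submodule.finiteDimensional_of_le hlt.le
  have h2 : cB n (τ * rf x y) ≤ Module.finrank ℚ ↥(FixS n τ ⊓ LinearMap.ker (diffF x y)) + 1 := by
    apply finrank_le_aux _ _ (diffF x y)
    intro u hu h
    have h' : u x = u y := by simpa [diffF, evF, sub_eq_zero] using h
    refine ⟨⟨hu.1, hu.2.1, fun z => ?_⟩, h⟩
    have := hu.2.2 (rf x y z)
    rw [← Equiv.Perm.mul_apply, mul_assoc, rf_sq hx.1 hy.1 hxy, mul_one] at this
    rw [this, fix_rf hu.1 hx hy hxy h']
  omega

section ann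
variable {m : ℕ}

abbrev sN (m : ℕ) : Equiv.Perm ℤ := rf ((m : ℤ) + 1) (-((m : ℤ) + 1))

theorem N_mem (m : ℕ) : ((m : ℤ) + 1) ∈ signedSet (m + 1) := by
  rw [mem_signed]; push_cast; omega

theorem N_ne (m : ℕ) : ((m : ℤ) + 1) ≠ -((m : ℤ) + 1) := by omega

theorem sN_sq (m : ℕ) : sN m * sN m = 1 := rf_sq (by omega) (by omega) (N_ne m)

theorem sN_N (m : ℕ) : sN m ((m : ℤ) + 1) = -((m : ℤ) + 1) := rf_left (by omega) (by omega) (N_ne m)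
theorem sN_nN (m : ℕ) : sN m (-((m : ℤ) + 1)) = ((m : ℤ) + 1) := rf_right (by omega) (by omega) (N_ne m)

theorem sN_inB (m : ℕ) : inB (m + 1) (sN m) :=
  rf_inB (N_mem m) (neg_mem_signed.mpr (N_mem m)) (N_ne m)

theorem sN_of {z : ℤ} (h : z ≠ (m : ℤ) + 1) (h' : z ≠ -((m : ℤ) + 1)) : sN m z = z := by
  rw [sN, rf_apply _ _ (by omega) (by omega) (N_ne m), if_neg h, if_neg h', if_neg h', neg_neg, if_neg h]

theorem not_N {z : ℤ} (hz : z ∈ signedSet m) : z ≠ (m : ℤ) + 1 ∧ z ≠ -((m : ℤ) + 1) := by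
  rw [mem_signed] at hz; omega

theorem mem_up {z : ℤ} (hz : z ∈ signedSet m) : z ∈ signedSet (m + 1) := by
  rw [mem_signed] at *; push_cast; omega

theorem mem_down {z : ℤ} (hz : z ∈ signedSet (m + 1)) (h : z ≠ (m : ℤ) + 1) (h' : z ≠ -((m : ℤ) + 1)) :
    z ∈ signedSet m := by
  rw [mem_signed] at *; push_cast at *; omega

theorem inB_up {τ : Equiv.Perm ℤ} (h : inB m τ) : inB (m + 1) τ :=
  ⟨h.1, fun x hx => h.2 x (fun h' => hx (mem_up h'))⟩

theorem inB_down {τ : Equiv.Perm ℤ} (h : inB (m + 1) τ) (hN : τ ((m : ℤ) + 1) = (m : ℤ) + 1) :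
    inB m τ := by
  refine ⟨h.1, fun x hx => ?_⟩
  by_cases h1 : x = (m : ℤ) + 1
  · rw [h1, hN]
  by_cases h2 : x = -((m : ℤ) + 1)
  · rw [h2, h.1, hN]
  exact h.2 x (fun h' => hx (mem_down h' h1 h2))

theorem N_fix {τ : Equiv.Perm ℤ} (h : inB m τ) : τ ((m : ℤ) + 1) = (m : ℤ) + 1 :=
  h.2 _ (fun h' => (not_N h').1 rfl)

theorem nN_fix {τ : Equiv.Perm ℤ} (h : inB m τ) : τ (-((m : ℤ) + 1)) = -((m : ℤ) + 1) :=
  h.2 _ (fun h' => (not_N h').2 rfl)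

theorem FixS_s {τ : Equiv.Perm ℤ} (h : inB m τ) : FixS (m + 1) (τ * sN m) = FixS m τ := by
  ext u
  rw [mem_FixS, mem_FixS]
  constructor
  · rintro ⟨h1, h2, h3⟩
    have hN : u ((m : ℤ) + 1) = 0 := by
      have := h3 ((m : ℤ) + 1)
      rw [Equiv.Perm.mul_apply, sN_N, nN_fix h, h1] at this
      linarith
    have hN' : u (-((m : ℤ) + 1)) = 0 := by rw [h1, hN, neg_zero]
    have hsup : ∀ x, x ∉ signedSet m → u x = 0 := by
      intro x hx
      by_cases e1 : x = (m : ℤ) + 1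
      · rw [e1, hN]
      by_cases e2 : x = -((m : ℤ) + 1)
      · rw [e2, hN']
      exact h2 x (fun h' => hx (mem_down h' e1 e2))
    refine ⟨h1, hsup, fun x => ?_⟩
    by_cases hx : x ∈ signedSet m
    · have := h3 x
      rwa [Equiv.Perm.mul_apply, sN_of (not_N hx).1 (not_N hx).2] at this
    · rw [h.2 x hx]
  · rintro ⟨h1, h2, h3⟩
    have hN : u ((m : ℤ) + 1) = 0 := h2 _ (fun h' => (not_N h').1 rfl)
    have hN' : u (-((m : ℤ) + 1)) = 0 := by rw [h1, hN, neg_zero]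
    refine ⟨h1, fun x hx => h2 x (fun h' => hx (mem_up h')), fun x => ?_⟩
    rw [Equiv.Perm.mul_apply, h3]
    by_cases e1 : x = (m : ℤ) + 1
    · rw [e1, sN_N, hN, hN']
    by_cases e2 : x = -((m : ℤ) + 1)
    · rw [e2, sN_nN, hN, hN']
    rw [sN_of e1 e2]

theorem cB_s {τ : Equiv.Perm ℤ} (h : inB m τ) : cB (m + 1) (τ * sN m) = cB m τ := by
  unfold cB; rw [FixS_s h]

theorem cB_up {τ : Equiv.Perm ℤ} (h : inB m τ) : cB (m + 1) τ = cB m τ + 1 := by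
  have h1 := cB_split (n := m + 1) (τ := τ * sN m) (inB_mul (inB_up h) (sN_inB m)) (N_mem m) (N_ne m)
    (by rw [Equiv.Perm.mul_apply, sN_nN, N_fix h])
  rw [cB_s h] at h1
  have h2 : τ * sN m * rf ((m : ℤ) + 1) (-((m : ℤ) + 1)) = τ := by
    rw [mul_assoc, sN_sq, mul_one]
  rw [h2] at h1
  exact h1

theorem s_comm {κ : Equiv.Perm ℤ} (h : inB m κ) : sN m * κ = κ * sN m := by
  ext z
  rw [Equiv.Perm.mul_apply, Equiv.Perm.mul_apply]
  by_cases e1 : z = (m : ℤ) + 1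
  · rw [e1, N_fix h, sN_N, nN_fix h]
  by_cases e2 : z = -((m : ℤ) + 1)
  · rw [e2, nN_fix h, sN_nN, N_fix h]
  rw [sN_of e1 e2, sN_of]
  · intro h'; apply e1; apply κ.injective; rw [h', N_fix h]
  · intro h'; apply e2; apply κ.injective; rw [h', nN_fix h]

theorem gpq_cB (hm : 0 < m) : cB (m + 1) (gammaPQ m 1) = 0 := by
  rw [gpq_eq]; exact (cB_s (gd_inB hm)).trans (gd_cB hm)

theorem gpq_inB (hm : 0 < m) : inB (m + 1) (gammaPQ m 1) := by
  rw [gpq_eq]; exact inB_mul (inB_up (gd_inB hm)) (sN_inB m)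

def Sn (m j : ℕ) : Set (Equiv.Perm ℤ) :=
  {τ | inB (m + 1) τ ∧ cB (m + 1) τ + cB (m + 1) (τ⁻¹ * gammaPQ m 1) = m + 1 ∧ cB (m + 1) τ = j}

theorem kapA (hm : 0 < m) {τ : Equiv.Perm ℤ} (h : inB m τ) :
    cB (m + 1) (τ⁻¹ * gammaPQ m 1) = cB m (τ⁻¹ * gammaDisc m) := by
  rw [gpq_eq, ← mul_assoc]
  exact cB_s (inB_mul (inB_inv h) (gd_inB hm))

theorem kapB' (hm : 0 < m) {τ : Equiv.Perm ℤ} (h : inB m τ) :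
    (τ * sN m)⁻¹ * gammaPQ m 1 = τ⁻¹ * gammaDisc m := by
  have hk := inB_mul (inB_inv h) (gd_inB hm)
  rw [gpq_eq, mul_inv_rev]
  have e : (sN m)⁻¹ = sN m := inv_eq_of_mul_eq_one_right (sN_sq m)
  rw [e]
  calc sN m * τ⁻¹ * (gammaDisc m * sN m) = sN m * (τ⁻¹ * gammaDisc m) * sN m := by group
    _ = (τ⁻¹ * gammaDisc m) * (sN m * sN m) := by rw [s_comm hk, mul_assoc]
    _ = _ := by rw [sN_sq, mul_one]

theorem kapB (hm : 0 < m) {τ : Equiv.Perm ℤ} (h : inB m τ) :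
    cB (m + 1) ((τ * sN m)⁻¹ * gammaPQ m 1) = cB m (τ⁻¹ * gammaDisc m) + 1 := by
  rw [kapB' hm h]
  exact cB_up (inB_mul (inB_inv h) (gd_inB hm))

theorem caseA (hm : 0 < m) (j : ℕ) :
    {τ | τ ∈ Sn m j ∧ τ ((m : ℤ) + 1) = (m : ℤ) + 1} = {τ | NCm m τ ∧ cB m τ + 1 = j} := by
  ext τ
  constructor
  · rintro ⟨⟨h1, h2, h3⟩, h4⟩
    have h := inB_down h1 h4
    rw [cB_up h, kapA hm h] at h2
    rw [cB_up h] at h3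
    exact ⟨⟨h, by omega⟩, h3⟩
  · rintro ⟨⟨h, h2⟩, h3⟩
    refine ⟨⟨inB_up h, ?_, ?_⟩, N_fix h⟩
    · rw [cB_up h, kapA hm h]; omega
    · rw [cB_up h, h3]

theorem caseB (hm : 0 < m) (j : ℕ) :
    {τ | τ ∈ Sn m j ∧ τ ((m : ℤ) + 1) = -((m : ℤ) + 1)} =
      (fun ρ => ρ * sN m) '' {τ | NCm m τ ∧ cB m τ = j} := by
  ext τ
  constructor
  · rintro ⟨⟨h1, h2, h3⟩, h4⟩
    have h : inB m (τ * sN m) := by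
      apply inB_down (inB_mul h1 (sN_inB m))
      rw [Equiv.Perm.mul_apply, sN_N, h1.1, h4, neg_neg]
    have e : τ * sN m * sN m = τ := by rw [mul_assoc, sN_sq, mul_one]
    have k1 := cB_s h
    have k2 := kapB hm h
    rw [e] at k1 k2
    exact ⟨τ * sN m, ⟨⟨h, by omega⟩, by omega⟩, e⟩
  · rintro ⟨ρ, ⟨⟨h, h2⟩, h3⟩, rfl⟩
    have k1 := cB_s h
    have k2 := kapB hm h
    refine ⟨⟨inB_mul (inB_up h) (sN_inB m), ?_, ?_⟩, ?_⟩
    · simp only; omega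
    · simp only; omega
    · simp only; rw [Equiv.Perm.mul_apply, sN_N, nN_fix h]

end ann

section annC
variable {m : ℕ}

theorem nat_orbit {ρ : Equiv.Perm ℤ} (hρ : inB m ρ) {a : ℤ} (h : -a ∈ permOrbit ρ a) :
    ∃ r : ℕ, (ρ ^ r) a = -a := by
  obtain ⟨k, hk⟩ := h
  rcases Int.eq_nat_or_neg k with ⟨r, rfl | rfl⟩
  · exact ⟨r, by simpa using hk⟩
  · refine ⟨r, ?_⟩
    have h1 := (inB_zpow hρ (r : ℤ)).1 a
    have h2 : (ρ ^ (r : ℤ)) (-a) = a := by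
      rw [← hk, ← Equiv.Perm.mul_apply, ← zpow_add]; simp
    rw [h2, zpow_natCast] at h1
    omega

theorem Z_split {ρ : Equiv.Perm ℤ} (hρ : inB m ρ) {a : ℤ} (ha : Zpt m ρ a) :
    cB (m + 1) (ρ * sN m * rf a ((m : ℤ) + 1)) = cB (m + 1) (ρ * sN m) + 1 := by
  classical
  have ha1 := ha.1
  have ha0 : a ≠ 0 := ha1.1
  have haN := not_N ha1
  have hN0 : (m : ℤ) + 1 ≠ 0 := by omega
  obtain ⟨-, hor⟩ := (Zpt_iff hρ).mp ha
  have hex := nat_orbit hρ hor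
  set r := Nat.find hex with hr
  have hra : (ρ ^ r) a = -a := Nat.find_spec hex
  have hmin : ∀ i < r, (ρ ^ i) a ≠ -a := fun i hi => Nat.find_min hex hi
  have hpB : ∀ i : ℕ, inB m (ρ ^ i) := fun i => by
    have := inB_zpow hρ (i : ℤ); rwa [zpow_natCast] at this
  have hpm : ∀ i : ℕ, (ρ ^ i) a ∈ signedSet m := fun i => (inB_mem (hpB i)).mpr ha1
  have hr0 : 0 < r := by
    rcases Nat.eq_zero_or_pos r with h | h
    · rw [h] at hra; simp at hra; omega
    · exact h
  have hne : ∀ i, 0 < i → i < r → (ρ ^ i) a ≠ a := by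
    intro i h0 hi h
    apply hmin (r - i) (by omega)
    have : (ρ ^ r) a = (ρ ^ (r - i)) ((ρ ^ i) a) := by
      rw [← Equiv.Perm.mul_apply, ← pow_add, Nat.sub_add_cancel hi.le]
    rw [h] at this
    rw [← this, hra]
  have hdiff : ∀ i k, i ≤ r → 0 < k → i < k → k ≤ r → 0 < i → (ρ ^ i) a ≠ -(ρ ^ k) a := by
    intro i k _ _ hik hk hi h
    apply hmin (k - i) (by omega)
    apply (ρ ^ i).injective
    rw [← Equiv.Perm.mul_apply, ← pow_add, Nat.add_sub_cancel' hik.le, (hpB i).1, h, neg_neg]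
  set N : ℤ := (m : ℤ) + 1 with hN
  set B : Set ℤ := {z | z = N ∨ ∃ i : ℕ, 1 ≤ i ∧ i ≤ r ∧ (ρ ^ i) a = z} with hB
  have tz : ∀ z, z ≠ a → z ≠ N → z ≠ -a → z ≠ -N → rf a N z = z := by
    intro z h1 h2 h3 h4
    rw [rf_apply _ _ ha0 hN0 haN.1, if_neg h1, if_neg h2, if_neg h3, if_neg h4]
  have tna : rf a N (-a) = -N := by
    rw [(rf_inB (mem_up ha1) (N_mem m) haN.1).1, rf_left ha0 hN0 haN.1]
  have tN : rf a N N = a := rf_right ha0 hN0 haN.1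
  have step : ∀ i : ℕ, 0 < i → i < r → (ρ * sN m * rf a N) ((ρ ^ i) a) = (ρ ^ (i + 1)) a := by
    intro i h0 hi
    have h1 := not_N (hpm i)
    rw [Equiv.Perm.mul_apply, Equiv.Perm.mul_apply, tz _ (hne i h0 hi) h1.1 (hmin i hi) h1.2,
      sN_of h1.1 h1.2, pow_succ', Equiv.Perm.mul_apply]
  have stepN : (ρ * sN m * rf a N) N = (ρ ^ 1) a := by
    rw [Equiv.Perm.mul_apply, Equiv.Perm.mul_apply, tN, sN_of haN.1 haN.2, pow_one]
  have stepr : (ρ * sN m * rf a N) ((ρ ^ r) a) = N := by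
    rw [hra, Equiv.Perm.mul_apply, Equiv.Perm.mul_apply, tna, sN_nN, N_fix hρ]
  have hτB : inB (m + 1) (ρ * sN m * rf a N) :=
    inB_mul (inB_mul (inB_up hρ) (sN_inB m)) (rf_inB (mem_up ha1) (N_mem m) haN.1)
  apply cB_lt_of (ρ * sN m) (mem_up ha1) (N_mem m) haN.1 (u := bInd B)
  · intro u hu
    rw [FixS_s hρ] at hu
    rw [ha.2 u hu, hu.2.1 _ (fun h' => (not_N h').1 rfl)]
  · apply bInd_fix hτB
    · rintro z (rfl | ⟨i, -, -, rfl⟩)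
      · exact N_mem m
      · exact mem_up (hpm i)
    · apply perm_set_iff
      · rintro z (rfl | ⟨i, h1, h2, rfl⟩)
        · rw [stepN]; exact Or.inr ⟨1, le_refl _, hr0, rfl⟩
        · rcases eq_or_lt_of_le h2 with h | h
          · rw [h, stepr]; exact Or.inl rfl
          · rw [step i h1 h]; exact Or.inr ⟨i + 1, by omega, h, rfl⟩
      · rintro z (rfl | ⟨i, h1, h2, rfl⟩)
        · exact ⟨(ρ ^ r) a, Or.inr ⟨r, hr0, le_refl _, rfl⟩, stepr⟩
        · rcases eq_or_lt_of_le h1 with h | h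
          · rw [← h]; exact ⟨N, Or.inl rfl, stepN⟩
          · refine ⟨(ρ ^ (i - 1)) a, Or.inr ⟨i - 1, by omega, by omega, rfl⟩, ?_⟩
            rw [step (i - 1) (by omega) (by omega), Nat.sub_add_cancel h1]
    · rintro z (rfl | ⟨i, h1, h2, rfl⟩) (h' | ⟨k, h3, h4, h5⟩)
      · omega
      · exact (not_N (hpm k)).2 h5
      · exact (not_N (hpm i)).2 (by omega)
      · rcases lt_trichotomy i k with h | h | h
        · exact hdiff i k h2 h3 h h4 h1 (by omega)
        · rw [h] at h5; have := (hpm k).1; omega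
        · exact hdiff k i h4 h1 h h2 h3 h5
  · intro hu
    rw [FixS_s hρ] at hu
    have := hu.2.1 N (fun h' => (not_N h').1 rfl)
    unfold bInd at this
    rw [if_pos (show N ∈ B from Or.inl rfl)] at this
    norm_num at this

theorem caseC (hm : 0 < m) (j : ℕ) :
    {τ | τ ∈ Sn m j ∧ τ ((m : ℤ) + 1) ≠ (m : ℤ) + 1 ∧ τ ((m : ℤ) + 1) ≠ -((m : ℤ) + 1)} =
      (fun p : Equiv.Perm ℤ × ℤ => p.1 * sN m * rf p.2 ((m : ℤ) + 1)) ''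
        {p | NCm m p.1 ∧ cB m p.1 + 1 = j ∧ Zpt m p.1 p.2} := by
  ext τ
  have hN0 : (m : ℤ) + 1 ≠ 0 := by omega
  constructor
  · rintro ⟨⟨h1, h2, h3⟩, h4, h5⟩
    set a : ℤ := -(τ⁻¹ ((m : ℤ) + 1)) with ha
    have hta : τ a = -((m : ℤ) + 1) := by
      rw [ha, h1.1, show ∀ y, τ (τ⁻¹ y) = y from τ.apply_symm_apply]
    have ha1 : a ∈ signedSet m := by
      apply mem_down
      · rw [ha, neg_mem_signed]; exact (inB_mem (inB_inv h1)).mpr (N_mem m)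
      · intro h; rw [h] at hta; exact h5 hta
      · intro h; rw [h, h1.1] at hta; apply h4; omega
    have haN := not_N ha1
    have ha0 : a ≠ 0 := ha1.1
    set t := rf a ((m : ℤ) + 1) with ht
    have htt : t * t = 1 := rf_sq ha0 hN0 haN.1
    have htB : inB (m + 1) t := rf_inB (mem_up ha1) (N_mem m) haN.1
    set ρ := τ * t * sN m with hρ
    have e1 : ρ * sN m = τ * t := by rw [hρ, mul_assoc, sN_sq, mul_one]
    have e2 : ρ * sN m * t = τ := by rw [e1, mul_assoc, htt, mul_one]
    have hρB : inB m ρ := by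
      apply inB_down (inB_mul (inB_mul h1 htB) (sN_inB m))
      rw [Equiv.Perm.mul_apply, Equiv.Perm.mul_apply, sN_N, htB.1, ht, rf_right ha0 hN0 haN.1, h1.1,
        hta, neg_neg]
    have hκB : inB m (ρ⁻¹ * gammaDisc m) := inB_mul (inB_inv hρB) (gd_inB hm)
    have k1 := cB_s hρB
    have k2 := kapB hm hρB
    have k3 := kapB' hm hρB
    set σ := τ⁻¹ * gammaPQ m 1 with hσ
    have hσB : inB (m + 1) σ := inB_mul (inB_inv h1) (gpq_inB hm)
    have tinv : t⁻¹ = t := rf_inv ha0 hN0 haN.1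
    have e3 : (ρ * sN m)⁻¹ * gammaPQ m 1 = t * σ := by
      rw [e1, mul_inv_rev, tinv, mul_assoc]
    have hσN : σ ((m : ℤ) + 1) = a := by
      have : (t * σ) ((m : ℤ) + 1) = (m : ℤ) + 1 := by rw [← e3, k3]; exact N_fix hκB
      rw [Equiv.Perm.mul_apply] at this
      have h6 : t a = (m : ℤ) + 1 := rf_left ha0 hN0 haN.1
      exact t.injective (this.trans h6.symm)
    have k4 : cB (m + 1) (t * σ) = cB (m + 1) σ + 1 := by
      have h6 : σ⁻¹ a = (m : ℤ) + 1 := by rw [← hσN]; exact σ.symm_apply_apply _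
      have h8 : (σ⁻¹)⁻¹ = σ := inv_inv σ
      have h7 := cB_split (inB_inv hσB) (N_mem m) haN.1.symm h6
      have h9 : rf ((m : ℤ) + 1) a = t := by
        ext z
        rw [ht, rf_apply _ _ hN0 ha0 haN.1.symm, rf_apply _ _ ha0 hN0 haN.1]
        split_ifs <;> omega
      rw [h9, cB_inv, ← cB_inv (m + 1) (σ⁻¹ * t), mul_inv_rev, h8, tinv] at h7
      exact h7
    rw [e3] at k2
    have k5 := cB_mul_rf τ (mem_up ha1) (N_mem m) haN.1
    rw [← ht, ← e1] at k5
    have k6 := cB_add_le (n := m) ρ (gammaDisc m) (gd_cB hm)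
    refine ⟨(ρ, a), ⟨⟨hρB, by simp only; omega⟩, by simp only; omega, ha1, ?_⟩, e2⟩
    intro v hv
    by_contra hc
    simp only at hv hc
    have h6 := cB_le_of (ρ * sN m) (mem_up ha1) (N_mem m) haN.1 v (by rw [FixS_s hρB]; exact hv)
      (by rw [hv.2.1 _ (fun h' => (not_N h').1 rfl)]; exact hc)
    rw [← ht, e2] at h6
    omega
  · rintro ⟨⟨ρ, a⟩, ⟨h1, h2, h3⟩, rfl⟩
    simp only at h1 h2 h3 ⊢
    have ha1 := h3.1
    have haN := not_N ha1
    have ha0 : a ≠ 0 := ha1.1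
    have k1 := cB_s h1.1
    have k2 := kapB hm h1.1
    have k3 := Z_split h1.1 h3
    have hρN : ρ a ∈ signedSet m := (inB_mem h1.1).mpr ha1
    have ev : (ρ * sN m * rf a ((m : ℤ) + 1)) ((m : ℤ) + 1) = ρ a := by
      rw [Equiv.Perm.mul_apply, Equiv.Perm.mul_apply, rf_right ha0 hN0 haN.1, sN_of haN.1 haN.2]
    have hB : inB (m + 1) (ρ * sN m * rf a ((m : ℤ) + 1)) :=
      inB_mul (inB_mul (inB_up h1.1) (sN_inB m)) (rf_inB (mem_up ha1) (N_mem m) haN.1)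
    have k4 := cB_add_le (n := m + 1) (ρ * sN m * rf a ((m : ℤ) + 1)) (gammaPQ m 1) (gpq_cB hm)
    have k5 := cB_rf_mul (n := m + 1) ((ρ * sN m)⁻¹ * gammaPQ m 1) (mem_up ha1) (N_mem m) haN.1
    rw [← mul_assoc] at k5
    have e : (ρ * sN m * rf a ((m : ℤ) + 1))⁻¹ * gammaPQ m 1 =
        rf a ((m : ℤ) + 1) * (ρ * sN m)⁻¹ * gammaPQ m 1 := by
      rw [mul_inv_rev (ρ * sN m), rf_inv ha0 hN0 haN.1]
    have h1' := h1.2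
    refine ⟨⟨hB, ?_, ?_⟩, ?_, ?_⟩
    · rw [e] at k4 ⊢; omega
    · omega
    · rw [ev]; exact (not_N hρN).1
    · rw [ev]; exact (not_N hρN).2

theorem injC : Set.InjOn (fun p : Equiv.Perm ℤ × ℤ => p.1 * sN m * rf p.2 ((m : ℤ) + 1))
    {p | inB m p.1 ∧ p.2 ∈ signedSet m} := by
  rintro ⟨ρ, a⟩ ⟨h1, h2⟩ ⟨ρ', a'⟩ ⟨h1', h2'⟩ he
  simp only at h1 h2 h1' h2' he
  have hN0 : (m : ℤ) + 1 ≠ 0 := by omega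
  have key : ∀ {ρ : Equiv.Perm ℤ} {a : ℤ}, inB m ρ → a ∈ signedSet m →
      (ρ * sN m * rf a ((m : ℤ) + 1)) (-a) = (m : ℤ) + 1 := by
    intro ρ a h1 h2
    have haN := not_N h2
    rw [Equiv.Perm.mul_apply, Equiv.Perm.mul_apply, (rf_inB (mem_up h2) (N_mem m) haN.1).1,
      rf_left h2.1 hN0 haN.1, sN_nN, N_fix h1]
  have k1 := key h1 h2
  have k2 := key h1' h2'
  rw [he] at k1
  have ha : a = a' := by have := Equiv.injective _ (k1.trans k2.symm); omega
  subst ha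
  have := mul_right_cancel (mul_right_cancel he)
  rw [this]

theorem card_Sn (hm : 0 < m) (j : ℕ) (hfin : (Sn m j).Finite) :
    (Sn m j).ncard = (m + 1).choose j ^ 2 := by
  have hsplit : Sn m j = ({τ | τ ∈ Sn m j ∧ τ ((m : ℤ) + 1) = (m : ℤ) + 1} ∪
      {τ | τ ∈ Sn m j ∧ τ ((m : ℤ) + 1) = -((m : ℤ) + 1)}) ∪
      {τ | τ ∈ Sn m j ∧ τ ((m : ℤ) + 1) ≠ (m : ℤ) + 1 ∧ τ ((m : ℤ) + 1) ≠ -((m : ℤ) + 1)} := by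
    ext τ
    simp only [Set.mem_union, Set.mem_ofPred_eq]
    tauto
  have cA : {τ | τ ∈ Sn m j ∧ τ ((m : ℤ) + 1) = -((m : ℤ) + 1)}.ncard = m.choose j ^ 2 := by
    rw [caseB hm, Set.ncard_image_of_injective _ (mul_left_injective _), card_N hm]
  have f1 : {τ | τ ∈ Sn m j ∧ τ ((m : ℤ) + 1) = (m : ℤ) + 1}.Finite := hfin.subset (fun _ h => h.1)
  have f2 : {τ | τ ∈ Sn m j ∧ τ ((m : ℤ) + 1) = -((m : ℤ) + 1)}.Finite :=
    hfin.subset (fun _ h => h.1)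
  have f3 : {τ | τ ∈ Sn m j ∧ τ ((m : ℤ) + 1) ≠ (m : ℤ) + 1 ∧
      τ ((m : ℤ) + 1) ≠ -((m : ℤ) + 1)}.Finite := hfin.subset (fun _ h => h.1)
  have hin : Set.InjOn (fun p : Equiv.Perm ℤ × ℤ => p.1 * sN m * rf p.2 ((m : ℤ) + 1))
      {p | NCm m p.1 ∧ cB m p.1 + 1 = j ∧ Zpt m p.1 p.2} :=
    Set.InjOn.mono (fun p hp => show inB m p.1 ∧ p.2 ∈ signedSet m from ⟨hp.1.1, hp.2.2.1⟩) injC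
  rw [hsplit, Set.ncard_union_eq ?_ (f1.union f2) f3, Set.ncard_union_eq ?_ f1 f2, cA, caseA hm,
    caseC hm, Set.InjOn.ncard_image hin]
  · cases j with
    | zero =>
      simp
    | succ j =>
      simp only [Nat.add_right_cancel_iff]
      rw [card_N hm, card_M hm, Nat.choose_succ_succ]
      ring
  · rw [Set.disjoint_left]
    rintro τ ⟨-, h⟩ ⟨-, h'⟩
    omega
  · rw [Set.disjoint_left]
    rintro τ (⟨-, h⟩ | ⟨-, h⟩) ⟨-, h', h''⟩
    · exact h' h
    · exact h'' h
end annC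

theorem inB_finite (n : ℕ) : {τ | inB n τ}.Finite := by
  classical
  have hs : Finite (signedSet n) := (signed_finite n).to_subtype
  let f : {τ | inB n τ} → (signedSet n → signedSet n) := fun τ z =>
    ⟨τ.1 z.1, (inB_mem τ.2).mpr z.2⟩
  have hf : Function.Injective f := by
    rintro ⟨τ, h⟩ ⟨τ', h'⟩ he
    apply Subtype.ext
    ext z
    by_cases hz : z ∈ signedSet n
    · have := congrArg Subtype.val (congrFun he ⟨z, hz⟩)
      exact this
    · show τ z = τ' z
      rw [h.2 z hz, h'.2 z hz]
  exact Set.finite_coe_iff.mp (Finite.of_injective f hf)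

/-- For every integer `n ≥ 2` and every `0 ≤ k ≤ n`, the number of partitions
`π ∈ NC^B(n-1,1)` with `rank(π) = k` equals `C(n,k)²`. -/
theorem ncb_nm1_1_rank_card (n k : ℕ) (hn : 2 ≤ n) (hk : k ≤ n) :
    {π | π ∈ NCB (n - 1) 1 ∧ rankNCB (n - 1 + 1) π = k}.ncard = (Nat.choose n k) ^ 2 := by
  obtain ⟨m, rfl⟩ : ∃ m, n = m + 1 := ⟨n - 1, by omega⟩
  have hm : 0 < m := by omega
  rw [Nat.add_sub_cancel]
  have e : {π | π ∈ NCB m 1 ∧ rankNCB (m + 1) π = k} = omegaTilde (m + 1) '' Sn m (m + 1 - k) := by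
    ext π
    constructor
    · rintro ⟨⟨τ, ⟨h1, h2⟩, rfl⟩, h3⟩
      rw [leB_iff h1 (gpq_inB hm) (gpq_cB hm)] at h2
      rw [rank_omega h1] at h3
      have := cB_le (m + 1) τ
      exact ⟨τ, ⟨h1, h2, by omega⟩, rfl⟩
    · rintro ⟨τ, ⟨h1, h2, h3⟩, rfl⟩
      refine ⟨⟨τ, ⟨h1, ?_⟩, rfl⟩, ?_⟩
      · rw [leB_iff h1 (gpq_inB hm) (gpq_cB hm)]; exact h2
      · rw [rank_omega h1]; omega
  rw [e, Set.InjOn.ncard_image, card_Sn hm _ ((inB_finite (m + 1)).subset (fun _ h => h.1)),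
    Nat.choose_symm hk]
  rintro τ ⟨h1, h2, -⟩ τ' ⟨h1', h2', -⟩ he
  exact brady_watt (gpq_inB hm) (gpq_cB hm) h1 h1' h2 h2' (FixS_eq_of_omega h1 h1' he)
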